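/- Let q be a prime power with q ≥ 5. Every uniformizationally rigid Drinfeldian domain over F_q is isomorphic as an F_q-algebra to the polynomial ring F_q[T]. -/

import Mathlib

open Matrix Polynomial

/-- The unipotent matrix `[[1,a],[0,1]]` as an element of `GL₂(R)`. -/
def unipGL {R : Type*} [CommRing R] (a : R) : GL (Fin 2) R :=
  ⟨!![1, a; 0, 1], !![1, -a; 0, 1],
    by simp [Matrix.mul_fin_two, Matrix.one_fin_two],
    by simp [Matrix.mul_fin_two, Matrix.one_fin_two]⟩

/-- The quasi-level of a subgroup `Γ ≤ GL₂(R)`: the set of `a ∈ R` such that the unipotent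
matrix `[[1,a],[0,1]]` lies in `g Γ g⁻¹` for every `g ∈ GL₂(R)`. -/
def quasiLevelGL {R : Type*} [CommRing R] (Γ : Subgroup (GL (Fin 2) R)) : Set R :=
  {a : R | ∀ g : GL (Fin 2) R, g⁻¹ * unipGL a * g ∈ Γ}

/-- `B` is a Drinfeldian domain over the finite field `Fq`: a Dedekind domain which is not a
field, finitely generated as an `Fq`-algebra, whose fraction field `K` has `Fq` algebraically
closed in it, and which has exactly one place of `K` "at infinity", i.e. exactly one valuation
subring of `K` containing the image of `Fq` but not containing the image of `B`. -/
structure IsDrinfeldianDomain (Fq : Type*) [Field Fq] [Fintype Fq]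
    (B : Type*) [CommRing B] [IsDomain B] [Algebra Fq B] : Prop where
  isDedekind : IsDedekindDomain B
  not_isField : ¬ IsField B
  finiteType : Algebra.FiniteType Fq B
  algebraicallyClosed : ∀ x : FractionRing B,
    (∃ f : Polynomial Fq, f ≠ 0 ∧
      Polynomial.eval₂ ((algebraMap B (FractionRing B)).comp (algebraMap Fq B)) x f = 0) →
    x ∈ ((algebraMap B (FractionRing B)).comp (algebraMap Fq B)).range
  unique_infinite_place : ∃! v : ValuationSubring (FractionRing B),
    (∀ c : Fq, ((algebraMap B (FractionRing B)).comp (algebraMap Fq B)) c ∈ v) ∧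
    ¬ (∀ b : B, algebraMap B (FractionRing B) b ∈ v)

/-- `B` is uniformizationally rigid: the set of finite-index subgroups of `GL₂(B)` of
nonzero level (i.e. whose quasi-level contains a nonzero ideal of `B`) is countable. -/
def IsUniformizationallyRigid (B : Type*) [CommRing B] : Prop :=
  {Γ : Subgroup (GL (Fin 2) B) | Γ.FiniteIndex ∧
    ∃ I : Ideal B, I ≠ ⊥ ∧ (I : Set B) ⊆ quasiLevelGL Γ}.Countable

section
open Polynomial

theorem int_of_val {A K : Type*} [CommRing A] [Field K] (φ : A →+* K) (x : K)
    (h : ∀ W : ValuationSubring K, (∀ a, φ a ∈ W) → x ∈ W) : φ.IsIntegralElem x := by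
  have h1 : x ∈ (⨅ V : {V : ValuationSubring K // (φ.range : Set K) ⊆ V.toSubring},
      V.1.toSubring) := by
    rw [Subring.mem_iInf]
    intro V
    exact h V.1 (fun a => V.2 ⟨a, rfl⟩)
  rw [iInf_valuationSubring_superset] at h1
  have h2 : IsIntegral (Subring.closure (φ.range : Set K)) x := h1
  rw [Subring.closure_eq] at h2
  obtain ⟨p, hp, hx⟩ := h2
  have hs : p ∈ Polynomial.lifts φ.rangeRestrict := by
    rw [Polynomial.lifts_iff_coeff_lifts]
    intro n
    exact φ.rangeRestrict_surjective _
  obtain ⟨r, hr, -, hm⟩ := Polynomial.lifts_and_degree_eq_and_monic hs hp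
  refine ⟨r, hm, ?_⟩
  rw [← hr, Polynomial.eval₂_map] at hx
  exact hx

structure InfPlace (k B : Type*) [Field k] [CommRing B] [IsDomain B] [Algebra k B]
    (V : ValuationSubring (FractionRing B)) : Prop where
  hk : ∀ c : k, algebraMap B (FractionRing B) (algebraMap k B c) ∈ V
  hn : ∃ b : B, algebraMap B (FractionRing B) b ∉ V
  hu : ∀ W : ValuationSubring (FractionRing B),
    (∀ c : k, algebraMap B (FractionRing B) (algebraMap k B c) ∈ W) →
    W ≠ V → ∀ b : B, algebraMap B (FractionRing B) b ∈ W
  hc : ∀ b : FractionRing B, (algebraMap k (FractionRing B)).IsIntegralElem b →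
    ∃ c : k, algebraMap k (FractionRing B) c = b
  ft : Algebra.FiniteType k B

namespace InfPlace
variable {k B : Type*} [Field k] [CommRing B] [IsDomain B] [Algebra k B]
  {V : ValuationSubring (FractionRing B)}


theorem const (h : InfPlace k B V) {b : B} (hb : (algebraMap B (FractionRing B)) b ∈ V) : ∃ c : k, algebraMap k B c = b := by
  obtain ⟨c, hc⟩ := h.hc ((algebraMap B (FractionRing B)) b) (by
    apply int_of_val
    intro W hW
    by_cases hWV : W = V
    · rw [hWV]; exact hb
    · exact h.hu W (fun c => by
        rw [← IsScalarTower.algebraMap_apply]; exact hW c) hWV b)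
  refine ⟨c, ?_⟩
  rw [IsScalarTower.algebraMap_apply k B] at hc
  exact IsFractionRing.injective B (FractionRing B) hc

theorem inv_mem (h : InfPlace k B V) {b : B} (hb : b ≠ 0) : ((algebraMap B (FractionRing B)) b)⁻¹ ∈ V := by
  rcases V.mem_or_inv_mem ((algebraMap B (FractionRing B)) b) with h1 | h1
  · obtain ⟨c, rfl⟩ := h.const h1
    have h2 := h.hk c⁻¹
    rw [← IsScalarTower.algebraMap_apply, map_inv₀] at h2
    rwa [← IsScalarTower.algebraMap_apply]
  · exact h1

theorem exists_pow (h : InfPlace k B V) {g : FractionRing B} (hg : g ∉ V) (z : FractionRing B) :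
    ∃ N : ℕ, z * g⁻¹ ^ N ∈ V := by
  have hgi : g⁻¹ ∈ V := (V.mem_or_inv_mem g).resolve_left hg
  have hg0 : g ≠ 0 := by rintro rfl; exact hg V.zero_mem
  have mono : ∀ (w : FractionRing B) (N M : ℕ), N ≤ M → w * g⁻¹ ^ N ∈ V → w * g⁻¹ ^ M ∈ V := by
    intro w N M hNM hw
    obtain ⟨d, rfl⟩ := Nat.exists_eq_add_of_le hNM
    rw [pow_add, ← mul_assoc]
    exact V.mul_mem _ _ hw (pow_mem hgi d)
  let S : Subring (FractionRing B) :=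
    { carrier := {w | ∃ N : ℕ, w * g⁻¹ ^ N ∈ V}
      mul_mem' := by
        rintro a b ⟨N, hN⟩ ⟨M, hM⟩
        refine ⟨N + M, ?_⟩
        have : a * b * g⁻¹ ^ (N + M) = (a * g⁻¹ ^ N) * (b * g⁻¹ ^ M) := by ring
        rw [this]; exact V.mul_mem _ _ hN hM
      one_mem' := ⟨0, by simp⟩
      add_mem' := by
        rintro a b ⟨N, hN⟩ ⟨M, hM⟩
        refine ⟨max N M, ?_⟩
        rw [add_mul]
        exact V.add_mem _ _ (mono _ _ _ (le_max_left _ _) hN) (mono _ _ _ (le_max_right _ _) hM)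
      zero_mem' := ⟨0, by simp⟩
      neg_mem' := by
        rintro a ⟨N, hN⟩
        refine ⟨N, ?_⟩
        rw [neg_mul]; exact V.neg_mem _ hN }
  have hVS : V.toSubring ≤ S := fun a ha => ⟨0, by simpa using ha⟩
  let W := ValuationSubring.ofLE V S hVS
  have hW : ∀ a, a ∈ W ↔ ∃ N : ℕ, a * g⁻¹ ^ N ∈ V := fun a => Iff.rfl
  have hne : W ≠ V := by
    intro e
    apply hg
    rw [← e, hW]
    exact ⟨1, by rw [pow_one, mul_inv_cancel₀ hg0]; exact V.one_mem⟩
  have hB := h.hu W (fun c => (hW _).2 ⟨0, by simpa using h.hk c⟩) hne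
  obtain ⟨a, b, hb, rfl⟩ := IsFractionRing.div_surjective (A := B) z
  rw [← hW, div_eq_mul_inv]
  exact W.mul_mem _ _ (hB a) ((hW _).2 ⟨0, by simpa using h.inv_mem (nonZeroDivisors.ne_zero hb)⟩)

theorem fin_aux (h : InfPlace k B V) {y : B} (hy : (algebraMap B (FractionRing B)) y ∉ V) :
    Module.Finite k (B ⧸ Ideal.span {y}) := by
  have hft := h.ft
  let φ : k[X] →ₐ[k] B := Polynomial.aeval y
  have hintg : φ.toRingHom.IsIntegral := by
    intro b
    have h1 : (((algebraMap B (FractionRing B))).comp φ.toRingHom).IsIntegralElem ((algebraMap B (FractionRing B)) b) := by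
      apply int_of_val
      intro W hW
      apply h.hu W
      · intro c
        have := hW (C c)
        simpa [φ] using this
      · rintro rfl
        apply hy
        have := hW X
        simpa [φ] using this
    obtain ⟨p, hp, hx⟩ := h1
    refine ⟨p, hp, ?_⟩
    rw [← Polynomial.hom_eval₂] at hx
    exact (injective_iff_map_eq_zero _).1 (IsFractionRing.injective B (FractionRing B)) _ hx
  have hfin : φ.toRingHom.Finite := by
    apply RingHom.IsIntegral.to_finite hintg
    have h2 : (φ.toRingHom.comp (algebraMap k k[X])).FiniteType := by
      have : φ.toRingHom.comp (algebraMap k k[X]) = algebraMap k B := by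
        ext c; simp [φ]
      rw [this]
      exact (RingHom.finiteType_algebraMap).2 h.ft
    exact RingHom.FiniteType.of_comp_finiteType h2
  let _ := φ.toRingHom.toAlgebra
  have hfin' : Module.Finite k[X] B := hfin
  obtain ⟨s, hs⟩ := hfin'
  classical
  refine ⟨s.image (Ideal.Quotient.mk (Ideal.span {y})), ?_⟩
  rw [eq_top_iff]
  rintro z -
  obtain ⟨b, rfl⟩ := Ideal.Quotient.mk_surjective z
  have hb : b ∈ Submodule.span k[X] (s : Set B) := by rw [hs]; trivial
  induction hb using Submodule.span_induction with
  | mem x hx =>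
    apply Submodule.subset_span
    rw [Finset.coe_image]
    exact ⟨x, hx, rfl⟩
  | zero => simp
  | add x z _ _ hx hz => rw [map_add]; exact Submodule.add_mem _ hx hz
  | smul p x _ hx =>
    have e : Ideal.Quotient.mk (Ideal.span {y}) (p • x)
        = (p.coeff 0) • Ideal.Quotient.mk (Ideal.span {y}) x := by
      have e1 : p • x = aeval y p * x := rfl
      have e2 : (p.coeff 0) • Ideal.Quotient.mk (Ideal.span {y}) x
        = Ideal.Quotient.mk (Ideal.span {y}) (p.coeff 0 • x) := rfl
      rw [e1, e2, Ideal.Quotient.eq, Ideal.mem_span_singleton, Algebra.smul_def, ← sub_mul]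
      apply Dvd.dvd.mul_right
      have := Polynomial.X_dvd_sub_C (p := p)
      obtain ⟨r, hr⟩ := this
      refine ⟨aeval y r, ?_⟩
      have := congrArg (aeval y) hr
      simpa using this
    rw [e]
    exact Submodule.smul_mem _ _ hx

theorem isUnit_of_mem (h : InfPlace k B V) {b : B} (hb0 : b ≠ 0) (hb : (algebraMap B (FractionRing B)) b ∈ V) : IsUnit b := by
  obtain ⟨c, rfl⟩ := h.const hb
  have : c ≠ 0 := by rintro rfl; simp at hb0
  exact (IsUnit.mk0 c this).map (algebraMap k B)

theorem fin (h : InfPlace k B V) {b : B} (hb0 : b ≠ 0) :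
    Module.Finite k (B ⧸ Ideal.span {b}) := by
  by_cases hb : (algebraMap B (FractionRing B)) b ∈ V
  · have := h.isUnit_of_mem hb0 hb
    rw [Ideal.span_singleton_eq_top.2 this]
    infer_instance
  · exact h.fin_aux hb

/-- the Riemann–Roch like space -/
def Lsp (h : InfPlace k B V) (g : FractionRing B) : Submodule k B where
  carrier := {b | (algebraMap B (FractionRing B)) b * g⁻¹ ∈ V}
  zero_mem' := by simp
  add_mem' := by
    intro a b ha hb
    simp only [Set.mem_ofPred_eq, map_add, add_mul] at *
    exact V.add_mem _ _ ha hb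
  smul_mem' := by
    intro c b hb
    simp only [Set.mem_ofPred_eq, Algebra.smul_def, map_mul, mul_assoc] at *
    exact V.mul_mem _ _ (h.hk c) hb

theorem mem_Lsp (h : InfPlace k B V) (g : FractionRing B) (b : B) :
    b ∈ h.Lsp g ↔ (algebraMap B (FractionRing B)) b * g⁻¹ ∈ V := Iff.rfl

theorem Lsp_fin (h : InfPlace k B V) {g : FractionRing B} (hg : g ≠ 0) :
    Module.Finite k (h.Lsp g) := by
  obtain ⟨x, hx⟩ := h.hn
  have hx0 : (algebraMap B (FractionRing B)) x ≠ 0 := by intro e; rw [e] at hx; exact hx V.zero_mem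
  obtain ⟨N, hN⟩ := h.exists_pow hx g
  have hx0' : x ≠ 0 := by rintro rfl; simp at hx0
  have hfin : Module.Finite k (B ⧸ Ideal.span {x ^ (N+1)}) := h.fin (pow_ne_zero _ hx0')
  let f : h.Lsp g →ₗ[k] (B ⧸ Ideal.span {x ^ (N+1)}) :=
    (Ideal.Quotient.mkₐ k (Ideal.span {x ^ (N+1)})).toLinearMap.comp (h.Lsp g).subtype
  apply Module.Finite.of_injective f
  rw [← LinearMap.ker_eq_bot, LinearMap.ker_eq_bot']
  rintro ⟨b, hb⟩ hfb
  have : Ideal.Quotient.mk (Ideal.span {x ^ (N+1)}) b = 0 := hfb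
  rw [Ideal.Quotient.eq_zero_iff_mem, Ideal.mem_span_singleton] at this
  obtain ⟨c, rfl⟩ := this
  by_cases hc : c = 0
  · subst hc; simp
  exfalso
  rw [mem_Lsp] at hb
  apply hx
  have hc' : (algebraMap B (FractionRing B)) c ≠ 0 := by simpa using hc
  have h1 := V.mul_mem _ _ (V.mul_mem _ _ hb hN) (h.inv_mem hc)
  convert h1 using 1
  rw [map_mul, map_pow]
  (try simp only [inv_pow]); field_simp
  ring

theorem exists_pow_fin (h : InfPlace k B V) {x : B} (hx : (algebraMap B (FractionRing B)) x ∉ V) (s : Finset B) :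
    ∃ N : ℕ, ∀ z ∈ s, (algebraMap B (FractionRing B)) z * ((algebraMap B (FractionRing B)) x)⁻¹ ^ N ∈ V := by
  classical
  have hxi : ((algebraMap B (FractionRing B)) x)⁻¹ ∈ V := (V.mem_or_inv_mem _).resolve_left hx
  induction s using Finset.induction_on with
  | empty => exact ⟨0, by simp⟩
  | insert a s _ ih =>
    obtain ⟨N, hN⟩ := ih
    obtain ⟨M, hM⟩ := h.exists_pow hx ((algebraMap B (FractionRing B)) a)
    refine ⟨N + M, ?_⟩
    intro z hz
    rw [Finset.mem_insert] at hz
    rcases hz with rfl | hz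
    · have := V.mul_mem _ _ hM (pow_mem hxi N)
      convert this using 1; ring
    · have := V.mul_mem _ _ (hN z hz) (pow_mem hxi M)
      convert this using 1; ring

theorem Lsp_deg (h : InfPlace k B V) {x : B} (hx : (algebraMap B (FractionRing B)) x ∉ V) {b : B} (hb : b ≠ 0) :
    ∃ N : ℕ, ∀ g : FractionRing B, g ≠ 0 → ((algebraMap B (FractionRing B)) x) ^ N * g⁻¹ ∈ V →
      Module.finrank k (h.Lsp ((algebraMap B (FractionRing B)) b * g)) =
        Module.finrank k (h.Lsp g) + Module.finrank k (B ⧸ Ideal.span {b}) := by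
  classical
  have hx0 : (algebraMap B (FractionRing B)) x ≠ 0 := by intro e; rw [e] at hx; exact hx V.zero_mem
  have hb' : (algebraMap B (FractionRing B)) b ≠ 0 := by simpa using hb
  have hfin := h.fin hb
  obtain ⟨s, hs⟩ := hfin
  obtain ⟨t, ht⟩ : ∃ t : Finset B, t.image (Ideal.Quotient.mk (Ideal.span {b})) = s := by
    refine ⟨s.image (Function.surjInv Ideal.Quotient.mk_surjective), ?_⟩
    ext z
    simp [Finset.mem_image, Function.surjInv_eq]
  obtain ⟨N, hN⟩ := h.exists_pow_fin hx t
  refine ⟨N, fun g hg hgx => ?_⟩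
  let f : h.Lsp ((algebraMap B (FractionRing B)) b * g) →ₗ[k] (B ⧸ Ideal.span {b}) :=
    (Ideal.Quotient.mkₐ k (Ideal.span {b})).toLinearMap.comp (h.Lsp ((algebraMap B (FractionRing B)) b * g)).subtype
  have hf : ∀ z : h.Lsp ((algebraMap B (FractionRing B)) b * g), f z = Ideal.Quotient.mk (Ideal.span {b}) z.1 := fun z => rfl
  have hsurj : LinearMap.range f = ⊤ := by
    rw [eq_top_iff, ← hs, Submodule.span_le, ← ht]
    intro z hz
    rw [Finset.coe_image] at hz
    obtain ⟨y, hy, rfl⟩ := hz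
    have hyL : y ∈ h.Lsp ((algebraMap B (FractionRing B)) b * g) := by
      rw [mem_Lsp]
      have := V.mul_mem _ _ (V.mul_mem _ _ (hN y hy) hgx) (h.inv_mem hb)
      convert this using 1
      (try simp only [inv_pow]); field_simp
    exact ⟨⟨y, hyL⟩, rfl⟩
  have := h.Lsp_fin (g := (algebraMap B (FractionRing B)) b * g) (mul_ne_zero hb' hg)
  have h1 := LinearMap.finrank_range_add_finrank_ker f
  rw [hsurj, finrank_top] at h1
  rw [← h1, add_comm]
  congr 1
  have hmul : ∀ c : B, c ∈ h.Lsp g ↔ b * c ∈ h.Lsp ((algebraMap B (FractionRing B)) b * g) := by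
    intro c
    rw [mem_Lsp, mem_Lsp]
    have : (algebraMap B (FractionRing B)) (b * c) * ((algebraMap B (FractionRing B)) b * g)⁻¹ = (algebraMap B (FractionRing B)) c * g⁻¹ := by
      rw [map_mul]; (try simp only [inv_pow]); field_simp
    rw [this]
  let m : h.Lsp g →ₗ[k] LinearMap.ker f :=
    { toFun := fun c => ⟨⟨b * c.1, (hmul c.1).1 c.2⟩, by
        rw [LinearMap.mem_ker, hf, Ideal.Quotient.eq_zero_iff_mem, Ideal.mem_span_singleton]
        exact dvd_mul_right _ _⟩
      map_add' := by
        intro c d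
        apply Subtype.ext; apply Subtype.ext
        simp [mul_add]
      map_smul' := by
        intro c d
        apply Subtype.ext; apply Subtype.ext
        simp }
  symm
  apply LinearEquiv.finrank_eq (LinearEquiv.ofBijective m ⟨?_, ?_⟩)
  · intro c d hcd
    have : b * c.1 = b * d.1 := congrArg (fun z => z.1.1) hcd
    exact Subtype.ext (mul_left_cancel₀ hb this)
  · rintro ⟨⟨c, hc⟩, hc2⟩
    rw [LinearMap.mem_ker, hf, Ideal.Quotient.eq_zero_iff_mem, Ideal.mem_span_singleton] at hc2
    obtain ⟨d, hd⟩ := hc2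
    simp only at hd
    subst hd
    exact ⟨⟨d, (hmul d).2 hc⟩, rfl⟩

theorem deg_mul (h : InfPlace k B V) {a b : B} (ha : a ≠ 0) (hb : b ≠ 0) :
    Module.finrank k (B ⧸ Ideal.span {a * b}) = Module.finrank k (B ⧸ Ideal.span {a})
      + Module.finrank k (B ⧸ Ideal.span {b}) := by
  obtain ⟨x, hx⟩ := h.hn
  have hx0 : (algebraMap B (FractionRing B)) x ≠ 0 := by intro e; rw [e] at hx; exact hx V.zero_mem
  have hxi : ((algebraMap B (FractionRing B)) x)⁻¹ ∈ V := (V.mem_or_inv_mem _).resolve_left hx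
  have ha' : (algebraMap B (FractionRing B)) a ≠ 0 := by simpa using ha
  have hb' : (algebraMap B (FractionRing B)) b ≠ 0 := by simpa using hb
  obtain ⟨N1, h1⟩ := h.Lsp_deg hx ha
  obtain ⟨N2, h2⟩ := h.Lsp_deg hx hb
  obtain ⟨N3, h3⟩ := h.Lsp_deg hx (mul_ne_zero ha hb)
  set M := N1 + N2 + N3
  have e1 := h1 ((algebraMap B (FractionRing B)) b * (algebraMap B (FractionRing B)) x ^ M) (mul_ne_zero hb' (pow_ne_zero _ hx0)) (by
    have := V.mul_mem _ _ (h.inv_mem hb) (pow_mem hxi (N2 + N3))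
    convert this using 1
    simp only [M, pow_add]; (try simp only [inv_pow]); field_simp)
  have e2 := h2 ((algebraMap B (FractionRing B)) x ^ M) (pow_ne_zero _ hx0) (by
    have := (pow_mem hxi (N1 + N3))
    convert this using 1
    simp only [M, pow_add]; (try simp only [inv_pow]); field_simp)
  have e3 := h3 ((algebraMap B (FractionRing B)) x ^ M) (pow_ne_zero _ hx0) (by
    have := (pow_mem hxi (N1 + N2))
    convert this using 1
    simp only [M, pow_add]; (try simp only [inv_pow]); field_simp)
  rw [map_mul, mul_assoc] at e3
  omega

theorem deg_le (h : InfPlace k B V) {b c : B} (hb : b ≠ 0) (hc : c ≠ 0)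
    (hbc : (algebraMap B (FractionRing B)) b / (algebraMap B (FractionRing B)) c ∈ V) :
    Module.finrank k (B ⧸ Ideal.span {b}) ≤ Module.finrank k (B ⧸ Ideal.span {c}) := by
  obtain ⟨x, hx⟩ := h.hn
  have hx0 : (algebraMap B (FractionRing B)) x ≠ 0 := by intro e; rw [e] at hx; exact hx V.zero_mem
  have hxi : ((algebraMap B (FractionRing B)) x)⁻¹ ∈ V := (V.mem_or_inv_mem _).resolve_left hx
  have hb' : (algebraMap B (FractionRing B)) b ≠ 0 := by simpa using hb
  have hc' : (algebraMap B (FractionRing B)) c ≠ 0 := by simpa using hc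
  obtain ⟨N1, h1⟩ := h.Lsp_deg hx hb
  obtain ⟨N2, h2⟩ := h.Lsp_deg hx hc
  set M := N1 + N2
  have e1 := h1 ((algebraMap B (FractionRing B)) x ^ M) (pow_ne_zero _ hx0) (by
    have := (pow_mem hxi (N2))
    convert this using 1
    simp only [M, pow_add]; (try simp only [inv_pow]); field_simp)
  have e2 := h2 ((algebraMap B (FractionRing B)) x ^ M) (pow_ne_zero _ hx0) (by
    have := (pow_mem hxi (N1))
    convert this using 1
    simp only [M, pow_add]; (try simp only [inv_pow]); field_simp)
  have := h.Lsp_fin (mul_ne_zero hc' (pow_ne_zero M hx0))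
  have h3 : Module.finrank k (h.Lsp ((algebraMap B (FractionRing B)) b * (algebraMap B (FractionRing B)) x ^ M)) ≤ Module.finrank k (h.Lsp ((algebraMap B (FractionRing B)) c * (algebraMap B (FractionRing B)) x ^ M)) := by
    apply Submodule.finrank_mono
    intro z hz
    rw [mem_Lsp] at *
    have := V.mul_mem _ _ hz hbc
    convert this using 1
    (try simp only [inv_pow]); field_simp
  omega

theorem deg_pos (h : InfPlace k B V) {x : B} (hx : (algebraMap B (FractionRing B)) x ∉ V) :
    0 < Module.finrank k (B ⧸ Ideal.span {x}) := by
  have hx0 : x ≠ 0 := by rintro rfl; rw [map_zero] at hx; exact hx V.zero_mem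
  have := h.fin hx0
  rw [Module.finrank_pos_iff, Ideal.Quotient.nontrivial_iff, Ne, Ideal.span_singleton_eq_top]
  rintro ⟨u, rfl⟩
  have h1 := h.inv_mem (b := (↑u⁻¹ : B)) (Units.ne_zero _)
  apply hx
  convert h1
  rw [eq_comm, inv_eq_iff_eq_inv]
  apply eq_inv_of_mul_eq_one_left
  rw [← map_mul]; simp

theorem deg_le_iff (h : InfPlace k B V) {b c : B} (hb : b ≠ 0) (hc : c ≠ 0) :
    (algebraMap B (FractionRing B)) b / (algebraMap B (FractionRing B)) c ∈ V ↔
    Module.finrank k (B ⧸ Ideal.span {b}) ≤ Module.finrank k (B ⧸ Ideal.span {c}) := by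
  refine ⟨h.deg_le hb hc, fun hle => ?_⟩
  by_contra hV
  obtain ⟨x, hx⟩ := h.hn
  have hx0 : x ≠ 0 := by rintro rfl; rw [map_zero] at hx; exact hx V.zero_mem
  have hpow : ∀ (a : B) (n : ℕ), a ≠ 0 → Module.finrank k (B ⧸ Ideal.span {a ^ n})
      = n * Module.finrank k (B ⧸ Ideal.span {a}) := by
    intro a n ha
    induction n with
    | zero =>
      rw [pow_zero, Ideal.span_singleton_one, zero_mul]
      exact Module.finrank_zero_of_subsingleton
    | succ n ih => rw [pow_succ, h.deg_mul (pow_ne_zero _ ha) ha, ih]; ring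
  obtain ⟨n, hn⟩ := h.exists_pow hV ((algebraMap B (FractionRing B)) x)
  have h1 := h.deg_le (b := x * c ^ n) (c := b ^ n) (mul_ne_zero hx0 (pow_ne_zero _ hc))
    (pow_ne_zero _ hb) (by
      convert hn using 1
      rw [map_mul, map_pow, map_pow, inv_div, div_pow, mul_div_assoc])
  rw [h.deg_mul hx0 (pow_ne_zero _ hc), hpow _ _ hc, hpow _ _ hb] at h1
  have h2 := h.deg_pos hx
  have h3 := Nat.mul_le_mul_left n hle
  omega

end InfPlace

/-- A degree function on `B`. -/
structure DegRing (k B : Type*) [Field k] [CommRing B] [IsDomain B] [Algebra k B]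
    (deg : B → ℕ) : Prop where
  zero : deg 0 = 0
  mul : ∀ a b, a ≠ 0 → b ≠ 0 → deg (a * b) = deg a + deg b
  add : ∀ a b, deg (a + b) ≤ max (deg a) (deg b)
  fin : ∀ b : B, b ≠ 0 → Module.Finite k (B ⧸ Ideal.span {b})
  finrank : ∀ b : B, b ≠ 0 → Module.finrank k (B ⧸ Ideal.span {b}) = deg b
  const : ∀ b, deg b = 0 → ∃ c : k, algebraMap k B c = b
  pos : ∃ b, 0 < deg b

open Classical in
theorem InfPlace.exists_deg {k B : Type*} [Field k] [CommRing B] [IsDomain B] [Algebra k B]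
    {V : ValuationSubring (FractionRing B)} (h : InfPlace k B V) :
    ∃ deg : B → ℕ, DegRing k B deg ∧ ∀ b c : B, c ≠ 0 →
      (algebraMap B (FractionRing B) b / algebraMap B (FractionRing B) c ∈ V
        ↔ deg b ≤ deg c) := by
  let deg : B → ℕ := fun b => if b = 0 then 0 else Module.finrank k (B ⧸ Ideal.span {b})
  have h0 : deg 0 = 0 := by simp [deg]
  have hd : ∀ b, b ≠ 0 → deg b = Module.finrank k (B ⧸ Ideal.span {b}) := by
    intro b hb; simp [deg, hb]
  have hle : ∀ b c : B, c ≠ 0 →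
      (algebraMap B (FractionRing B) b / algebraMap B (FractionRing B) c ∈ V
        ↔ deg b ≤ deg c) := by
    intro b c hc
    by_cases hb : b = 0
    · subst hb; simp [h0]
    · rw [hd b hb, hd c hc]; exact h.deg_le_iff hb hc
  have hcon : ∀ b, deg b = 0 → ∃ c : k, algebraMap k B c = b := by
    intro b hb
    by_cases hb0 : b = 0
    · exact ⟨0, by simp [hb0]⟩
    · have := (hle b 1 one_ne_zero).2 (by omega)
      rw [map_one, div_one] at this
      exact h.const this
  refine ⟨deg, ⟨h0, ?_, ?_, fun b hb => h.fin hb, fun b hb => (hd b hb).symm, hcon, ?_⟩, hle⟩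
  · intro a b ha hb
    rw [hd a ha, hd b hb, hd _ (mul_ne_zero ha hb), h.deg_mul ha hb]
  · have key : ∀ a b : B, deg a ≤ deg b → deg (a + b) ≤ deg b := by
      intro a b hab
      by_cases hb : b = 0
      · subst hb; simpa using hab
      rw [← hle _ b hb, map_add, add_div]
      exact V.add_mem _ _ ((hle a b hb).2 hab) ((hle b b hb).2 le_rfl)
    intro a b
    rcases le_total (deg a) (deg b) with hab | hab
    · exact (key a b hab).trans (le_max_right _ _)
    · rw [add_comm]; exact (key b a hab).trans (le_max_left _ _)
  · obtain ⟨x, hx⟩ := h.hn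
    have hx0 : x ≠ 0 := by rintro rfl; rw [map_zero] at hx; exact hx V.zero_mem
    exact ⟨x, by rw [hd x hx0]; exact h.deg_pos hx⟩
end

section
open Polynomial

namespace DegRing
variable {k B : Type*} [Field k] [CommRing B] [IsDomain B] [Algebra k B] {deg : B → ℕ}

theorem isUnit_of_deg (h : DegRing k B deg) {b : B} (hb : b ≠ 0) (hd : deg b = 0) :
    IsUnit b := by
  obtain ⟨c, rfl⟩ := h.const b hd
  have : c ≠ 0 := by rintro rfl; simp at hb
  exact (IsUnit.mk0 c this).map (algebraMap k B)

theorem deg_one (h : DegRing k B deg) : deg 1 = 0 := by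
  have := h.mul 1 1 one_ne_zero one_ne_zero
  rw [one_mul] at this; omega

theorem deg_of_isUnit (h : DegRing k B deg) {b : B} (hb : IsUnit b) : deg b = 0 := by
  obtain ⟨c, hc⟩ := hb.exists_right_inv
  have h1 : b ≠ 0 := hb.ne_zero
  have h2 : c ≠ 0 := by rintro rfl; simp at hc
  have := h.mul b c h1 h2
  rw [hc, h.deg_one] at this; omega

theorem deg_algebraMap (h : DegRing k B deg) (c : k) : deg (algebraMap k B c) = 0 := by
  by_cases hc : c = 0
  · rw [hc, map_zero, h.zero]
  · exact h.deg_of_isUnit ((IsUnit.mk0 c hc).map (algebraMap k B))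

theorem deg_pow (h : DegRing k B deg) {b : B} (hb : b ≠ 0) (n : ℕ) : deg (b ^ n) = n * deg b := by
  induction n with
  | zero => rw [pow_zero, h.deg_one, zero_mul]
  | succ n ih => rw [pow_succ, h.mul _ _ (pow_ne_zero _ hb) hb, ih]; ring

theorem deg_smul_le (h : DegRing k B deg) (c : k) (b : B) : deg (c • b) ≤ deg b := by
  by_cases hc : c = 0
  · rw [hc, zero_smul, h.zero]; omega
  by_cases hb : b = 0
  · rw [hb, smul_zero]
  rw [Algebra.smul_def, h.mul _ _ (by simpa using hc) hb, h.deg_algebraMap]; omega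

theorem deg_smul (h : DegRing k B deg) {c : k} (hc : c ≠ 0) (b : B) : deg (c • b) = deg b := by
  apply le_antisymm (h.deg_smul_le c b)
  have := h.deg_smul_le c⁻¹ (c • b)
  rwa [smul_smul, inv_mul_cancel₀ hc, one_smul] at this

theorem deg_neg (h : DegRing k B deg) (b : B) : deg (-b) = deg b := by
  have := h.deg_smul (c := -1) (by simp) b
  simpa using this

theorem deg_add_eq (h : DegRing k B deg) {a b : B} (hab : deg a < deg b) :
    deg (a + b) = deg b := by
  apply le_antisymm
  · exact (h.add a b).trans (by omega)
  · have := h.add (a + b) (-a)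
    rw [h.deg_neg, add_neg_cancel_comm] at this
    rcases le_max_iff.1 this with h1 | h1 <;> omega

theorem ne_zero_of_pos (h : DegRing k B deg) {b : B} (hb : 0 < deg b) : b ≠ 0 := by
  rintro rfl; rw [h.zero] at hb; omega

/-- elements of degree at most `n`. -/
def L (h : DegRing k B deg) (n : ℕ) : Submodule k B where
  carrier := {b | deg b ≤ n}
  zero_mem' := by simp [h.zero]
  add_mem' := by
    intro a b ha hb
    exact (h.add a b).trans (max_le ha hb)
  smul_mem' := by
    intro c b hb
    exact (h.deg_smul_le c b).trans hb

theorem mem_L (h : DegRing k B deg) (n : ℕ) (b : B) : b ∈ h.L n ↔ deg b ≤ n := Iff.rfl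

theorem deg_sum_le (h : DegRing k B deg) {ι : Type*} (s : Finset ι) (f : ι → B) (n : ℕ)
    (hf : ∀ i ∈ s, deg (f i) ≤ n) : deg (∑ i ∈ s, f i) ≤ n :=
  (h.L n).sum_mem hf

instance L_fin (h : DegRing k B deg) (n : ℕ) : Module.Finite k (h.L n) := by
  obtain ⟨x, hx⟩ := h.pos
  have hx0 := h.ne_zero_of_pos hx
  have := h.fin (x ^ (n + 1)) (pow_ne_zero _ hx0)
  let f : h.L n →ₗ[k] (B ⧸ Ideal.span {x ^ (n+1)}) :=
    (Ideal.Quotient.mkₐ k (Ideal.span {x ^ (n+1)})).toLinearMap.comp (h.L n).subtype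
  apply Module.Finite.of_injective f
  rw [← LinearMap.ker_eq_bot, LinearMap.ker_eq_bot']
  rintro ⟨b, hb⟩ hfb
  have : Ideal.Quotient.mk (Ideal.span {x ^ (n+1)}) b = 0 := hfb
  rw [Ideal.Quotient.eq_zero_iff_mem, Ideal.mem_span_singleton] at this
  obtain ⟨c, rfl⟩ := this
  by_cases hc : c = 0
  · subst hc; simp
  exfalso
  rw [mem_L, h.mul _ _ (pow_ne_zero _ hx0) hc, h.deg_pow hx0] at hb
  have := Nat.mul_le_mul_left (n+1) hx
  omega

instance L_finite (h : DegRing k B deg) [Finite k] (n : ℕ) : Finite (h.L n) :=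
  Module.finite_of_finite k

theorem finite_deg_le (h : DegRing k B deg) [Finite k] (n : ℕ) : {b : B | deg b ≤ n}.Finite :=
  (Set.finite_coe_iff (s := {b : B | deg b ≤ n})).1 (h.L_finite n)

end DegRing
end

section
open Polynomial Matrix

namespace Cusp
section
variable {K : Type*} [Field K] {Γ₀ : Type*} [LinearOrderedCommGroupWithZero Γ₀]

def wedge (u u' : Fin 2 → K) : K := u 0 * u' 1 - u' 0 * u 1

theorem wedge_mulVec (γ : Matrix (Fin 2) (Fin 2) K) (u u' : Fin 2 → K) :
    wedge (γ *ᵥ u) (γ *ᵥ u') = γ.det * wedge u u' := by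
  simp [wedge, Matrix.mulVec, dotProduct, Fin.sum_univ_two, Matrix.det_fin_two]
  ring

/-- column with the largest pairing with `w` -/
def big (v : Valuation K Γ₀) (w a b : Fin 2 → K) : Fin 2 → K :=
  if v (w ⬝ᵥ a) ≤ v (w ⬝ᵥ b) then b else a

theorem big_le (v : Valuation K Γ₀) (w a b : Fin 2 → K) :
    v (w ⬝ᵥ a) ≤ v (w ⬝ᵥ big v w a b) ∧ v (w ⬝ᵥ b) ≤ v (w ⬝ᵥ big v w a b) := by
  unfold big
  split_ifs with h
  · exact ⟨h, le_rfl⟩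
  · exact ⟨le_rfl, (not_le.1 h).le⟩

theorem big_cases (v : Valuation K Γ₀) (w a b : Fin 2 → K) :
    big v w a b = a ∨ big v w a b = b := by
  unfold big
  split_ifs with h
  · exact Or.inr rfl
  · exact Or.inl rfl

theorem big_mulVec (v : Valuation K Γ₀) (γ : Matrix (Fin 2) (Fin 2) K) (w a b : Fin 2 → K) :
    big v w (γ *ᵥ a) (γ *ᵥ b) = γ *ᵥ big v (w ᵥ* γ) a b := by
  unfold big
  simp only [Matrix.dotProduct_mulVec]
  split_ifs <;> rfl

/-- recover coordinates of `w` from pairings. -/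
theorem coord0 (w a b : Fin 2 → K) : w 0 * wedge a b = (w ⬝ᵥ a) * b 1 - (w ⬝ᵥ b) * a 1 := by
  simp [wedge, dotProduct, Fin.sum_univ_two]; ring

theorem coord1 (w a b : Fin 2 → K) : w 1 * wedge a b = (w ⬝ᵥ b) * a 0 - (w ⬝ᵥ a) * b 0 := by
  simp [wedge, dotProduct, Fin.sum_univ_two]; ring

theorem big_ne (v : Valuation K Γ₀) (w a b : Fin 2 → K) (hw : w ≠ 0) (hab : wedge a b ≠ 0) :
    w ⬝ᵥ big v w a b ≠ 0 := by
  intro h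
  have h1 := big_le v w a b
  rw [h, map_zero, le_zero_iff, le_zero_iff, map_eq_zero, map_eq_zero] at h1
  apply hw
  have e0 := coord0 w a b
  have e1 := coord1 w a b
  rw [h1.1, h1.2] at e0 e1
  simp only [zero_mul, sub_zero, mul_eq_zero, hab, or_false] at e0 e1
  ext i; fin_cases i
  · exact e0
  · exact e1

def diff (v : Valuation K Γ₀) (w a b a' b' : Fin 2 → K) : K :=
  wedge (big v w a b) (big v w a' b') / ((w ⬝ᵥ big v w a b) * (w ⬝ᵥ big v w a' b'))

theorem diff_add (v : Valuation K Γ₀) (w a b a' b' a'' b'' : Fin 2 → K) (hw : w ≠ 0)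
    (h : wedge a b ≠ 0) (h' : wedge a' b' ≠ 0) (h'' : wedge a'' b'' ≠ 0) :
    diff v w a b a' b' + diff v w a' b' a'' b'' = diff v w a b a'' b'' := by
  have n := big_ne v w a b hw h
  have n' := big_ne v w a' b' hw h'
  have n'' := big_ne v w a'' b'' hw h''
  unfold diff
  generalize big v w a b = u at *
  generalize big v w a' b' = u' at *
  generalize big v w a'' b'' = u'' at *
  field_simp
  simp [wedge, dotProduct, Fin.sum_univ_two]; ring

theorem diff_mulVec (v : Valuation K Γ₀) (γ : Matrix (Fin 2) (Fin 2) K) (hγ : γ.det = 1)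
    (w a b a' b' : Fin 2 → K) :
    diff v w (γ *ᵥ a) (γ *ᵥ b) (γ *ᵥ a') (γ *ᵥ b') = diff v (w ᵥ* γ) a b a' b' := by
  unfold diff
  simp only [big_mulVec, wedge_mulVec, hγ, one_mul, Matrix.dotProduct_mulVec]

theorem exists_bound (v : Valuation K Γ₀) (a b : Fin 2 → K) (hab : wedge a b ≠ 0) :
    ∃ c : Γ₀, c ≠ 0 ∧ ∀ (w : Fin 2 → K) (i : Fin 2), v (w i) ≤ c * v (w ⬝ᵥ big v w a b) := by
  have hv : v (wedge a b) ≠ 0 := by simpa using hab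
  set m : Γ₀ := max 1 (max (max (v (a 0)) (v (a 1))) (max (v (b 0)) (v (b 1)))) with hm
  have hm0 : m ≠ 0 := (lt_of_lt_of_le zero_lt_one (le_max_left _ _)).ne'
  have ha0 : v (a 0) ≤ m := by simp [hm]
  have ha1 : v (a 1) ≤ m := by simp [hm]
  have hb0 : v (b 0) ≤ m := by simp [hm]
  have hb1 : v (b 1) ≤ m := by simp [hm]
  refine ⟨m * (v (wedge a b))⁻¹, mul_ne_zero hm0 (inv_ne_zero hv), fun w i => ?_⟩
  obtain ⟨h1, h2⟩ := big_le v w a b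
  set q := v (w ⬝ᵥ big v w a b)
  have key : v (w i) * v (wedge a b) ≤ m * q := by
    rw [← map_mul]
    fin_cases i
    · show v (w 0 * _) ≤ _
      rw [coord0]
      refine (v.map_sub _ _).trans (max_le ?_ ?_)
      · rw [map_mul, mul_comm]; exact mul_le_mul' hb1 h1
      · rw [map_mul, mul_comm]; exact mul_le_mul' ha1 h2
    · show v (w 1 * _) ≤ _
      rw [coord1]
      refine (v.map_sub _ _).trans (max_le ?_ ?_)
      · rw [map_mul, mul_comm]; exact mul_le_mul' ha0 h2
      · rw [map_mul, mul_comm]; exact mul_le_mul' hb0 h1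
  calc v (w i) = v (w i) * v (wedge a b) * (v (wedge a b))⁻¹ := by
        rw [mul_assoc, mul_inv_cancel₀ hv, mul_one]
    _ ≤ m * q * (v (wedge a b))⁻¹ := by gcongr
    _ = _ := by rw [mul_right_comm]

/-- if the difference is large then `w` is small -/
theorem diff_bound (v : Valuation K Γ₀) (a b a' b' : Fin 2 → K) (hab : wedge a b ≠ 0)
    (hab' : wedge a' b' ≠ 0) : ∃ c : Γ₀, c ≠ 0 ∧ ∀ (w : Fin 2 → K), w ≠ 0 →
      1 < v (diff v w a b a' b') → ∀ i j, v (w i) * v (w j) ≤ c := by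
  obtain ⟨c, hc, h⟩ := exists_bound v a b hab
  obtain ⟨c', hc', h'⟩ := exists_bound v a' b' hab'
  set m : Γ₀ := max 1 (max (max (v (wedge a a')) (v (wedge a b')))
    (max (v (wedge b a')) (v (wedge b b')))) with hm
  have hm0 : m ≠ 0 := (lt_of_lt_of_le zero_lt_one (le_max_left _ _)).ne'
  refine ⟨c * c' * m, by simp [hc, hc', hm0], fun w hw hd i j => ?_⟩
  have n := big_ne v w a b hw hab
  have n' := big_ne v w a' b' hw hab'
  have hW : v (wedge (big v w a b) (big v w a' b')) ≤ m := by
    rcases big_cases v w a b with e | e <;> rcases big_cases v w a' b' with e' | e' <;>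
      rw [e, e'] <;> simp [hm]
  have h1 : v (w ⬝ᵥ big v w a b) * v (w ⬝ᵥ big v w a' b') ≤ m := by
    refine le_trans ?_ hW
    unfold diff at hd
    rw [map_div₀, map_mul] at hd
    have hp : 0 < v (w ⬝ᵥ big v w a b) * v (w ⬝ᵥ big v w a' b') := by
      rw [zero_lt_iff]; exact mul_ne_zero ((map_ne_zero v).2 n) ((map_ne_zero v).2 n')
    rw [one_lt_div₀ hp] at hd
    exact hd.le
  calc v (w i) * v (w j) ≤ (c * v (w ⬝ᵥ big v w a b)) * (c' * v (w ⬝ᵥ big v w a' b')) :=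
        mul_le_mul' (h w i) (h' w j)
    _ = c * c' * (v (w ⬝ᵥ big v w a b) * v (w ⬝ᵥ big v w a' b')) := mul_mul_mul_comm _ _ _ _
    _ ≤ _ := by gcongr

/-- the small terms -/
theorem diff_small (v : Valuation K Γ₀) (n m : Fin 2 → K) (ϖ t : K) (w : Fin 2 → K)
    (h1 : 1 ≤ v (w ⬝ᵥ n)) (h3 : v t * v (wedge n m) ≤ v ϖ)
    (hϖ : 1 ≤ v ϖ) (hw0 : v (wedge n m) ≤ 1) :
    v (diff v w (ϖ • n) (m + t • n) (ϖ • n) m) ≤ 1 := by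
  unfold diff
  rw [map_div₀, map_mul]
  have g1 := (big_le v w (ϖ • n) (m + t • n)).1
  have g2 := (big_le v w (ϖ • n) m).1
  rw [dotProduct_smul, smul_eq_mul, map_mul] at g1 g2
  have g1' : v ϖ ≤ v (w ⬝ᵥ big v w (ϖ • n) (m + t • n)) :=
    le_trans (by simpa using mul_le_mul_right h1 (v ϖ)) g1
  have g2' : 1 ≤ v (w ⬝ᵥ big v w (ϖ • n) m) :=
    le_trans (le_trans hϖ (by simpa using mul_le_mul_right h1 (v ϖ))) g2
  have hp : 0 < v (w ⬝ᵥ big v w (ϖ • n) (m + t • n)) * v (w ⬝ᵥ big v w (ϖ • n) m) :=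
    mul_pos (lt_of_lt_of_le (lt_of_lt_of_le zero_lt_one hϖ) g1') (lt_of_lt_of_le zero_lt_one g2')
  rw [div_le_one₀ hp]
  refine le_trans ?_ (by simpa using mul_le_mul' g1' g2')
  have e1 : wedge (ϖ • n) (ϖ • n) = 0 := by simp [wedge]
  have e2 : wedge (ϖ • n) m = ϖ * wedge n m := by simp [wedge]; ring
  have e3 : wedge (m + t • n) (ϖ • n) = - (ϖ * wedge n m) := by simp [wedge]; ring
  have e4 : wedge (m + t • n) m = t * wedge n m := by simp [wedge]; ring
  rcases big_cases v w (ϖ • n) (m + t • n) with e | e <;>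
    rcases big_cases v w (ϖ • n) m with e' | e' <;> rw [e, e']
  · rw [e1]; simp
  · rw [e2, map_mul]
    simpa using mul_le_mul_right hw0 (v ϖ)
  · rw [e3, Valuation.map_neg, map_mul]
    simpa using mul_le_mul_right hw0 (v ϖ)
  · rw [e4, map_mul]; exact h3
end
end Cusp
end

section
open Polynomial Matrix

namespace Cusp
section
variable {K B : Type*} [Field K] [CommRing B] {Γ₀ : Type*}
  [LinearOrderedCommGroupWithZero Γ₀] {A : Type*} [AddCommGroup A]

/-- the orbit of `w0`. -/
def orb (Γ : Subgroup (GL (Fin 2) B)) (w0 : Fin 2 → B) : Type _ :=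
  {w : Fin 2 → B // ∃ γ ∈ Γ, w = w0 ᵥ* (γ : Matrix (Fin 2) (Fin 2) B)}

theorem orb_ne (Γ : Subgroup (GL (Fin 2) B)) {w0 : Fin 2 → B} (h0 : w0 ≠ 0) (w : orb Γ w0) :
    w.1 ≠ 0 := by
  obtain ⟨γ, _, hw⟩ := w.2
  intro e
  rw [e] at hw
  apply h0
  have : (w0 ᵥ* (γ : Matrix (Fin 2) (Fin 2) B)) ᵥ* ((γ⁻¹ : GL (Fin 2) B) : Matrix (Fin 2) (Fin 2) B)
      = w0 := by
    rw [Matrix.vecMul_vecMul, ← Units.val_mul, mul_inv_cancel]; simp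
  rw [← this, ← hw, Matrix.zero_vecMul]

/-- `Γ` acts on the orbit -/
def orbEquiv (Γ : Subgroup (GL (Fin 2) B)) (w0 : Fin 2 → B) (γ : Γ) : orb Γ w0 ≃ orb Γ w0 where
  toFun w := ⟨w.1 ᵥ* (γ.1 : Matrix (Fin 2) (Fin 2) B), by
    obtain ⟨δ, hδ, hw⟩ := w.2
    exact ⟨δ * γ.1, Γ.mul_mem hδ γ.2, by rw [hw, Matrix.vecMul_vecMul, ← Units.val_mul]⟩⟩
  invFun w := ⟨w.1 ᵥ* ((γ.1⁻¹ : GL (Fin 2) B) : Matrix (Fin 2) (Fin 2) B), by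
    obtain ⟨δ, hδ, hw⟩ := w.2
    exact ⟨δ * γ.1⁻¹, Γ.mul_mem hδ (Γ.inv_mem γ.2),
      by rw [hw, Matrix.vecMul_vecMul, ← Units.val_mul]⟩⟩
  left_inv w := by
    apply Subtype.ext
    simp only [Matrix.vecMul_vecMul, ← Units.val_mul, mul_inv_cancel]
    simp
  right_inv w := by
    apply Subtype.ext
    simp only [Matrix.vecMul_vecMul, ← Units.val_mul, inv_mul_cancel]
    simp

theorem orbEquiv_val (Γ : Subgroup (GL (Fin 2) B)) (w0 : Fin 2 → B) (γ : Γ) (w : orb Γ w0) :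
    (orbEquiv Γ w0 γ w).1 = w.1 ᵥ* (γ.1 : Matrix (Fin 2) (Fin 2) B) := rfl

/-- matrix over `K` -/
def mK (ι : B →+* K) (γ : GL (Fin 2) B) : Matrix (Fin 2) (Fin 2) K :=
  (γ : Matrix (Fin 2) (Fin 2) B).map ι

theorem mK_mul (ι : B →+* K) (γ δ : GL (Fin 2) B) : mK ι (γ * δ) = mK ι γ * mK ι δ := by
  simp [mK, Matrix.map_mul]

theorem mK_det (ι : B →+* K) (γ : GL (Fin 2) B) (h : (γ : Matrix (Fin 2) (Fin 2) B).det = 1) :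
    (mK ι γ).det = 1 := by
  have := (RingHom.map_det ι (γ : Matrix (Fin 2) (Fin 2) B))
  rw [h, map_one] at this
  exact this.symm

theorem vecMul_mK (ι : B →+* K) (γ : GL (Fin 2) B) (w : Fin 2 → B) :
    (ι ∘ w) ᵥ* mK ι γ = ι ∘ (w ᵥ* (γ : Matrix (Fin 2) (Fin 2) B)) := by
  ext i
  simp [mK, Matrix.vecMul, dotProduct, Fin.sum_univ_two]

theorem exists_chi (v : Valuation K Γ₀) (ι : B →+* K) (hι : Function.Injective ι)
    (hv1 : ∀ b : B, b ≠ 0 → 1 ≤ v (ι b)) (hfin : ∀ c : Γ₀, c ≠ 0 → {b : B | v (ι b) ≤ c}.Finite)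
    (l : K →+ A) (hl : ∀ x, v x ≤ 1 → l x = 0) (Γ : Subgroup (GL (Fin 2) B))
    (hΓ : ∀ γ ∈ Γ, (γ : Matrix (Fin 2) (Fin 2) B).det = 1) (w0 : Fin 2 → B) (hw0 : w0 ≠ 0) :
    ∃ χ : Γ →* Multiplicative A, ∀ a b : Fin 2 → K, wedge a b ≠ 0 → ∀ γ : Γ,
      χ γ = Multiplicative.ofAdd (∑ᶠ w : orb Γ w0,
        l (diff v (ι ∘ w.1) (mK ι γ.1 *ᵥ a) (mK ι γ.1 *ᵥ b) a b)) := by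
  have hne : ∀ w : orb Γ w0, ι ∘ w.1 ≠ 0 := by
    intro w e
    apply orb_ne Γ hw0 w
    ext i
    apply hι
    simpa using congrFun e i
  have hwedge : ∀ (γ : Γ) (a b : Fin 2 → K), wedge a b ≠ 0 →
      wedge (mK ι γ.1 *ᵥ a) (mK ι γ.1 *ᵥ b) ≠ 0 := by
    intro γ a b hab
    rw [wedge_mulVec, mK_det ι γ.1 (hΓ _ γ.2), one_mul]; exact hab
  -- finite support
  have hsupp : ∀ a b a' b' : Fin 2 → K, wedge a b ≠ 0 → wedge a' b' ≠ 0 →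
      (Function.support (fun w : orb Γ w0 => l (diff v (ι ∘ w.1) a b a' b'))).Finite := by
    intro a b a' b' hab hab'
    obtain ⟨c, hc, hbd⟩ := diff_bound v a b a' b' hab hab'
    have hF := (Set.Finite.pi' (ι := Fin 2) (fun _ => hfin c hc))
    apply Set.Finite.subset (hF.preimage (f := fun w : orb Γ w0 => w.1)
      (Subtype.val_injective.injOn))
    intro w hw i
    have h1 : 1 < v (diff v (ι ∘ w.1) a b a' b') := by
      by_contra h
      exact hw (hl _ (not_lt.1 h))
    have h2 := hbd _ (hne w) h1 i i
    by_cases hi : w.1 i = 0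
    · simp [hi]
    · have h3 := hv1 _ hi
      refine le_trans ?_ h2
      have := mul_le_mul_right h3 (v (ι (w.1 i)))
      simpa using this
  have hadd : ∀ a b a' b' a'' b'' : Fin 2 → K, wedge a b ≠ 0 → wedge a' b' ≠ 0 →
      wedge a'' b'' ≠ 0 →
      (∑ᶠ w : orb Γ w0, l (diff v (ι ∘ w.1) a b a' b'))
        + (∑ᶠ w : orb Γ w0, l (diff v (ι ∘ w.1) a' b' a'' b''))
      = ∑ᶠ w : orb Γ w0, l (diff v (ι ∘ w.1) a b a'' b'') := by
    intro a b a' b' a'' b'' h h' h''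
    rw [← finsum_add_distrib (hsupp _ _ _ _ h h') (hsupp _ _ _ _ h' h'')]
    apply finsum_congr
    intro w
    rw [← map_add, diff_add v _ _ _ _ _ _ _ (hne w) h h' h'']
  have hinv : ∀ (γ : Γ) (a b a' b' : Fin 2 → K),
      (∑ᶠ w : orb Γ w0, l (diff v (ι ∘ w.1) (mK ι γ.1 *ᵥ a) (mK ι γ.1 *ᵥ b)
        (mK ι γ.1 *ᵥ a') (mK ι γ.1 *ᵥ b')))
      = ∑ᶠ w : orb Γ w0, l (diff v (ι ∘ w.1) a b a' b') := by
    intro γ a b a' b'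
    rw [← finsum_comp_equiv (orbEquiv Γ w0 γ)
      (f := fun w : orb Γ w0 => l (diff v (ι ∘ w.1) a b a' b'))]
    apply finsum_congr
    intro w
    rw [diff_mulVec v _ (mK_det ι γ.1 (hΓ _ γ.2)), vecMul_mK, orbEquiv_val]
  let e0 : Fin 2 → K := ![1, 0]
  let e1 : Fin 2 → K := ![0, 1]
  have he : wedge e0 e1 ≠ 0 := by simp [wedge, e0, e1]
  let S : Γ → (Fin 2 → K) → (Fin 2 → K) → A := fun γ a b =>
    ∑ᶠ w : orb Γ w0, l (diff v (ι ∘ w.1) (mK ι γ.1 *ᵥ a) (mK ι γ.1 *ᵥ b) a b)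
  have hmul : ∀ γ δ : Γ, S (γ * δ) e0 e1 = S γ e0 e1 + S δ e0 e1 := by
    intro γ δ
    have h1 := hadd (mK ι (γ.1 * δ.1) *ᵥ e0) (mK ι (γ.1 * δ.1) *ᵥ e1) (mK ι γ.1 *ᵥ e0)
      (mK ι γ.1 *ᵥ e1) e0 e1 (hwedge (γ * δ) _ _ he) (hwedge γ _ _ he) he
    rw [mK_mul, ← Matrix.mulVec_mulVec, ← Matrix.mulVec_mulVec, hinv γ,
      Matrix.mulVec_mulVec, Matrix.mulVec_mulVec, ← mK_mul] at h1
    rw [add_comm] at h1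
    exact h1.symm
  have hind : ∀ (γ : Γ) a b, wedge a b ≠ 0 → S γ e0 e1 = S γ a b := by
    intro γ a b hab
    have h1 := hadd (mK ι γ.1 *ᵥ e0) (mK ι γ.1 *ᵥ e1) e0 e1 a b (hwedge γ _ _ he) he hab
    have h2 := hadd (mK ι γ.1 *ᵥ e0) (mK ι γ.1 *ᵥ e1) (mK ι γ.1 *ᵥ a) (mK ι γ.1 *ᵥ b) a b
      (hwedge γ _ _ he) (hwedge γ _ _ hab) hab
    rw [hinv γ] at h2
    rw [← h2, add_comm] at h1
    exact add_left_cancel h1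
  refine ⟨MonoidHom.mk' (fun γ => Multiplicative.ofAdd (S γ e0 e1)) ?_, ?_⟩
  · intro γ δ
    rw [← ofAdd_add, hmul]
  · intro a b hab γ
    show Multiplicative.ofAdd (S γ e0 e1) = _
    rw [hind γ a b hab]
end
end Cusp
end

section
open Polynomial Matrix

namespace Cusp

/-- unipotent element fixing the row `(c0,d0)`. -/
def uT {B : Type*} [CommRing B] (c0 d0 t : B) : GL (Fin 2) B :=
  ⟨!![1 + t * d0 * c0, t * d0 * d0; - (t * c0 * c0), 1 - t * c0 * d0],
   !![1 - t * d0 * c0, - (t * d0 * d0); (t * c0 * c0), 1 + t * c0 * d0],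
    by rw [Matrix.mul_fin_two, Matrix.one_fin_two]; congr 1 <;> ring_nf,
    by rw [Matrix.mul_fin_two, Matrix.one_fin_two]; congr 1 <;> ring_nf⟩

/-- congruence subgroup. -/
def congr {B : Type*} [CommRing B] (I : Ideal B) : Subgroup (GL (Fin 2) B) :=
  ((Matrix.GeneralLinearGroup.map (n := Fin 2) (Ideal.Quotient.mk I)).prod
    (Matrix.GeneralLinearGroup.det)).ker

theorem mem_congr {B : Type*} [CommRing B] (I : Ideal B) (γ : GL (Fin 2) B) :
    γ ∈ congr I ↔ (∀ i j, γ.1 i j - (1 : Matrix (Fin 2) (Fin 2) B) i j ∈ I) ∧ γ.1.det = 1 := by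
  unfold congr
  rw [MonoidHom.mem_ker, MonoidHom.prod_apply, Prod.mk_eq_one]
  apply and_congr
  · rw [Units.ext_iff, ← Matrix.ext_iff]
    apply forall_congr'; intro i
    apply forall_congr'; intro j
    rw [← Ideal.Quotient.eq]
    have : Ideal.Quotient.mk I ((1 : Matrix (Fin 2) (Fin 2) B) i j)
      = (1 : Matrix (Fin 2) (Fin 2) (B ⧸ I)) i j := by
      rw [Matrix.one_apply, Matrix.one_apply]; split_ifs <;> simp
    rw [this]
    rfl
  · rw [Units.ext_iff]; rfl

variable {k B : Type*} [Field k] [Finite k] [CommRing B] [IsDomain B] [Algebra k B]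
  {V : ValuationSubring (FractionRing B)} {deg : B → ℕ}

theorem congr_finiteIndex (hD : DegRing k B deg) (x : B) (hx : x ≠ 0) :
    (congr (Ideal.span {x})).FiniteIndex := by
  have := hD.fin x hx
  have : Finite (B ⧸ Ideal.span {x}) := Module.finite_of_finite k
  have : Finite (Matrix (Fin 2) (Fin 2) (B ⧸ Ideal.span {x})) :=
    inferInstanceAs (Finite (Fin 2 → Fin 2 → (B ⧸ Ideal.span {x})))
  have : Finite Bˣ := by
    have h0 := hD.finite_deg_le 0
    have : Finite {b : B | deg b ≤ 0} := h0
    apply Finite.of_injective (fun u : Bˣ => (⟨u.1, (hD.deg_of_isUnit u.isUnit).le⟩ :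
      {b : B | deg b ≤ 0}))
    intro u u' h
    exact Units.ext (congrArg Subtype.val h)
  exact Subgroup.finiteIndex_ker _

/-- stabilizer of the cusp is unipotent -/
theorem eq_of_fix [IsIntegrallyClosed B] (hD : DegRing k B deg) (x : B) (hx : 0 < deg x)
    (w0 : Fin 2 → B) (hw0 : w0 ≠ 0) (γ : GL (Fin 2) B) (hγ : γ ∈ congr (Ideal.span {x}))
    (h : (w0 ᵥ* γ.1) 0 * w0 1 - (w0 ᵥ* γ.1) 1 * w0 0 = 0) : w0 ᵥ* γ.1 = w0 := by
  obtain ⟨h1, h2⟩ := (mem_congr _ _).1 hγ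
  let ι := algebraMap B (FractionRing B)
  have hι : Function.Injective ι := IsFractionRing.injective B (FractionRing B)
  have hx0 := hD.ne_zero_of_pos hx
  set w := w0 ᵥ* γ.1 with hw
  obtain ⟨μ, hμ⟩ : ∃ μ : FractionRing B, ∀ i, ι (w i) = μ * ι (w0 i) := by
    have h' := congrArg ι h
    rw [map_sub, map_mul, map_mul, map_zero, sub_eq_zero] at h'
    by_cases hc : w0 0 = 0
    · have hd : w0 1 ≠ 0 := by
        intro hd; apply hw0; ext i; fin_cases i <;> simp [hc, hd]
      have hd' : ι (w0 1) ≠ 0 := by simpa [ι] using hd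
      refine ⟨ι (w 1) / ι (w0 1), fun i => ?_⟩
      fin_cases i
      · show ι (w 0) = _ * ι (w0 0)
        rw [div_mul_eq_mul_div, ← h', mul_div_cancel_right₀ _ hd']
      · show ι (w 1) = _ * ι (w0 1)
        rw [div_mul_cancel₀ _ hd']
    · have hd' : ι (w0 0) ≠ 0 := by simpa [ι] using hc
      refine ⟨ι (w 0) / ι (w0 0), fun i => ?_⟩
      fin_cases i
      · show ι (w 0) = _ * ι (w0 0)
        rw [div_mul_cancel₀ _ hd']
      · show ι (w 1) = _ * ι (w0 1)
        rw [div_mul_eq_mul_div, h', mul_div_cancel_right₀ _ hd']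
  have hdet : (mK ι γ - μ • (1 : Matrix (Fin 2) (Fin 2) (FractionRing B))).det = 0 := by
    rw [← Matrix.exists_vecMul_eq_zero_iff]
    refine ⟨ι ∘ w0, ?_, ?_⟩
    · intro e; apply hw0; ext i; apply hι; simpa using congrFun e i
    · rw [Matrix.vecMul_sub, vecMul_mK, Matrix.vecMul_smul, Matrix.vecMul_one]
      ext i
      have := hμ i
      simp only [Pi.sub_apply, Function.comp, Pi.smul_apply, smul_eq_mul, Pi.zero_apply]
      rw [← this, hw, sub_self]
  have hdet1 := mK_det ι γ h2
  rw [Matrix.det_fin_two] at hdet hdet1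
  simp only [Matrix.sub_apply, Matrix.smul_apply, Matrix.one_apply_eq, smul_eq_mul, mul_one,
    Matrix.one_apply_ne (show (0 : Fin 2) ≠ 1 by decide),
    Matrix.one_apply_ne (show (1 : Fin 2) ≠ 0 by decide), mul_zero, sub_zero] at hdet
  have hq : μ ^ 2 - ι (γ.1 0 0 + γ.1 1 1) * μ + 1 = 0 := by
    have e0 : mK ι γ 0 0 = ι (γ.1 0 0) := rfl
    have e1 : mK ι γ 1 1 = ι (γ.1 1 1) := rfl
    rw [map_add, ← e0, ← e1]
    linear_combination hdet - hdet1
  have hintg : IsIntegral B μ := by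
    refine ⟨X ^ 2 + (- C (γ.1 0 0 + γ.1 1 1) * X + C 1), ?_, ?_⟩
    · apply Polynomial.monic_X_pow_add
      refine lt_of_le_of_lt (Polynomial.degree_add_le _ _) ?_
      rw [max_lt_iff]
      constructor
      · rw [← C_neg]
        exact lt_of_le_of_lt (Polynomial.degree_C_mul_X_le _) (by norm_num)
      · exact lt_of_le_of_lt (Polynomial.degree_C_le) (by norm_num)
    · simp only [eval₂_add, eval₂_mul, eval₂_pow, eval₂_X, eval₂_neg, eval₂_C, map_one, eval₂_one]
      linear_combination hq
  obtain ⟨m, rfl⟩ := IsIntegrallyClosed.isIntegral_iff.1 hintg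
  have hm : m ^ 2 - (γ.1 0 0 + γ.1 1 1) * m + 1 = 0 := by
    apply hι
    rw [map_add, map_sub, map_mul, map_pow, map_one, map_zero]
    exact hq
  have hu : IsUnit m := IsUnit.of_mul_eq_one ((γ.1 0 0 + γ.1 1 1) - m) (by linear_combination -hm)
  obtain ⟨c, hc⟩ := hD.const m (hD.deg_of_isUnit hu)
  have hI : (m - 1) ^ 2 ∈ Ideal.span {x} := by
    have e : (m - 1) ^ 2 = ((γ.1 0 0 - (1 : Matrix (Fin 2) (Fin 2) B) 0 0)
        + (γ.1 1 1 - (1 : Matrix (Fin 2) (Fin 2) B) 1 1)) * m := by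
      simp only [Matrix.one_apply_eq]
      linear_combination hm
    rw [e]
    exact Ideal.mul_mem_right _ _ (Ideal.add_mem _ (h1 0 0) (h1 1 1))
  have hm1 : m = 1 := by
    by_contra hne
    have hc1 : c - 1 ≠ 0 := by
      intro e; apply hne; rw [← hc, sub_eq_zero.1 e, map_one]
    have hu1 : IsUnit ((m - 1) ^ 2) := by
      rw [← hc, ← map_one (algebraMap k B), ← map_sub]
      exact ((IsUnit.mk0 _ hc1).map (algebraMap k B)).pow 2
    rw [Ideal.mem_span_singleton] at hI
    have := hD.deg_of_isUnit (isUnit_of_dvd_unit hI hu1)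
    omega
  ext i
  apply hι
  rw [hμ i, hm1, map_one, one_mul]

theorem exists_subgroup [IsIntegrallyClosed B] (h : InfPlace k B V) (hD : DegRing k B deg)
    (hle : ∀ b c : B, c ≠ 0 →
      (algebraMap B (FractionRing B) b / algebraMap B (FractionRing B) c ∈ V ↔ deg b ≤ deg c))
    (w0 : Fin 2 → B) (hnp : ¬ (Ideal.span {w0 0, w0 1}).IsPrincipal)
    (x : B) (hx : 0 < deg x) (l : FractionRing B →+ k) (hl : ∀ z ∈ V, l z = 0) :
    ∃ Δ : Subgroup (GL (Fin 2) B), Δ.FiniteIndex ∧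
      (Ideal.span {x} : Ideal B) ≤ (quasiLevelGL Δ : Set B) ∧
      ∀ t ∈ Ideal.span {x}, (uT (w0 0) (w0 1) t ∈ Δ ↔ l (algebraMap B (FractionRing B) t) = 0) := by
  set ι := algebraMap B (FractionRing B) with hιdef
  have hι : Function.Injective ι := IsFractionRing.injective B (FractionRing B)
  have hx0 := hD.ne_zero_of_pos hx
  have hw0 : w0 ≠ 0 := by
    rintro rfl; apply hnp; simp only [Pi.zero_apply, Set.pair_eq_singleton]; exact ⟨0, by simp⟩
  set v := V.valuation with hv
  have hvV : ∀ z, v z ≤ 1 ↔ z ∈ V := fun z => V.valuation_le_one_iff z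
  have hv1 : ∀ b : B, b ≠ 0 → 1 ≤ v (ι b) := by
    intro b hb
    have := (hvV _).2 (h.inv_mem hb)
    rw [map_inv₀] at this
    rwa [inv_le_one₀ (zero_lt_iff.2 (by simpa [ι] using hb))] at this
  have hxV : ι x ∉ V := by
    intro hxV
    have := (hle x 1 one_ne_zero).1 (by simpa using hxV)
    rw [hD.deg_one] at this; omega
  have hpow : ∀ z, ∃ N : ℕ, v z ≤ v (ι (x ^ N)) := by
    intro z
    obtain ⟨N, hN⟩ := h.exists_pow hxV z
    refine ⟨N, ?_⟩
    rw [← hvV, map_mul, inv_pow, map_inv₀, ← map_pow] at hN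
    rwa [← div_eq_mul_inv, div_le_one₀] at hN
    exact lt_of_lt_of_le zero_lt_one (hv1 _ (pow_ne_zero _ hx0))
  have hfin : ∀ c : V.ValueGroup, c ≠ 0 → {b : B | v (ι b) ≤ c}.Finite := by
    intro c hc
    obtain ⟨z, rfl⟩ := V.valuation_surjective c
    obtain ⟨N, hN⟩ := hpow z
    apply (hD.finite_deg_le (deg (x ^ N))).subset
    intro b hb
    show deg b ≤ _
    rw [← hle b _ (pow_ne_zero _ hx0), ← hvV, map_div₀, div_le_one₀]
    · exact le_trans hb hN
    · exact lt_of_lt_of_le zero_lt_one (hv1 _ (pow_ne_zero _ hx0))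
  have hvu : ∀ u : B, IsUnit u → v (ι u) ≤ 1 := by
    intro u hu
    rw [hvV]
    have := (hle u 1 one_ne_zero).2 (by rw [hD.deg_of_isUnit hu]; omega)
    simpa using this
  set I : Ideal B := Ideal.span {x} with hI
  have hdet : ∀ γ ∈ congr I, (γ : Matrix (Fin 2) (Fin 2) B).det = 1 :=
    fun γ hγ => ((mem_congr _ _).1 hγ).2
  obtain ⟨χ, hχ⟩ := exists_chi v ι hι hv1 hfin l (fun z hz => hl z ((hvV z).1 hz)) (congr I) hdet
    w0 hw0
  have hmem : ∀ γ, γ ∈ χ.ker.map (congr I).subtype ↔ ∃ hγ : γ ∈ congr I, χ ⟨γ, hγ⟩ = 1 := by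
    intro γ
    rw [Subgroup.mem_map]
    constructor
    · rintro ⟨⟨g, hg⟩, hg1, rfl⟩
      exact ⟨hg, hg1⟩
    · rintro ⟨hg, hg1⟩
      exact ⟨⟨γ, hg⟩, hg1, rfl⟩
  refine ⟨χ.ker.map (congr I).subtype, ?_, ?_, ?_⟩
  · have h1 : (congr I).FiniteIndex := congr_finiteIndex hD x hx0
    have : Finite (Multiplicative k) := inferInstanceAs (Finite k)
    have h2 : χ.ker.FiniteIndex := Subgroup.finiteIndex_ker χ
    refine ⟨?_⟩
    rw [Subgroup.index_map_subtype]
    exact mul_ne_zero h2.index_ne_zero h1.index_ne_zero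
  · intro a ha g
    have hun : unipGL a ∈ congr I := by
      rw [mem_congr]
      constructor
      · intro i j
        have e1 : (unipGL a).1 = !![1, a; 0, 1] := rfl
        rw [e1]
        fin_cases i <;> fin_cases j <;> simp
        exact ha
      · have e1 : (unipGL a).1 = !![1, a; 0, 1] := rfl
        rw [e1, Matrix.det_fin_two]; simp
    have hγ : g⁻¹ * unipGL a * g ∈ congr I := by
      have hn : (congr I).Normal := by unfold congr; infer_instance
      have := hn.conj_mem _ hun g⁻¹
      simpa using this
    rw [hmem]
    refine ⟨hγ, ?_⟩
    set e0 : Fin 2 → FractionRing B := ![1, 0]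
    set e1 : Fin 2 → FractionRing B := ![0, 1]
    set n := mK ι g⁻¹ *ᵥ e0 with hn
    set m := mK ι g⁻¹ *ᵥ e1 with hm
    obtain ⟨N, hN⟩ := hpow (ι a)
    set ϖ := ι (x ^ N) with hϖ
    have hϖ1 : 1 ≤ v ϖ := hv1 _ (pow_ne_zero _ hx0)
    have hϖ0 : ϖ ≠ 0 := by simpa [ϖ, ι] using fun e => absurd e hx0
    have hdu : IsUnit ((g⁻¹ : GL (Fin 2) B).1.det) :=
      (Matrix.isUnit_iff_isUnit_det _).1 (Units.isUnit _)
    have hwed : wedge n m = ι ((g⁻¹ : GL (Fin 2) B).1.det) := by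
      rw [hn, hm, wedge_mulVec]
      have : wedge e0 e1 = 1 := by simp [wedge, e0, e1]
      rw [this, mul_one]
      exact (RingHom.map_det ι _).symm
    have hw1 : v (wedge n m) ≤ 1 := by rw [hwed]; exact hvu _ hdu
    have hw2 : wedge n m ≠ 0 := by
      rw [hwed]; intro e; exact hdu.ne_zero (hι (by rw [e, map_zero]))
    have hframe : wedge (ϖ • n) m ≠ 0 := by
      have e2 : wedge (ϖ • n) m = ϖ * wedge n m := by simp [wedge]; ring
      rw [e2]; exact mul_ne_zero hϖ0 hw2
    rw [hχ (ϖ • n) m hframe]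
    have hgm : mK ι (g⁻¹ * unipGL a * g) * mK ι g⁻¹ = mK ι g⁻¹ * mK ι (unipGL a) := by
      rw [← mK_mul, ← mK_mul]; congr 1; group
    have hU : mK ι (unipGL a) = !![1, ι a; 0, 1] := by
      ext i j
      have e1 : (unipGL a).1 = !![1, a; 0, 1] := rfl
      unfold mK
      rw [e1]
      fin_cases i <;> fin_cases j <;> simp
    have hn1 : mK ι (g⁻¹ * unipGL a * g) *ᵥ n = n := by
      rw [hn, Matrix.mulVec_mulVec, hgm, ← Matrix.mulVec_mulVec, hU]
      congr 1
      ext i; fin_cases i <;> simp [e0]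
    have hm1 : mK ι (g⁻¹ * unipGL a * g) *ᵥ m = m + ι a • n := by
      rw [hn, hm, Matrix.mulVec_mulVec, hgm, ← Matrix.mulVec_mulVec, hU,
        ← Matrix.mulVec_smul, ← Matrix.mulVec_add]
      congr 1
      ext i; fin_cases i <;> simp [e0, e1]
    rw [ofAdd_eq_one]
    apply finsum_eq_zero_of_forall_eq_zero
    intro w
    show l (diff v (ι ∘ w.1) (mK ι (g⁻¹ * unipGL a * g) *ᵥ _) (mK ι (g⁻¹ * unipGL a * g) *ᵥ _) _ _) = 0
    rw [Matrix.mulVec_smul, hn1, hm1]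
    apply hl
    rw [← hvV]
    apply diff_small v n m ϖ (ι a) _ _ _ hϖ1 hw1
    · have e : (ι ∘ w.1) ⬝ᵥ n = ι ((w.1 ᵥ* (g⁻¹ : GL (Fin 2) B).1) 0) := by
        rw [hn, Matrix.dotProduct_mulVec, vecMul_mK]
        simp [dotProduct, Fin.sum_univ_two, e0]
      rw [e]
      apply hv1
      intro e3
      apply hnp
      obtain ⟨δ, hδ, hw⟩ := w.2
      set s := (w.1 ᵥ* (g⁻¹ : GL (Fin 2) B).1) 1 with hs
      -- w = (0,s) g
      have e4 : w0 = ![0, s] ᵥ* (g * δ⁻¹).1 := by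
        have e5 : (![0, s] : Fin 2 → B) = w.1 ᵥ* (g⁻¹ : GL (Fin 2) B).1 := by
          ext i; fin_cases i
          · exact e3.symm
          · exact hs
        rw [e5, hw, Matrix.vecMul_vecMul, Matrix.vecMul_vecMul, ← Units.val_mul, ← Units.val_mul,
          show δ * (g⁻¹ * (g * δ⁻¹)) = 1 by group, Units.val_one, Matrix.vecMul_one]
      have e6 : (![0, s] : Fin 2 → B) = w0 ᵥ* (δ * g⁻¹).1 := by
        rw [e4, Matrix.vecMul_vecMul, ← Units.val_mul,
          show (g * δ⁻¹) * (δ * g⁻¹) = 1 by group, Units.val_one, Matrix.vecMul_one]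
      refine ⟨s, le_antisymm ?_ ?_⟩
      · rw [Ideal.span_le]
        have key : ∀ i, w0 i ∈ Ideal.span {s} := by
          intro i
          rw [Ideal.mem_span_singleton, e4]
          simp [Matrix.vecMul, dotProduct, Fin.sum_univ_two]
        intro z hz
        rcases hz with rfl | hz
        · exact key 0
        · rw [Set.mem_singleton_iff.1 hz]; exact key 1
      · show Ideal.span {s} ≤ _
        rw [Ideal.span_le, Set.singleton_subset_iff]
        have e7 : s = (w0 ᵥ* (δ * g⁻¹).1) 1 := by rw [← e6]; simp
        rw [SetLike.mem_coe, e7]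
        simp only [Matrix.vecMul, dotProduct, Fin.sum_univ_two]
        exact Ideal.add_mem _ (Ideal.mul_mem_right _ _ (Ideal.subset_span (by simp)))
          (Ideal.mul_mem_right _ _ (Ideal.subset_span (by simp)))
    · refine le_trans ?_ hN
      simpa using mul_le_mul_right hw1 (v (ι a))
  · intro t ht
    have eM : (uT (w0 0) (w0 1) t).1 = !![1 + t * w0 1 * w0 0, t * w0 1 * w0 1;
        - (t * w0 0 * w0 0), 1 - t * w0 0 * w0 1] := rfl
    have hγ : uT (w0 0) (w0 1) t ∈ congr I := by
      rw [mem_congr, eM]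
      constructor
      · intro i j
        fin_cases i <;> fin_cases j <;> simp <;>
        · simp only [mul_assoc]; exact Ideal.mul_mem_right _ _ ht
      · rw [Matrix.det_fin_two]; simp; ring
    set γ := uT (w0 0) (w0 1) t with hγdef
    rw [hmem]
    set n : Fin 2 → FractionRing B := ![ι (w0 1), - ι (w0 0)] with hn
    obtain ⟨m, hm⟩ : ∃ m : Fin 2 → FractionRing B, (ι ∘ w0) ⬝ᵥ m = 1 := by
      by_cases hc : w0 0 = 0
      · have hd : w0 1 ≠ 0 := by
          intro hd; apply hw0; ext i; fin_cases i <;> simp [hc, hd]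
        exact ⟨![0, (ι (w0 1))⁻¹], by
          simp [dotProduct, Fin.sum_univ_two]; rw [mul_inv_cancel₀]; simpa [ι] using hd⟩
      · exact ⟨![(ι (w0 0))⁻¹, 0], by
          simp [dotProduct, Fin.sum_univ_two]; rw [mul_inv_cancel₀]; simpa [ι] using hc⟩
    have hm' := hm
    simp only [dotProduct, Fin.sum_univ_two, Function.comp] at hm'
    obtain ⟨N, hN⟩ := hpow (ι t)
    set ϖ := ι (x ^ N) with hϖ
    have hϖ1 : 1 ≤ v ϖ := hv1 _ (pow_ne_zero _ hx0)
    have hϖ0 : ϖ ≠ 0 := by simpa [ϖ, ι] using fun e => absurd e hx0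
    have hwed : wedge n m = 1 := by
      simp [wedge, hn]; linear_combination hm'
    have hframe : wedge (ϖ • n) m ≠ 0 := by
      have e2 : wedge (ϖ • n) m = ϖ * wedge n m := by simp [wedge]; ring
      rw [e2, hwed, mul_one]; exact hϖ0
    have hn1 : mK ι γ *ᵥ n = n := by
      unfold mK
      rw [eM]
      ext i; fin_cases i <;> simp [hn] <;> ring
    have hm1 : mK ι γ *ᵥ m = m + ι t • n := by
      unfold mK
      rw [eM]
      ext i; fin_cases i <;> simp [hn]
      · linear_combination ι t * ι (w0 1) * hm'
      · linear_combination -ι t * ι (w0 0) * hm'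
    have hw0n : (ι ∘ w0) ⬝ᵥ n = 0 := by
      simp [dotProduct, Fin.sum_univ_two, hn]; ring
    have hsum : χ ⟨γ, hγ⟩ = Multiplicative.ofAdd (l (ι t)) := by
      rw [hχ (ϖ • n) m hframe]
      congr 1
      let w00 : orb (congr I) w0 := ⟨w0, 1, Subgroup.one_mem _, by simp⟩
      rw [finsum_eq_single (α := orb (congr I) w0) _ w00]
      · show l (diff v (ι ∘ w0) (mK ι γ *ᵥ _) (mK ι γ *ᵥ _) _ _) = _
        rw [Matrix.mulVec_smul, hn1, hm1]
        congr 1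
        have g1 : (ι ∘ w0) ⬝ᵥ (ϖ • n) = 0 := by rw [dotProduct_smul, hw0n, smul_zero]
        have g2 : (ι ∘ w0) ⬝ᵥ (m + ι t • n) = 1 := by
          rw [dotProduct_add, dotProduct_smul, hw0n, smul_zero, add_zero, hm]
        have b1 : big v (ι ∘ w0) (ϖ • n) m = m := by
          unfold big; rw [g1, if_pos]; simp
        have b2 : big v (ι ∘ w0) (ϖ • n) (m + ι t • n) = m + ι t • n := by
          unfold big; rw [g1, if_pos]; simp
        unfold diff
        rw [b1, b2, g2, hm]
        have e4 : wedge (m + ι t • n) m = ι t * wedge n m := by simp [wedge]; ring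
        rw [e4, hwed]; simp
      · intro w hw
        show l (diff v (ι ∘ w.1) (mK ι γ *ᵥ _) (mK ι γ *ᵥ _) _ _) = 0
        rw [Matrix.mulVec_smul, hn1, hm1]
        apply hl
        rw [← hvV]
        apply diff_small v n m ϖ (ι t) _ _ _ hϖ1 (by rw [hwed, map_one])
        · have e : (ι ∘ w.1) ⬝ᵥ n = ι (w.1 0 * w0 1 - w.1 1 * w0 0) := by
            simp [dotProduct, Fin.sum_univ_two, hn]; ring
          rw [e]
          apply hv1
          intro e3
          apply hw
          obtain ⟨δ, hδ, hwδ⟩ := w.2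
          apply Subtype.ext
          show w.1 = w0
          rw [hwδ] at e3 ⊢
          exact eq_of_fix hD x hx w0 hw0 δ hδ e3
        · rw [hwed, map_one, mul_one]; exact hN
    constructor
    · rintro ⟨hg, h1⟩
      rw [hsum, ofAdd_eq_one] at h1
      exact h1
    · intro h1
      exact ⟨hγ, by rw [hsum, h1]; rfl⟩
end Cusp
end

section
open Polynomial Matrix

namespace DegRing
variable {k B : Type*} [Field k] [CommRing B] [IsDomain B] [Algebra k B] {deg : B → ℕ}

theorem deg_aeval_aux (h : DegRing k B deg) {x : B} (hx : 0 < deg x) (n : ℕ) :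
    ∀ p : k[X], p.natDegree = n → p ≠ 0 →
    deg (aeval x p) = p.natDegree * deg x ∧ aeval x p ≠ 0 := by
  have hx0 := h.ne_zero_of_pos hx
  induction n using Nat.strong_induction_on with
  | _ n ih =>
    intro p hp hp0
    rcases Nat.eq_zero_or_pos n with h0 | h0
    · rw [h0] at hp
      obtain ⟨c, rfl⟩ := natDegree_eq_zero.1 hp
      rw [aeval_C, h.deg_algebraMap, hp, zero_mul]
      refine ⟨rfl, ?_⟩
      simpa using hp0
    · have e := p.eraseLead_add_C_mul_X_pow
      have hl : p.leadingCoeff ≠ 0 := by simpa using hp0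
      have h1 : deg (aeval x (C p.leadingCoeff * X ^ p.natDegree)) = p.natDegree * deg x := by
        rw [map_mul, aeval_C, map_pow, aeval_X, h.mul _ _ (by simpa using hp0)
          (pow_ne_zero _ hx0), h.deg_algebraMap, h.deg_pow hx0, zero_add]
      have h2 : deg (aeval x p.eraseLead) < p.natDegree * deg x := by
        by_cases he : p.eraseLead = 0
        · rw [he, map_zero, h.zero, hp]; positivity
        · have hlt : p.eraseLead.natDegree < n := by
            have := p.eraseLead_natDegree_le
            omega
          rw [(ih _ hlt _ rfl he).1, hp]
          exact Nat.mul_lt_mul_of_pos_right hlt hx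
      have h3 : deg (aeval x p) = p.natDegree * deg x := by
        conv_lhs => rw [← e, map_add]
        rw [h.deg_add_eq (by rw [h1]; exact h2), h1]
      refine ⟨h3, ?_⟩
      apply h.ne_zero_of_pos
      rw [h3, hp]; positivity

theorem deg_aeval (h : DegRing k B deg) {x : B} (hx : 0 < deg x) (p : k[X]) :
    deg (aeval x p) = p.natDegree * deg x := by
  by_cases hp : p = 0
  · rw [hp, map_zero, h.zero, natDegree_zero, zero_mul]
  · exact (h.deg_aeval_aux hx _ p rfl hp).1

theorem aeval_inj (h : DegRing k B deg) {x : B} (hx : 0 < deg x) :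
    Function.Injective (aeval x : k[X] →ₐ[k] B) := by
  rw [injective_iff_map_eq_zero]
  intro p hp
  by_contra hp0
  exact (h.deg_aeval_aux hx _ p rfl hp0).2 hp

end DegRing

namespace Cusp
variable {k B : Type*} [Field k] [CommRing B] [IsDomain B] [Algebra k B]
  {V : ValuationSubring (FractionRing B)} {deg : B → ℕ}

/-- the valuation ring as a `k`-subspace. -/
def Vsub (h : InfPlace k B V) : Submodule k (FractionRing B) where
  carrier := V
  zero_mem' := V.zero_mem
  add_mem' := fun ha hb => V.add_mem _ _ ha hb
  smul_mem' := by
    intro c b hb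
    rw [Algebra.smul_def, IsScalarTower.algebraMap_apply k B]
    exact V.mul_mem _ _ (h.hk c) hb

theorem exists_functional (h : InfPlace k B V) (hD : DegRing k B deg) (x : B) (hx : 0 < deg x)
    (s : Set ℕ) : ∃ l : FractionRing B →+ k, (∀ z ∈ V, l z = 0) ∧
      ∀ i, l (algebraMap B (FractionRing B) (x ^ (i+1))) = 0 ↔ i ∉ s := by
  classical
  let f : k[X] →ₗ[k] (FractionRing B) ⧸ (Vsub h) :=
    (Vsub h).mkQ ∘ₗ (Algebra.linearMap B (FractionRing B)).restrictScalars k ∘ₗ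
      (aeval x : k[X] →ₐ[k] B).toLinearMap ∘ₗ (LinearMap.mulLeft k (X : k[X]))
  have hf : LinearMap.ker f = ⊥ := by
    rw [LinearMap.ker_eq_bot']
    intro p hp
    have h1 : algebraMap B (FractionRing B) (aeval x (X * p)) ∈ V :=
      (Submodule.Quotient.mk_eq_zero (Vsub h)).1 hp
    obtain ⟨c, hc⟩ := h.const h1
    rw [← aeval_C (x := x)] at hc
    have h2 := hD.aeval_inj hx hc
    have h3 := congrArg (fun r => coeff r 0) h2
    simp at h3
    rw [h3] at h2
    simpa using h2.symm
  obtain ⟨g, hg⟩ := LinearMap.exists_leftInverse_of_injective f hf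
  let l : FractionRing B →ₗ[k] k :=
    ((Polynomial.basisMonomials k).constr k (fun i => if i ∈ s then (1:k) else 0)) ∘ₗ g ∘ₗ
      (Vsub h).mkQ
  refine ⟨l.toAddMonoidHom, ?_, ?_⟩
  · intro z hz
    have : (Vsub h).mkQ z = 0 := (Submodule.Quotient.mk_eq_zero (Vsub h)).2 hz
    show ((Polynomial.basisMonomials k).constr k _) (g ((Vsub h).mkQ z)) = 0
    rw [this, map_zero, map_zero]
  · intro i
    have e1 : (Vsub h).mkQ (algebraMap B (FractionRing B) (x ^ (i+1))) = f (X ^ i) := by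
      show _ = (Vsub h).mkQ (algebraMap B (FractionRing B) (aeval x (X * X ^ i)))
      congr 2
      rw [map_mul (aeval x), map_pow (aeval x), aeval_X, pow_succ']
    have e2 : l (algebraMap B (FractionRing B) (x ^ (i+1))) = if i ∈ s then (1:k) else 0 := by
      show ((Polynomial.basisMonomials k).constr k _) (g ((Vsub h).mkQ _)) = _
      have e3 : g (f (X ^ i)) = X ^ i := LinearMap.congr_fun hg _
      rw [e1, e3, X_pow_eq_monomial]
      have := (Polynomial.basisMonomials k).constr_basis k (fun i => if i ∈ s then (1:k) else 0) i
      rw [Polynomial.coe_basisMonomials] at this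
      exact this
    show l _ = 0 ↔ _
    rw [e2]
    split_ifs with hs <;> simp [hs]

theorem isPrincipalIdealRing [Finite k] [IsDedekindDomain B] (h : InfPlace k B V)
    (hD : DegRing k B deg)
    (hle : ∀ b c : B, c ≠ 0 →
      (algebraMap B (FractionRing B) b / algebraMap B (FractionRing B) c ∈ V ↔ deg b ≤ deg c))
    (hrig : IsUniformizationallyRigid B) : IsPrincipalIdealRing B := by
  classical
  have hbez : IsBezout B := by
    rw [IsBezout.iff_span_pair_isPrincipal]
    intro c0 d0
    by_contra hnp
    obtain ⟨x, hx⟩ := hD.pos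
    have H : ∀ s : Set ℕ, ∃ Δ : Subgroup (GL (Fin 2) B), Δ.FiniteIndex ∧
        (Ideal.span {x} : Ideal B) ≤ (quasiLevelGL Δ : Set B) ∧
        ∀ i, (uT c0 d0 (x ^ (i+1)) ∈ Δ ↔ i ∉ s) := by
      intro s
      obtain ⟨l, hl1, hl2⟩ := exists_functional h hD x hx s
      obtain ⟨Δ, h1, h2, h3⟩ := exists_subgroup h hD hle ![c0, d0] (by simpa using hnp) x hx l hl1
      refine ⟨Δ, h1, h2, ?_⟩
      intro i
      rw [← hl2 i]
      exact h3 _ (Ideal.mem_span_singleton.2 (dvd_pow_self x (by omega)))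
    choose Δ h1 h2 h3 using H
    have hinj : Function.Injective Δ := by
      intro s t hst
      ext i
      have e1 := h3 s i
      have e2 := h3 t i
      rw [hst] at e1
      tauto
    have hcount := hrig.mono (s₁ := Set.range Δ) (by
      rintro _ ⟨s, rfl⟩
      refine ⟨h1 s, Ideal.span {x}, ?_, h2 s⟩
      rw [Ne, Ideal.span_singleton_eq_bot]
      exact hD.ne_zero_of_pos hx)
    have : Countable (Set ℕ) := by
      have := hcount.to_subtype
      exact Function.Injective.countable (f := Set.rangeFactorization Δ)
        (fun a b hab => hinj (congrArg Subtype.val hab))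
    obtain ⟨f, hf⟩ := exists_injective_nat (Set ℕ)
    exact Function.cantor_injective f hf
  infer_instance

end Cusp
end

section
open Polynomial

namespace DegRing
variable {k B : Type*} [Field k] [CommRing B] [IsDomain B] [Algebra k B] {deg : B → ℕ}

/-- dimension of the space of elements of degree at most `n`. -/
noncomputable def l (h : DegRing k B deg) (n : ℕ) : ℕ := Module.finrank k (h.L n)

theorem L_mono (h : DegRing k B deg) {m n : ℕ} (hmn : m ≤ n) : h.L m ≤ h.L n :=
  fun _ hb => le_trans hb hmn

theorem l_mono (h : DegRing k B deg) {m n : ℕ} (hmn : m ≤ n) : h.l m ≤ h.l n :=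
  Submodule.finrank_mono (h.L_mono hmn)

theorem finrank_map_mul (h : DegRing k B deg) {b : B} (hb : b ≠ 0) (n : ℕ) :
    Module.finrank k ((h.L n).map (LinearMap.mulLeft k b)) = h.l n :=
  (Submodule.equivMapOfInjective (LinearMap.mulLeft k b)
    (fun x y hxy => mul_left_cancel₀ hb hxy) (h.L n)).finrank_eq.symm

theorem mem_map_mul (h : DegRing k B deg) {b : B} (hb : b ≠ 0) (n : ℕ) (z : B) :
    z ∈ (h.L n).map (LinearMap.mulLeft k b) ↔ b ∣ z ∧ deg z ≤ n + deg b ∨ z = 0 := by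
  constructor
  · rintro ⟨y, hy, rfl⟩
    by_cases hy0 : y = 0
    · right; rw [hy0, map_zero]
    left
    refine ⟨⟨y, rfl⟩, ?_⟩
    show deg (b * y) ≤ _
    rw [h.mul _ _ hb hy0]
    have : deg y ≤ n := hy
    omega
  · rintro (⟨⟨y, rfl⟩, h2⟩ | rfl)
    · by_cases hy0 : y = 0
      · rw [hy0, mul_zero]; exact Submodule.zero_mem _
      refine ⟨y, ?_, rfl⟩
      rw [h.mul _ _ hb hy0] at h2
      show deg y ≤ n
      omega
    · exact Submodule.zero_mem _

theorem l_conv (h : DegRing k B deg) {b : B} (hb : b ≠ 0) (n : ℕ) :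
    h.l (n + 1) + h.l (n + deg b) ≤ h.l (n + 1 + deg b) + h.l n := by
  have h1 := Submodule.finrank_sup_add_finrank_inf_eq
    ((h.L (n+1)).map (LinearMap.mulLeft k b)) (h.L (n + deg b))
  rw [h.finrank_map_mul hb] at h1
  have h2 : (h.L (n+1)).map (LinearMap.mulLeft k b) ⊓ (h.L (n + deg b)) =
      (h.L n).map (LinearMap.mulLeft k b) := by
    ext z
    rw [Submodule.mem_inf, h.mem_map_mul hb, h.mem_map_mul hb, mem_L]
    constructor
    · rintro ⟨⟨h3, h4⟩ | h3, h5⟩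
      · exact Or.inl ⟨h3, h5⟩
      · exact Or.inr h3
    · rintro (⟨h3, h4⟩ | h3)
      · exact ⟨Or.inl ⟨h3, by omega⟩, h4⟩
      · exact ⟨Or.inr h3, by rw [h3, h.zero]; omega⟩
  rw [h2, h.finrank_map_mul hb] at h1
  have h3 : Module.finrank k ↥((h.L (n+1)).map (LinearMap.mulLeft k b) ⊔ (h.L (n + deg b)))
      ≤ h.l (n + 1 + deg b) := by
    apply Submodule.finrank_mono
    apply sup_le
    · intro z hz
      rw [h.mem_map_mul hb] at hz
      rcases hz with hz | hz
      · exact hz.2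
      · rw [hz]; exact Submodule.zero_mem _
    · exact h.L_mono (by omega)
  change _ = h.l (n+1) + h.l (n + deg b) at h1
  omega

theorem l_add_deg (h : DegRing k B deg) {b : B} (hb : b ≠ 0) :
    (∀ n, h.l (n + deg b) ≤ h.l n + deg b) ∧
      ∃ n0, ∀ n, n0 ≤ n → h.l (n + deg b) = h.l n + deg b := by
  have hfin := h.fin b hb
  let π : B →ₗ[k] (B ⧸ Ideal.span {b}) := (Ideal.Quotient.mkₐ k (Ideal.span {b})).toLinearMap
  have key : ∀ n, Module.finrank k (LinearMap.range (π ∘ₗ (h.L (n + deg b)).subtype)) + h.l n =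
      h.l (n + deg b) := by
    intro n
    have h1 := LinearMap.finrank_range_add_finrank_ker (π ∘ₗ (h.L (n + deg b)).subtype)
    have h2 : Module.finrank k (LinearMap.ker (π ∘ₗ (h.L (n + deg b)).subtype)) = h.l n := by
      rw [← h.finrank_map_mul hb n]
      have h3 : (h.L n).map (LinearMap.mulLeft k b) =
        (LinearMap.ker (π ∘ₗ (h.L (n + deg b)).subtype)).map (h.L (n + deg b)).subtype := by
        ext z
        rw [h.mem_map_mul hb]
        have hz : π z = 0 ↔ b ∣ z := by
          rw [← Ideal.mem_span_singleton]; exact Ideal.Quotient.eq_zero_iff_mem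
        constructor
        · intro h3
          refine ⟨⟨z, ?_⟩, ?_, rfl⟩
          · rcases h3 with h3 | h3
            · exact h3.2
            · rw [h3]; exact Submodule.zero_mem _
          · show π z = 0
            rw [hz]
            rcases h3 with h3 | h3
            · exact h3.1
            · rw [h3]; exact dvd_zero _
        · rintro ⟨⟨y, hy⟩, hy2, rfl⟩
          left
          exact ⟨hz.1 hy2, hy⟩
      rw [h3]
      exact (Submodule.equivMapOfInjective _ (Submodule.subtype_injective _) _).finrank_eq
    rw [h2] at h1
    exact h1
  have hsurj : Function.Surjective π := Ideal.Quotient.mk_surjective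
  constructor
  · intro n
    have h1 := key n
    have h2 := Submodule.finrank_le (LinearMap.range (π ∘ₗ (h.L (n + deg b)).subtype))
    rw [h.finrank b hb] at h2
    omega
  · obtain ⟨s, hs⟩ := hfin.fg_top
    choose r hr using hsurj
    refine ⟨s.sup (fun z => deg (r z)), fun n hn => ?_⟩
    have h1 := key n
    have h2 : LinearMap.range (π ∘ₗ (h.L (n + deg b)).subtype) = ⊤ := by
      rw [eq_top_iff, ← hs, Submodule.span_le]
      intro z hz
      refine ⟨⟨r z, ?_⟩, hr z⟩
      have h3 : deg (r z) ≤ _ := Finset.le_sup (f := fun z => deg (r z)) hz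
      show deg (r z) ≤ _
      omega
    rw [h2, finrank_top, h.finrank b hb] at h1
    omega

theorem exists_delta (h : DegRing k B deg) : ∃ δ : ℕ, 0 < δ ∧ (∀ b : B, δ ∣ deg b) ∧
    ∃ n0, ∀ n, n0 ≤ n → h.l (n + δ) = h.l n + δ := by
  classical
  let P : ℕ → Prop := fun t => ∃ n0, ∀ n, n0 ≤ n → h.l (n + t) = h.l n + t
  have hsub : ∀ s t, P s → P (s + t) → P t := by
    rintro s t ⟨a, ha⟩ ⟨c, hc⟩
    refine ⟨max a c, fun n hn => ?_⟩
    have h1 := hc n (by omega)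
    have h2 := ha (n + t) (by omega)
    have e : n + (s + t) = n + t + s := by ring
    rw [e, h2] at h1
    omega
  have hdeg : ∀ b : B, b ≠ 0 → P (deg b) := fun b hb => (h.l_add_deg hb).2
  obtain ⟨x, hx⟩ := h.pos
  have hex : ∃ t, 0 < t ∧ P t := ⟨deg x, hx, hdeg x (h.ne_zero_of_pos hx)⟩
  obtain ⟨h1, h2⟩ := Nat.find_spec hex
  refine ⟨Nat.find hex, h1, ?_, h2⟩
  intro b
  by_cases hb : b = 0
  · rw [hb, h.zero]; exact dvd_zero _
  have hred : ∀ j r, P (j * Nat.find hex + r) → P r := by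
    intro j r
    induction j with
    | zero => simp
    | succ j ih =>
      intro h3
      apply ih
      apply hsub _ _ h2
      have e : (j + 1) * Nat.find hex + r = Nat.find hex + (j * Nat.find hex + r) := by ring
      rwa [← e]
  have h3 : P (deg b % Nat.find hex) := by
    apply hred (deg b / Nat.find hex)
    rw [Nat.div_add_mod']
    exact hdeg b hb
  by_contra h4
  have h5 : 0 < deg b % Nat.find hex := Nat.pos_of_ne_zero (fun h5 => h4 (Nat.dvd_of_mod_eq_zero h5))
  exact Nat.find_min hex (Nat.mod_lt _ h1) ⟨h5, h3⟩

theorem l_zero (h : DegRing k B deg) : h.l 0 = 1 := by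
  have : h.L 0 = Submodule.span k {(1 : B)} := by
    ext b
    rw [mem_L, Submodule.mem_span_singleton]
    constructor
    · intro hb
      obtain ⟨c, hc⟩ := h.const b (by omega)
      exact ⟨c, by rw [← hc, Algebra.smul_def, mul_one]⟩
    · rintro ⟨c, rfl⟩
      have := h.deg_smul_le c 1
      rwa [h.deg_one] at this
  unfold l
  rw [this]
  exact finrank_span_singleton one_ne_zero

theorem l_succ_le (h : DegRing k B deg) (n0 : ℕ) (hn0 : ∀ n, n0 ≤ n → h.l (n + 1) = h.l n + 1)
    (n : ℕ) : h.l (n + 1) ≤ h.l n + 1 := by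
  obtain ⟨x, hx⟩ := h.pos
  have hx0 := h.ne_zero_of_pos hx
  have h1 := h.l_conv (pow_ne_zero n0 hx0) n
  rw [h.deg_pow hx0] at h1
  have h2 := hn0 (n + n0 * deg x) (by nlinarith)
  have e : n + 1 + n0 * deg x = n + n0 * deg x + 1 := by ring
  rw [e, h2] at h1
  omega

theorem l_eq_of_not (h : DegRing k B deg) (n : ℕ) (hn : ∀ b, deg b ≠ n + 1) :
    h.l (n+1) = h.l n := by
  have : h.L (n+1) = h.L n := by
    apply le_antisymm _ (h.L_mono (by omega))
    intro b hb
    have h1 : deg b ≤ n + 1 := hb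
    have := hn b
    show deg b ≤ n
    omega
  unfold l
  rw [this]

theorem l_lt_of (h : DegRing k B deg) (n : ℕ) (b : B) (hb : deg b = n + 1) :
    h.l n < h.l (n+1) := by
  apply Submodule.finrank_lt_finrank_of_lt
  refine lt_of_le_of_ne (h.L_mono (by omega)) ?_
  intro e
  have : b ∈ h.L (n+1) := by rw [mem_L]; omega
  rw [← e, mem_L] at this
  omega

end DegRing
end

section
open Polynomial

namespace DegRing
variable {k B : Type*} [Field k] [Finite k] [CommRing B] [IsDomain B] [Algebra k B] {deg : B → ℕ}

/-- elements of degree at most `n`, as a finset. -/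
noncomputable def LF (h : DegRing k B deg) (n : ℕ) : Finset B := (h.finite_deg_le n).toFinset

theorem mem_LF (h : DegRing k B deg) (n : ℕ) (b : B) : b ∈ h.LF n ↔ deg b ≤ n := by
  simp [LF]

open Classical in
/-- nonzero elements of degree exactly `n`. -/
noncomputable def E (h : DegRing k B deg) (n : ℕ) : Finset B :=
  (h.LF n).filter (fun b => b ≠ 0 ∧ deg b = n)

theorem mem_E (h : DegRing k B deg) (n : ℕ) (b : B) : b ∈ h.E n ↔ b ≠ 0 ∧ deg b = n := by
  classical
  unfold E
  rw [Finset.mem_filter, h.mem_LF]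
  constructor
  · exact fun h1 => h1.2
  · exact fun h1 => ⟨h1.2.le, h1⟩

open Classical in
/-- prime elements of degree at most `n`. -/
noncomputable def Pr (h : DegRing k B deg) (n : ℕ) : Finset B :=
  (h.LF n).filter (fun b => Prime b)

theorem mem_Pr (h : DegRing k B deg) (n : ℕ) (b : B) : b ∈ h.Pr n ↔ deg b ≤ n ∧ Prime b := by
  classical
  unfold Pr
  rw [Finset.mem_filter, h.mem_LF]

theorem card_LF (h : DegRing k B deg) (n : ℕ) : (h.LF n).card = Nat.card k ^ h.l n := by
  have h1 : Nat.card (h.L n) = Nat.card k ^ h.l n := Module.natCard_eq_pow_finrank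
  rw [← h1, ← Nat.card_eq_finsetCard]
  apply Nat.card_congr
  exact Equiv.subtypeEquivRight (fun b => by rw [h.mem_LF, h.mem_L])

theorem card_E_succ (h : DegRing k B deg) (n : ℕ) :
    (h.E (n+1)).card + Nat.card k ^ h.l n = Nat.card k ^ h.l (n+1) := by
  classical
  rw [← h.card_LF, ← h.card_LF, ← Finset.card_union_of_disjoint]
  · congr 1
    ext b
    rw [Finset.mem_union, h.mem_E, h.mem_LF, h.mem_LF]
    constructor
    · rintro (h1 | h1) <;> omega
    · intro h1
      by_cases h2 : deg b ≤ n
      · exact Or.inr h2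
      · exact Or.inl ⟨h.ne_zero_of_pos (by omega), by omega⟩
  · rw [Finset.disjoint_left]
    intro b h1 h2
    rw [h.mem_E] at h1
    rw [h.mem_LF] at h2
    omega

theorem card_E_zero (h : DegRing k B deg) : (h.E 0).card + 1 = Nat.card k := by
  classical
  have h1 := h.card_LF 0
  rw [h.l_zero, pow_one] at h1
  rw [← h1, ← Finset.card_singleton (0 : B), ← Finset.card_union_of_disjoint]
  · congr 1
    ext b
    rw [Finset.mem_union, h.mem_E, h.mem_LF, Finset.mem_singleton]
    constructor
    · rintro (h1 | h1)
      · omega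
      · rw [h1, h.zero]
    · intro h1
      by_cases h2 : b = 0
      · exact Or.inr h2
      · exact Or.inl ⟨h2, by omega⟩
  · rw [Finset.disjoint_left]
    intro b h1 h2
    rw [h.mem_E] at h1
    rw [Finset.mem_singleton] at h2
    exact h1.1 h2

theorem deg_prime_pos (h : DegRing k B deg) {p : B} (hp : Prime p) : 0 < deg p := by
  rcases Nat.eq_zero_or_pos (deg p) with h1 | h1
  · exact absurd (h.isUnit_of_deg hp.ne_zero h1) hp.not_isUnit
  · exact h1

theorem deg_dvd_le (h : DegRing k B deg) {a b : B} (hab : a ∣ b) (hb : b ≠ 0) : deg a ≤ deg b := by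
  obtain ⟨c, rfl⟩ := hab
  have h1 : a ≠ 0 := left_ne_zero_of_mul hb
  have h2 : c ≠ 0 := right_ne_zero_of_mul hb
  rw [h.mul _ _ h1 h2]; omega

theorem pow_dvd_le (h : DegRing k B deg) {p b : B} (hp : Prime p) (hb : b ≠ 0) {j : ℕ}
    (hj : p ^ j ∣ b) : j ≤ deg b := by
  have h1 := h.deg_dvd_le hj hb
  rw [h.deg_pow hp.ne_zero] at h1
  have := h.deg_prime_pos hp
  nlinarith

theorem finMult (h : DegRing k B deg) {p b : B} (hp : Prime p) (hb : b ≠ 0) :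
    FiniteMultiplicity p b :=
  ⟨deg b, fun h1 => by have := h.pow_dvd_le hp hb h1; omega⟩

open Classical in
theorem card_assoc (h : DegRing k B deg) {p : B} (hp : p ≠ 0) (n : ℕ) (hn : deg p ≤ n) :
    ((h.LF n).filter (fun x => Associated p x)).card = Nat.card k - 1 := by
  have h1 := h.card_E_zero
  have h2 : ((h.LF n).filter (fun x => Associated p x)).card = (h.E 0).card := by
    symm
    apply Finset.card_bij (fun u _ => p * u)
    · intro u hu
      rw [h.mem_E] at hu
      rw [Finset.mem_filter, h.mem_LF, h.mul _ _ hp hu.1]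
      obtain ⟨w, hw⟩ := h.isUnit_of_deg hu.1 hu.2
      exact ⟨by omega, w, by rw [hw]⟩
    · intro a _ b _ hab
      exact mul_left_cancel₀ hp hab
    · intro b hb
      rw [Finset.mem_filter] at hb
      obtain ⟨u, hu⟩ := hb.2
      exact ⟨u, by rw [h.mem_E]; exact ⟨u.ne_zero, h.deg_of_isUnit u.isUnit⟩, hu⟩
  omega

theorem sum_mult (h : DegRing k B deg) [IsPrincipalIdealRing B] (n : ℕ) (b : B) (hb : b ≠ 0)
    (hn : deg b ≤ n) :
    ∑ p ∈ h.Pr n, deg p * multiplicity p b = (Nat.card k - 1) * deg b := by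
  classical
  induction b using UniqueFactorizationMonoid.induction_on_prime with
  | h₁ => exact absurd rfl hb
  | h₂ b hu =>
    rw [h.deg_of_isUnit hu, mul_zero]
    apply Finset.sum_eq_zero
    intro p hp
    rw [h.mem_Pr] at hp
    rw [multiplicity_eq_zero.2, mul_zero]
    intro h1
    exact hp.2.not_isUnit (isUnit_of_dvd_unit h1 hu)
  | h₃ a p ha hp ih =>
    rw [h.mul _ _ hp.ne_zero ha] at hn ⊢
    have h1 : ∀ x ∈ h.Pr n, deg x * multiplicity x (p * a) =
        (if Associated p x then deg p else 0) + deg x * multiplicity x a := by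
      intro x hx
      rw [h.mem_Pr] at hx
      rw [multiplicity_mul hx.2 (h.finMult hx.2 hb), mul_add]
      congr 1
      by_cases hpx : Associated p x
      · rw [if_pos hpx]
        have e1 : multiplicity x p = 1 := by
          apply multiplicity_eq_of_dvd_of_not_dvd
          · rw [pow_one]; exact hpx.symm.dvd
          · intro h3
            have h4 : p ^ (1+1) ∣ p := (pow_dvd_pow_of_dvd hpx.dvd _).trans h3
            have h5 := h.deg_dvd_le h4 hp.ne_zero
            rw [h.deg_pow hp.ne_zero] at h5
            have := h.deg_prime_pos hp
            omega
        rw [e1, mul_one]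
        apply le_antisymm
        · exact h.deg_dvd_le hpx.symm.dvd hp.ne_zero
        · exact h.deg_dvd_le hpx.dvd hx.2.ne_zero
      · rw [if_neg hpx, multiplicity_eq_zero.2, mul_zero]
        intro h3
        exact hpx ((hx.2.dvd_prime_iff_associated hp).1 h3).symm
    rw [Finset.sum_congr rfl h1, Finset.sum_add_distrib, ih ha (by omega), ← Finset.sum_filter,
      Finset.sum_const, smul_eq_mul, mul_add]
    congr 2
    rw [← h.card_assoc hp.ne_zero n (by omega)]
    congr 1
    ext x
    rw [Finset.mem_filter, Finset.mem_filter, h.mem_Pr, h.mem_LF]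
    constructor
    · rintro ⟨h3, h4⟩; exact ⟨h3.1, h4⟩
    · rintro ⟨h3, h4⟩; exact ⟨⟨h3, h4.prime hp⟩, h4⟩

/-- weighted number of primes with degree dividing `n`. -/
noncomputable def Nt (h : DegRing k B deg) (n : ℕ) : ℕ :=
  ∑ p ∈ (h.Pr n).filter (fun p => deg p ∣ n), deg p

theorem mult_eq_card (h : DegRing k B deg) {p b : B} (hp : Prime p) (hb : b ≠ 0) (n : ℕ)
    (hn : deg b ≤ n) [DecidablePred fun j => p ^ j ∣ b] :
    multiplicity p b = ((Finset.Icc 1 n).filter (fun j => p ^ j ∣ b)).card := by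
  have h1 : (Finset.Icc 1 n).filter (fun j => p ^ j ∣ b) = Finset.Icc 1 (multiplicity p b) := by
    ext j
    rw [Finset.mem_filter, Finset.mem_Icc, Finset.mem_Icc,
      (h.finMult hp hb).pow_dvd_iff_le_multiplicity]
    constructor
    · rintro ⟨h2, h3⟩; exact ⟨h2.1, h3⟩
    · rintro ⟨h2, h3⟩
      refine ⟨⟨h2, ?_⟩, h3⟩
      have := h.pow_dvd_le hp hb (pow_multiplicity_dvd p b)
      omega
  rw [h1, Nat.card_Icc]; omega

open Classical in
theorem card_mult (h : DegRing k B deg) {a : B} (ha : a ≠ 0) (n : ℕ) :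
    ((h.E n).filter (fun b => a ∣ b)).card = if deg a ≤ n then (h.E (n - deg a)).card else 0 := by
  split_ifs with h1
  · symm
    apply Finset.card_bij (fun u _ => a * u)
    · intro u hu
      rw [h.mem_E] at hu
      rw [Finset.mem_filter, h.mem_E, h.mul _ _ ha hu.1]
      exact ⟨⟨mul_ne_zero ha hu.1, by omega⟩, dvd_mul_right _ _⟩
    · intro x _ y _ hxy
      exact mul_left_cancel₀ ha hxy
    · intro b hb
      rw [Finset.mem_filter, h.mem_E] at hb
      obtain ⟨⟨h2, h3⟩, u, rfl⟩ := hb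
      have hu := right_ne_zero_of_mul h2
      rw [h.mul _ _ ha hu] at h3
      exact ⟨u, by rw [h.mem_E]; exact ⟨hu, by omega⟩, rfl⟩
  · rw [Finset.card_eq_zero, Finset.filter_eq_empty_iff]
    intro b hb h2
    rw [h.mem_E] at hb
    have := h.deg_dvd_le h2 hb.1
    omega

theorem recurrence (h : DegRing k B deg) [IsPrincipalIdealRing B] (n : ℕ) :
    (Nat.card k - 1) * n * (h.E n).card = ∑ j ∈ Finset.Icc 1 n, h.Nt j * (h.E (n - j)).card := by
  classical
  have h1 : (Nat.card k - 1) * n * (h.E n).card =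
      ∑ b ∈ h.E n, ∑ p ∈ h.Pr n, deg p * multiplicity p b := by
    rw [Finset.sum_congr rfl (g := fun _ => (Nat.card k - 1) * n)]
    · rw [Finset.sum_const, smul_eq_mul]; ring
    · intro b hb
      rw [h.mem_E] at hb
      rw [h.sum_mult n b hb.1 hb.2.le, hb.2]
  have h2 : ∀ p ∈ h.Pr n, ∑ b ∈ h.E n, deg p * multiplicity p b =
      ∑ j ∈ Finset.Icc 1 n, if deg p ∣ j then deg p * (h.E (n - j)).card else 0 := by
    intro p hp
    rw [h.mem_Pr] at hp
    have hpos := h.deg_prime_pos hp.2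
    have h3 : ∀ b ∈ h.E n, deg p * multiplicity p b =
        ∑ i ∈ Finset.Icc 1 n, if p ^ i ∣ b then deg p else 0 := by
      intro b hb
      rw [h.mem_E] at hb
      rw [h.mult_eq_card hp.2 hb.1 n hb.2.le, ← Finset.sum_filter, Finset.sum_const, smul_eq_mul,
        mul_comm]
    rw [Finset.sum_congr rfl h3, Finset.sum_comm]
    have h4 : ∀ i ∈ Finset.Icc 1 n, (∑ b ∈ h.E n, if p ^ i ∣ b then deg p else 0) =
        if i * deg p ≤ n then deg p * (h.E (n - i * deg p)).card else 0 := by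
      intro i _
      rw [← Finset.sum_filter, Finset.sum_const, smul_eq_mul, h.card_mult (pow_ne_zero _ hp.2.ne_zero),
        h.deg_pow hp.2.ne_zero]
      split_ifs <;> ring
    rw [Finset.sum_congr rfl h4, ← Finset.sum_filter, ← Finset.sum_filter]
    apply Finset.sum_bij (fun i _ => i * deg p)
    · intro i hi
      rw [Finset.mem_filter, Finset.mem_Icc] at hi ⊢
      exact ⟨⟨by nlinarith, hi.2⟩, dvd_mul_left _ _⟩
    · intro a _ b _ hab
      exact Nat.eq_of_mul_eq_mul_right hpos hab
    · intro j hj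
      rw [Finset.mem_filter, Finset.mem_Icc] at hj
      obtain ⟨⟨h5, h6⟩, i, rfl⟩ := hj
      refine ⟨i, ?_, mul_comm _ _⟩
      rw [Finset.mem_filter, Finset.mem_Icc]
      have : 0 < i := Nat.pos_of_ne_zero (by rintro rfl; simp at h5)
      exact ⟨⟨by omega, by nlinarith⟩, by linarith⟩
    · intro i _; rfl
  rw [h1, Finset.sum_comm, Finset.sum_congr rfl h2, Finset.sum_comm]
  apply Finset.sum_congr rfl
  intro j hj
  rw [Finset.mem_Icc] at hj
  rw [Nt, Finset.sum_mul, ← Finset.sum_filter]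
  apply Finset.sum_congr _ (fun _ _ => rfl)
  ext p
  rw [Finset.mem_filter, Finset.mem_filter, h.mem_Pr, h.mem_Pr]
  constructor
  · rintro ⟨h5, h6⟩; exact ⟨⟨Nat.le_of_dvd (by omega) h6, h5.2⟩, h6⟩
  · rintro ⟨h5, h6⟩; exact ⟨⟨by omega, h5.2⟩, h6⟩

end DegRing
end

section
open Polynomial

namespace DegRing
variable {k B : Type*} [Field k] [CommRing B] [IsDomain B] [Algebra k B] {deg : B → ℕ}
  {Ω : Type*} [Field Ω] [Algebra k Ω]

/-- points killing `G` are homs from the quotient. -/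
noncomputable def zerosEquiv (k Ω : Type*) {B : Type*} [Field k] [CommRing B] [Algebra k B]
    [Field Ω] [Algebra k Ω] (G : B) :
    {P : B →ₐ[k] Ω | P G = 0} ≃ ((B ⧸ Ideal.span {G}) →ₐ[k] Ω) where
  toFun P := Ideal.Quotient.liftₐ (Ideal.span {G}) P.1 (by
    intro a ha
    obtain ⟨c, rfl⟩ := Ideal.mem_span_singleton.1 ha
    rw [map_mul, show P.1 G = 0 from P.2, zero_mul])
  invFun φ := ⟨φ.comp (Ideal.Quotient.mkₐ k (Ideal.span {G})), by
    show φ (Ideal.Quotient.mk _ G) = 0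
    rw [Ideal.Quotient.eq_zero_iff_mem.2 (Ideal.mem_span_singleton_self G), map_zero]⟩
  left_inv P := by
    ext b; rfl
  right_inv φ := by
    ext b
    obtain ⟨b, rfl⟩ := Ideal.Quotient.mk_surjective b
    rfl

theorem zeros_finite (h : DegRing k B deg) {G : B} (hG : G ≠ 0) :
    {P : B →ₐ[k] Ω | P G = 0}.Finite := by
  have := h.fin G hG
  have : Finite ((B ⧸ Ideal.span {G}) →ₐ[k] Ω) := inferInstance
  exact Set.finite_coe_iff.1 (Finite.of_equiv _ (zerosEquiv k Ω G).symm)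

theorem zeros_ncard_le (h : DegRing k B deg) {G : B} (hG : G ≠ 0) :
    {P : B →ₐ[k] Ω | P G = 0}.ncard ≤ deg G := by
  have := h.fin G hG
  rw [← Nat.card_coe_set_eq, Nat.card_congr (zerosEquiv k Ω G), ← h.finrank G hG]
  exact card_algHom_le_finrank k _ Ω

theorem isMaximal_of_prime [IsPrincipalIdealRing B] {p : B} (hp : Prime p) :
    (Ideal.span {p}).IsMaximal :=
  PrincipalIdealRing.isMaximal_of_irreducible hp.irreducible

theorem zeros_prime_ncard [Finite k] [IsAlgClosed Ω] [IsPrincipalIdealRing B] (h : DegRing k B deg) {p : B} (hp : Prime p) :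
    {P : B →ₐ[k] Ω | P p = 0}.ncard = deg p := by
  have := h.fin p hp.ne_zero
  have := isMaximal_of_prime hp
  letI : Field (B ⧸ Ideal.span {p}) := Ideal.Quotient.field _
  rw [← Nat.card_coe_set_eq, Nat.card_congr (zerosEquiv k Ω p), ← h.finrank p hp.ne_zero]
  rw [Nat.card_eq_fintype_card]
  exact AlgHom.card k (B ⧸ Ideal.span {p}) Ω

theorem pow_card_sub_mem [Finite k] [IsPrincipalIdealRing B] (h : DegRing k B deg) {p : B}
    (hp : Prime p) (b : B) : p ∣ b ^ (Nat.card k ^ deg p) - b := by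
  have := h.fin p hp.ne_zero
  have := isMaximal_of_prime hp
  letI : Field (B ⧸ Ideal.span {p}) := Ideal.Quotient.field _
  have : Finite (B ⧸ Ideal.span {p}) := Module.finite_of_finite k
  rw [← Ideal.mem_span_singleton, ← Ideal.Quotient.eq_zero_iff_mem, map_sub, map_pow]
  have h1 : Nat.card (B ⧸ Ideal.span {p}) = Nat.card k ^ deg p := by
    rw [← h.finrank p hp.ne_zero]; exact Module.natCard_eq_pow_finrank
  letI := Fintype.ofFinite (B ⧸ Ideal.span {p})
  rw [← h1, Nat.card_eq_fintype_card, FiniteField.pow_card, sub_self]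

/-- points fixed by the `n`th power of Frobenius. -/
def Fix (k B Ω : Type*) [Field k] [CommRing B] [Algebra k B] [Field Ω] [Algebra k Ω] (n : ℕ) :
    Set (B →ₐ[k] Ω) :=
  {P | ∀ b, P b ^ (Nat.card k ^ n) = P b}

theorem pow_sub_ne_zero (h : DegRing k B deg) {x : B} (hx : 0 < deg x) {Q : ℕ} (hQ : 1 < Q) :
    x ^ Q - x ≠ 0 := by
  intro h0
  have h1 := h.deg_pow (h.ne_zero_of_pos hx) Q
  rw [sub_eq_zero.1 h0] at h1
  nlinarith

theorem Fix_finite [Finite k] (h : DegRing k B deg) {n : ℕ} (hn : 1 ≤ n) : (Fix k B Ω n).Finite := by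
  obtain ⟨x, hx⟩ := h.pos
  have hQ : 1 < Nat.card k ^ n := Nat.one_lt_pow (by omega) Finite.one_lt_card
  refine (h.zeros_finite (Ω := Ω) (h.pow_sub_ne_zero hx hQ)).subset ?_
  intro P hP
  show P _ = 0
  rw [map_sub, map_pow, hP x, sub_self]

theorem exists_prime_of_fix [Finite k] [IsPrincipalIdealRing B] (h : DegRing k B deg) {n : ℕ}
    (hn : 1 ≤ n) {P : B →ₐ[k] Ω} (hP : P ∈ Fix k B Ω n) :
    ∃ p : B, Prime p ∧ P p = 0 ∧ deg p ∣ n := by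
  obtain ⟨x, hx⟩ := h.pos
  have hQ : 1 < Nat.card k ^ n := Nat.one_lt_pow (by omega) Finite.one_lt_card
  have hker : (RingHom.ker P).IsPrime := RingHom.ker_isPrime _
  obtain ⟨p, hp⟩ := IsPrincipalIdealRing.principal (RingHom.ker P)
  rw [Ideal.submodule_span_eq] at hp
  have hp0 : p ≠ 0 := by
    rintro rfl
    have : x ^ (Nat.card k ^ n) - x ∈ RingHom.ker P := by
      rw [RingHom.mem_ker, map_sub, map_pow, hP x, sub_self]
    rw [hp, Ideal.mem_span_singleton, zero_dvd_iff] at this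
    exact h.pow_sub_ne_zero hx hQ this
  have hpp : Prime p := by
    rw [← Ideal.span_singleton_prime hp0, ← hp]; exact hker
  refine ⟨p, hpp, ?_, ?_⟩
  · rw [← RingHom.mem_ker, hp]; exact Ideal.mem_span_singleton_self p
  have := h.fin p hp0
  have := isMaximal_of_prime hpp
  letI : Field (B ⧸ Ideal.span {p}) := Ideal.Quotient.field _
  have : Finite (B ⧸ Ideal.span {p}) := Module.finite_of_finite k
  letI := Fintype.ofFinite k
  rw [← h.finrank p hp0, ← FiniteField.orderOf_frobeniusAlgHom, orderOf_dvd_iff_pow_eq_one]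
  ext b
  obtain ⟨b, rfl⟩ := Ideal.Quotient.mk_surjective b
  rw [AlgHom.coe_pow, FiniteField.coe_frobeniusAlgHom, pow_iterate, ← Nat.card_eq_fintype_card]
  show (Ideal.Quotient.mk (Ideal.span {p}) b) ^ _ = Ideal.Quotient.mk (Ideal.span {p}) b
  rw [← map_pow, Ideal.Quotient.eq, ← hp, RingHom.mem_ker, map_sub, map_pow, hP b, sub_self]

theorem Fix_le_Nt [Finite k] [IsPrincipalIdealRing B] (h : DegRing k B deg) {n : ℕ} (hn : 1 ≤ n) :
    (Nat.card k - 1) * (Fix k B Ω n).ncard ≤ h.Nt n := by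
  classical
  have hf := h.Fix_finite (Ω := Ω) hn
  set S := (h.Pr n).filter (fun p => deg p ∣ n) with hS
  have h1 : ∑ P ∈ hf.toFinset, (S.filter (fun p => P p = 0)).card
      = ∑ p ∈ S, (hf.toFinset.filter (fun P => P p = 0)).card := by
    simp only [Finset.card_filter]
    exact Finset.sum_comm
  have h2 : ∑ p ∈ S, (hf.toFinset.filter (fun P => P p = 0)).card ≤ h.Nt n := by
    have : h.Nt n = ∑ p ∈ S, deg p := by
      rw [Nt, hS]
    rw [this]
    apply Finset.sum_le_sum
    intro p hp
    have hp' := ((h.mem_Pr _ _).1 (Finset.mem_filter.1 hp).1).2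
    refine le_trans ?_ (h.zeros_ncard_le (Ω := Ω) hp'.ne_zero)
    rw [← Set.ncard_coe_finset]
    apply Set.ncard_le_ncard _ (h.zeros_finite hp'.ne_zero)
    intro P hP
    exact (Finset.mem_filter.1 hP).2
  have h3 : ∑ P ∈ hf.toFinset, (Nat.card k - 1) ≤
      ∑ P ∈ hf.toFinset, (S.filter (fun p => P p = 0)).card := by
    apply Finset.sum_le_sum
    intro P hP
    obtain ⟨p, hp, hPp, hd⟩ := h.exists_prime_of_fix hn (hf.mem_toFinset.1 hP)
    have hdn : deg p ≤ n := Nat.le_of_dvd (by omega) hd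
    rw [← h.card_assoc hp.ne_zero n hdn]
    apply Finset.card_le_card
    intro z hz
    rw [Finset.mem_filter] at hz
    have hz2 := hz.2
    have hdz : deg z = deg p := by
      obtain ⟨u, rfl⟩ := hz2
      rw [h.mul _ _ hp.ne_zero u.ne_zero, h.deg_of_isUnit u.isUnit]; rfl
    rw [Finset.mem_filter, hS, Finset.mem_filter, h.mem_Pr, hdz]
    refine ⟨⟨⟨hdn, hz2.prime hp⟩, hd⟩, ?_⟩
    obtain ⟨u, rfl⟩ := hz2
    rw [map_mul, hPp, zero_mul]
  rw [Finset.sum_const, smul_eq_mul, ← Set.ncard_eq_toFinset_card _ hf] at h3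
  rw [mul_comm]
  omega

end DegRing
end

section
open Matrix Polynomial PowerSeries

namespace PowerSeries
namespace LogDer

/-- `X A' = A β`. -/
def R (A β : PowerSeries ℝ) : Prop := X * derivative ℝ A = A * β

theorem R.mul {A β A' β' : PowerSeries ℝ} (h : R A β) (h' : R A' β') : R (A * A') (β + β') := by
  unfold R at *
  rw [Derivation.leibniz, smul_eq_mul, smul_eq_mul]
  linear_combination A * h' + A' * h

theorem R.one : R 1 0 := by
  unfold R
  simp

theorem R.pow {A β : PowerSeries ℝ} (h : R A β) (n : ℕ) : R (A ^ n) (n • β) := by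
  induction n with
  | zero => rw [pow_zero, zero_smul]; exact R.one
  | succ n ih => rw [pow_succ, succ_nsmul]; exact ih.mul h

/-- geometric series -/
noncomputable def G (r : ℝ) : PowerSeries ℝ := PowerSeries.mk (fun n => r ^ n)

theorem G_mul (r : ℝ) : (1 - C r * X) * G r = 1 := by
  ext n
  rw [sub_mul, one_mul, mul_assoc, map_sub, PowerSeries.coeff_C_mul]
  cases n with
  | zero => simp [G]
  | succ n => rw [PowerSeries.coeff_succ_X_mul]; simp [G, PowerSeries.coeff_one]; ring

theorem R_lin (r : ℝ) : R (1 - C r * X) (-(G r - 1)) := by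
  unfold R
  have h := G_mul r
  have : derivative ℝ (1 - C r * X) = - C r := by
    rw [map_sub, Derivation.leibniz]
    simp
  rw [this]
  linear_combination h

theorem R_geom (r : ℝ) : R (G r) (G r - 1) := by
  unfold R
  have h := G_mul r
  have h2 := congrArg (derivative ℝ) h
  have : derivative ℝ (1 - C r * X) = - C r := by
    rw [map_sub, Derivation.leibniz]
    simp
  rw [Derivation.leibniz, this, smul_eq_mul, smul_eq_mul] at h2
  have h3 : derivative ℝ (1 : PowerSeries ℝ) = 0 := by simp
  rw [h3] at h2
  linear_combination X * G r * h2 + (- X * derivative ℝ (G r) - G r) * h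

theorem nonneg_of_R {W β : PowerSeries ℝ} (h : R W β) (h0 : 0 ≤ coeff 0 W) (hβ0 : coeff 0 β = 0)
    (hβ : ∀ n, 1 ≤ n → 0 ≤ coeff n β) (n : ℕ) : 0 ≤ coeff n W := by
  induction n using Nat.strong_induction_on with
  | _ n ih =>
    rcases Nat.eq_zero_or_pos n with rfl | hn
    · exact h0
    have h1 := congrArg (coeff n) h
    obtain ⟨m, rfl⟩ : ∃ m, n = m + 1 := ⟨n - 1, by omega⟩
    rw [PowerSeries.coeff_succ_X_mul, PowerSeries.coeff_derivative, PowerSeries.coeff_mul] at h1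
    have h2 : 0 ≤ ∑ p ∈ Finset.HasAntidiagonal.antidiagonal (m+1), coeff p.1 W * coeff p.2 β := by
      apply Finset.sum_nonneg
      rintro ⟨i, j⟩ hij
      rw [Finset.HasAntidiagonal.mem_antidiagonal] at hij
      simp only at hij ⊢
      rcases Nat.eq_zero_or_pos j with hj | hj
      · rw [hj, hβ0, mul_zero]
      · exact mul_nonneg (ih i (by omega)) (hβ j hj)
    rw [← h1] at h2
    exact nonneg_of_mul_nonneg_left h2 (by positivity)

/-- absolute summability at `t`. -/
def Sm (t : ℝ) (A : PowerSeries ℝ) : Prop := Summable (fun n => ‖coeff n A * t ^ n‖)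

/-- value at `t`. -/
noncomputable def ev (t : ℝ) (A : PowerSeries ℝ) : ℝ := ∑' n, coeff n A * t ^ n

theorem coeff_mul_eq (t : ℝ) (A A' : PowerSeries ℝ) (n : ℕ) : coeff n (A * A') * t ^ n =
    ∑ p ∈ Finset.HasAntidiagonal.antidiagonal n, (coeff p.1 A * t ^ p.1) * (coeff p.2 A' * t ^ p.2) := by
  rw [PowerSeries.coeff_mul, Finset.sum_mul]
  apply Finset.sum_congr rfl
  rintro ⟨i, j⟩ hij
  rw [Finset.HasAntidiagonal.mem_antidiagonal] at hij
  rw [← hij]; ring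

theorem Sm.mul {t : ℝ} {A A' : PowerSeries ℝ} (h : Sm t A) (h' : Sm t A') : Sm t (A * A') := by
  unfold Sm at *
  have h1 := summable_norm_sum_mul_antidiagonal_of_summable_norm
    (f := fun n => coeff n A * t ^ n) (g := fun n => coeff n A' * t ^ n) h h'
  refine h1.congr (fun n => ?_)
  rw [coeff_mul_eq]

theorem ev_mul {t : ℝ} {A A' : PowerSeries ℝ} (h : Sm t A) (h' : Sm t A') :
    ev t (A * A') = ev t A * ev t A' := by
  unfold ev
  rw [tsum_mul_tsum_eq_tsum_sum_antidiagonal_of_summable_norm h h']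
  simp_rw [coeff_mul_eq]

theorem Sm_geom {t r : ℝ} (ht : 0 ≤ t) (hr : 0 ≤ r) (htr : r * t < 1) : Sm t (G r) := by
  unfold Sm
  simp only [G, coeff_mk]
  simp_rw [← mul_pow, norm_pow]
  apply summable_geometric_of_lt_one (norm_nonneg _)
  rw [Real.norm_of_nonneg (by positivity)]; exact htr

theorem ev_geom_pos {t r : ℝ} (ht : 0 ≤ t) (hr : 0 ≤ r) (htr : r * t < 1) : 0 < ev t (G r) := by
  unfold ev
  simp only [G, coeff_mk]
  simp_rw [← mul_pow]
  rw [tsum_geometric_of_lt_one (by positivity) htr]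
  rw [inv_pos]; linarith

theorem geom_pow {t r : ℝ} (ht : 0 ≤ t) (hr : 0 ≤ r) (htr : r * t < 1) (n : ℕ) :
    Sm t (G r ^ n) ∧ 0 < ev t (G r ^ n) := by
  induction n with
  | zero =>
    rw [pow_zero]
    have : ∀ n, n ∉ ({0} : Finset ℕ) → coeff n (1 : PowerSeries ℝ) * t ^ n = 0 := by
      intro n hn
      rw [Finset.mem_singleton] at hn
      rw [PowerSeries.coeff_one, if_neg hn, zero_mul]
    constructor
    · apply summable_of_ne_finset_zero (s := {0})
      intro n hn
      rw [this n hn, norm_zero]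
    · unfold ev
      rw [tsum_eq_sum (s := {0}) this]
      simp
  | succ n ih =>
    rw [pow_succ]
    have h1 := Sm_geom ht hr htr
    refine ⟨ih.1.mul h1, ?_⟩
    rw [ev_mul ih.1 h1]
    exact mul_pos ih.2 (ev_geom_pos ht hr htr)

theorem main (e ν : ℕ → ℝ) (q ρ t : ℝ) (K c : ℕ) (he0 : 0 ≤ e 0)
    (hrec : ∀ n : ℕ, (n : ℝ) * e n = ∑ j ∈ Finset.Icc 1 n, ν j * e (n - j))
    (hc : ∀ n, c ≤ n → e (n+1) = q * e n)
    (hν : ∀ n, 1 ≤ n → q ^ n - K * ρ ^ n ≤ ν n)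
    (ht : 0 ≤ t) (hρ : 0 ≤ ρ) (htr : ρ * t < 1) :
    0 ≤ (1 - q * t) * (∑ n ∈ Finset.range c, e n * t ^ n) + e c * t ^ c := by
  let EE : PowerSeries ℝ := PowerSeries.mk e
  let NN : PowerSeries ℝ := PowerSeries.mk (fun n => if n = 0 then 0 else ν n)
  have hE : R EE NN := by
    unfold R
    ext n
    rcases n with _ | n
    · simp [NN, PowerSeries.coeff_mul]
    · rw [PowerSeries.coeff_succ_X_mul, PowerSeries.coeff_derivative, PowerSeries.coeff_mul]
      have := hrec (n+1)
      push_cast at this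
      simp only [EE, NN, coeff_mk]
      rw [mul_comm, this, ← Finset.Nat.sum_antidiagonal_swap,
        Finset.Nat.sum_antidiagonal_eq_sum_range_succ_mk]
      simp only [Prod.swap]
      rw [Finset.sum_range_succ', if_pos rfl, mul_zero, add_zero]
      rw [Finset.range_eq_Ico, Finset.sum_Ico_add' (fun x => e (n + 1 - x) * if x = 0 then 0 else ν x) 0 (n+1) 1]
      apply Finset.sum_congr
      · ext x; simp
      · intro x hx
        rw [Finset.mem_Ico] at hx
        rw [if_neg (by omega)]; ring
  let L1 := (1 - C q * X) * EE
  have hL1 : ∀ n, coeff (n+1) L1 = e (n+1) - q * e n := by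
    intro n
    simp only [L1]
    rw [sub_mul, one_mul, mul_assoc, map_sub, PowerSeries.coeff_C_mul,
      PowerSeries.coeff_succ_X_mul]
    simp [EE]
  have hL10 : coeff 0 L1 = e 0 := by
    simp [L1, EE, PowerSeries.coeff_mul]
  have hz : ∀ n, n ∉ Finset.range (c+1) → coeff n L1 * t ^ n = 0 := by
    intro n hn
    rw [Finset.mem_range] at hn
    obtain ⟨m, rfl⟩ : ∃ m, n = m + 1 := ⟨n - 1, by omega⟩
    rw [hL1, hc m (by omega)]; ring
  have hSm : Sm t L1 := summable_of_ne_finset_zero (s := Finset.range (c+1)) (by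
    intro n hn
    rw [hz n hn, norm_zero])
  have hev : ev t L1 = (1 - q * t) * (∑ n ∈ Finset.range c, e n * t ^ n) + e c * t ^ c := by
    unfold ev
    rw [tsum_eq_sum hz, Finset.sum_range_succ', hL10]
    simp_rw [hL1]
    have : ∀ c : ℕ, (∑ x ∈ Finset.range c, (e (x + 1) - q * e x) * t ^ (x + 1)) + e 0 * t ^ 0 =
      (1 - q * t) * (∑ n ∈ Finset.range c, e n * t ^ n) + e c * t ^ c := by
      intro c
      induction c with
      | zero => simp
      | succ c ih =>
        rw [Finset.sum_range_succ, Finset.sum_range_succ]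
        linear_combination ih
    exact this c
  have hW := ((R_lin q).mul hE).mul ((R_geom ρ).pow K)
  have hpos : ∀ n, 0 ≤ coeff n (L1 * G ρ ^ K) := by
    apply nonneg_of_R hW
    · have : coeff 0 (L1 * G ρ ^ K) = e 0 := by
        rw [PowerSeries.coeff_zero_eq_constantCoeff_apply, map_mul, map_pow,
          ← PowerSeries.coeff_zero_eq_constantCoeff_apply, hL10,
          ← PowerSeries.coeff_zero_eq_constantCoeff_apply]
        simp [G]
      exact this ▸ he0
    · simp [G, NN]
    · intro n hn
      have := hν n hn
      have hn0 : n ≠ 0 := by omega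
      have e1 : coeff n (K • (G ρ - 1)) = K * ρ ^ n := by
        rw [map_nsmul, nsmul_eq_mul]
        simp [G, PowerSeries.coeff_one, hn0]
      rw [map_add, e1]
      simp [G, NN, PowerSeries.coeff_one, hn0]
      linarith
  obtain ⟨g1, g2⟩ := geom_pow ht hρ htr K
  have h1 : 0 ≤ ev t (L1 * G ρ ^ K) := tsum_nonneg (fun n => mul_nonneg (hpos n) (by positivity))
  rw [ev_mul hSm g1, hev] at h1
  exact nonneg_of_mul_nonneg_left h1 g2

end LogDer
end PowerSeries
end

section
open Matrix Polynomial

namespace DegRing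
variable {k B : Type*} [Field k] [Finite k] [CommRing B] [IsDomain B] [Algebra k B] {deg : B → ℕ}

open Classical in
theorem l_eq_card (h : DegRing k B deg) (hle : ∀ n, h.l (n+1) ≤ h.l n + 1) (n : ℕ) :
    h.l n = ((Finset.range (n+1)).filter (fun s => ∃ b, deg b = s)).card := by
  induction n with
  | zero =>
    rw [h.l_zero, Finset.filter_true_of_mem]
    · simp
    · intro x hx
      refine ⟨1, ?_⟩
      rw [h.deg_one]
      simp at hx; omega
  | succ n ih =>
    rw [Finset.range_add_one, Finset.filter_insert]
    split_ifs with h1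
    · rw [Finset.card_insert_of_notMem (by simp), ← ih]
      obtain ⟨b, hb⟩ := h1
      have := h.l_lt_of n b hb
      have := hle n
      omega
    · rw [← ih]
      exact h.l_eq_of_not n (fun b hb => h1 ⟨b, hb⟩)

theorem exists_deg_one (h : DegRing k B deg) [IsPrincipalIdealRing B] (hq : 5 ≤ Nat.card k)
    (n0 : ℕ) (hn0 : ∀ n, n0 ≤ n → h.l (n + 1) = h.l n + 1) (K : ℕ)
    (hK : ∀ n : ℕ, 1 ≤ n → (Nat.card k : ℝ) ^ n - K * (√(Nat.card k)) ^ n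
      ≤ h.Nt n / ((Nat.card k : ℝ) - 1)) : ∃ x, deg x = 1 := by
  classical
  by_contra hno
  have hle := h.l_succ_le n0 hn0
  set q := Nat.card k with hqdef
  have hex : ∃ c, ∀ n, c ≤ n → ∃ b, deg b = n := by
    refine ⟨n0 + 1, fun n hn => ?_⟩
    by_contra h1
    obtain ⟨m, rfl⟩ : ∃ m, n = m + 1 := ⟨n - 1, by omega⟩
    have h2 := h.l_eq_of_not m (fun b hb => h1 ⟨b, hb⟩)
    have := hn0 m (by omega)
    omega
  set c := Nat.find hex with hc
  have hc1 : ∀ n, c ≤ n → ∃ b, deg b = n := Nat.find_spec hex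
  have hc2 : 2 ≤ c := by
    by_contra h1
    exact hno (hc1 1 (by omega))
  obtain ⟨a, ha⟩ : ∃ a, c = a + 1 := ⟨c - 1, by omega⟩
  have haS : ¬ ∃ b, deg b = a := by
    intro h1
    apply Nat.find_min hex (m := a) (by omega)
    intro n hn
    rcases Nat.eq_or_lt_of_le hn with h2 | h2
    · rw [← h2]; exact h1
    · exact hc1 n (by omega)
  have hl : ∀ n, a ≤ n → h.l (n+1) = h.l n + 1 := by
    intro n hn
    obtain ⟨b, hb⟩ := hc1 (n+1) (by omega)
    have := h.l_lt_of n b hb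
    have := hle n
    omega
  have h2l : 2 * h.l a ≤ a + 1 := by
    rw [h.l_eq_card hle a]
    have h1 : ((Finset.range (a+1)).filter (fun s => ∃ b, deg b = s)).card ≤
        ((Finset.range (a+1)).filter (fun s => ¬ ∃ b, deg b = s)).card := by
      apply Finset.card_le_card_of_injOn (fun i => a - i)
      · intro i hi
        rw [Finset.mem_coe, Finset.mem_filter, Finset.mem_range] at hi ⊢
        show a - i < a + 1 ∧ ¬ ∃ b, deg b = a - i
        refine ⟨by omega, ?_⟩
        rintro ⟨b, hb⟩
        obtain ⟨hi1, d, hd⟩ := hi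
        apply haS
        by_cases hb0 : b = 0
        · refine ⟨d, ?_⟩
          rw [hb0, h.zero] at hb; omega
        by_cases hd0 : d = 0
        · refine ⟨b, ?_⟩
          rw [hd0, h.zero] at hd; omega
        refine ⟨b * d, ?_⟩
        rw [h.mul _ _ hb0 hd0]; omega
      · intro i hi j hj hij
        rw [Finset.mem_coe, Finset.mem_filter, Finset.mem_range] at hi hj
        simp only at hij
        omega
    have h2 := Finset.card_filter_add_card_filter_not (s := Finset.range (a+1))
      (fun s => ∃ b, deg b = s)
    rw [Finset.card_range] at h2
    omega
  have hq1 : (1:ℝ) < q := by exact_mod_cast (by omega : 1 < q)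
  have hq5 : (5:ℝ) ≤ q := by exact_mod_cast hq
  -- card of E
  have he : ∀ n, a ≤ n → (((h.E (n+1)).card : ℕ) : ℝ) = (q - 1) * (q:ℝ) ^ h.l n := by
    intro n hn
    have h1 := h.card_E_succ n
    rw [hl n hn, pow_succ, ← hqdef] at h1
    have h2 : (((h.E (n+1)).card : ℕ) : ℝ) + (q:ℝ) ^ h.l n = (q:ℝ) ^ h.l n * q := by
      exact_mod_cast h1
    linarith
  have he0 : (((h.E 0).card : ℕ) : ℝ) = q - 1 := by
    have h1 := h.card_E_zero
    rw [← hqdef] at h1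
    rw [← h1]; push_cast; ring
  set ρ := √(q:ℝ) with hρ
  have hρ0 : 0 ≤ ρ := Real.sqrt_nonneg _
  have hρ2 : ρ * ρ = q := Real.mul_self_sqrt (by linarith)
  have hρ3 : 2 < ρ := by nlinarith
  -- t between 2/q and 1/ρ
  obtain ⟨t, ht1, ht2⟩ : ∃ t : ℝ, 2 / q < t ∧ t < 1 / ρ := by
    apply exists_between
    rw [div_lt_div_iff₀ (by linarith) (by linarith)]
    nlinarith
  have ht0 : 0 < t := lt_trans (by positivity) ht1
  have htq : 2 < q * t := by
    rw [div_lt_iff₀ (by linarith)] at ht1; linarith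
  have htr : ρ * t < 1 := by
    rw [lt_div_iff₀ (by linarith)] at ht2; linarith
  have key := PowerSeries.LogDer.main (fun n => ((h.E n).card : ℝ)) (fun n => h.Nt n / ((q:ℝ) - 1)) q ρ t K c
    (by positivity) (by
      intro n
      have h1 := h.recurrence n
      have h2 : ((q - 1 : ℕ) : ℝ) = (q:ℝ) - 1 := by
        rw [Nat.cast_sub (by omega), Nat.cast_one]
      have h3 : ((q:ℝ) - 1) * n * (h.E n).card =
          ∑ j ∈ Finset.Icc 1 n, (h.Nt j : ℝ) * (h.E (n - j)).card := by
        rw [← h2]; exact_mod_cast h1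
      have h4 : (q:ℝ) - 1 ≠ 0 := by linarith
      apply mul_left_cancel₀ h4
      rw [← mul_assoc, h3, Finset.mul_sum]
      apply Finset.sum_congr rfl
      intro j _
      field_simp) (by
      intro n hn
      obtain ⟨m, rfl⟩ : ∃ m, n = m + 1 := ⟨n - 1, by omega⟩
      rw [he (m+1) (by omega), he m (by omega), hl m (by omega)]
      ring) hK ht0.le hρ0 htr
  have hs : (q:ℝ) - 1 ≤ ∑ n ∈ Finset.range c, ((h.E n).card : ℝ) * t ^ n := by
    have : (fun n => ((h.E n).card : ℝ) * t ^ n) 0 ≤ ∑ n ∈ Finset.range c, ((h.E n).card : ℝ) * t ^ n :=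
      Finset.single_le_sum (f := fun n => ((h.E n).card : ℝ) * t ^ n)
        (fun i _ => by positivity) (Finset.mem_range.2 (by omega))
    simp only [pow_zero, mul_one] at this
    rwa [he0] at this
  have hlast : ((h.E c).card : ℝ) * t ^ c ≤ q - 1 := by
    rw [ha, he a le_rfl, mul_assoc]
    have h1 : (q:ℝ) ^ h.l a * t ^ (a+1) ≤ 1 := by
      have h2 : (q:ℝ) ^ h.l a ≤ ρ ^ (a+1) := by
        rw [← hρ2, ← pow_two, ← pow_mul]
        exact pow_le_pow_right₀ (by linarith) h2l
      calc (q:ℝ) ^ h.l a * t ^ (a+1) ≤ ρ ^ (a+1) * t ^ (a+1) := by gcongr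
        _ = (ρ * t) ^ (a+1) := by rw [mul_pow]
        _ ≤ 1 := pow_le_one₀ (by positivity) htr.le
    nlinarith
  nlinarith
end DegRing
end

section
open Polynomial

namespace DegRing
variable {k B : Type*} [Field k] [CommRing B] [IsDomain B] [Algebra k B] {deg : B → ℕ}

theorem reduce (h : DegRing k B deg) (hle : ∀ n, h.l (n+1) ≤ h.l n + 1) {n : ℕ} {a b : B}
    (ha : deg a = n + 1) (hb : deg b ≤ n + 1) : ∃ c : k, deg (b - c • a) ≤ n := by
  have h1 : h.L n < h.L n ⊔ Submodule.span k {a} := by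
    refine lt_of_le_of_ne le_sup_left ?_
    intro e
    have : a ∈ h.L n := by
      rw [e]; exact Submodule.mem_sup_right (Submodule.mem_span_singleton_self a)
    rw [mem_L] at this; omega
  have h2 : h.L n ⊔ Submodule.span k {a} ≤ h.L (n+1) := by
    apply sup_le (h.L_mono (by omega))
    rw [Submodule.span_singleton_le_iff_mem, mem_L]; omega
  have h3 : Module.Finite k ↥(h.L n ⊔ Submodule.span k {a}) := Submodule.finiteDimensional_of_le h2
  have h4 := Submodule.finrank_lt_finrank_of_lt h1
  have h5 : h.L n ⊔ Submodule.span k {a} = h.L (n+1) := by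
    apply Submodule.eq_of_le_of_finrank_le h2
    have := hle n
    unfold l at this
    omega
  have h6 : b ∈ h.L n ⊔ Submodule.span k {a} := by rw [h5]; exact hb
  rw [Submodule.mem_sup] at h6
  obtain ⟨y, hy, z, hz, rfl⟩ := h6
  obtain ⟨c, rfl⟩ := Submodule.mem_span_singleton.1 hz
  exact ⟨c, by rw [add_sub_cancel_right]; exact hy⟩

theorem iso_of_deg_one (h : DegRing k B deg) (hle : ∀ n, h.l (n+1) ≤ h.l n + 1) (x : B)
    (hx : deg x = 1) : Nonempty (B ≃ₐ[k] k[X]) := by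
  have hx0 := h.ne_zero_of_pos (b := x) (by omega)
  have hsurj : ∀ n : ℕ, ∀ b : B, deg b ≤ n → ∃ p : k[X], aeval x p = b := by
    intro n
    induction n with
    | zero =>
      intro b hb
      obtain ⟨c, hc⟩ := h.const b (by omega)
      exact ⟨C c, by rw [aeval_C, hc]⟩
    | succ n ih =>
      intro b hb
      obtain ⟨c, hc⟩ := h.reduce hle (a := x ^ (n+1)) (by rw [h.deg_pow hx0, hx, mul_one]) hb
      obtain ⟨p, hp⟩ := ih _ hc
      refine ⟨p + C c * X ^ (n+1), ?_⟩
      rw [map_add, map_mul, aeval_C, map_pow, aeval_X, hp, Algebra.smul_def]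
      ring
  exact ⟨(AlgEquiv.ofBijective (aeval x) ⟨h.aeval_inj (by omega), fun b => hsurj _ b le_rfl⟩).symm⟩

end DegRing
end

section
open Polynomial

namespace DegRing
variable {k B : Type*} [Field k] [CommRing B] [IsDomain B] [Algebra k B] {deg : B → ℕ}

theorem sum_ne_zero_of_distinct (h : DegRing k B deg) {ι : Type*} (S : Finset ι) (f : ι → B)
    (hf : ∀ s ∈ S, ∀ t ∈ S, f s ≠ 0 → f t ≠ 0 → deg (f s) = deg (f t) → s = t)
    (hne : ∃ s ∈ S, f s ≠ 0) : ∑ s ∈ S, f s ≠ 0 := by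
  classical
  obtain ⟨s, hs, hmax⟩ := Finset.exists_max_image (S.filter (fun s => f s ≠ 0)) (fun s => deg (f s))
    (by obtain ⟨s, hs, h1⟩ := hne; exact ⟨s, Finset.mem_filter.2 ⟨hs, h1⟩⟩)
  rw [Finset.mem_filter] at hs
  have hlt : ∀ t ∈ S.erase s, f t = 0 ∨ deg (f t) < deg (f s) := by
    intro t ht
    rw [Finset.mem_erase] at ht
    by_cases h0 : f t = 0
    · exact Or.inl h0
    right
    refine lt_of_le_of_ne (hmax t (Finset.mem_filter.2 ⟨ht.2, h0⟩)) ?_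
    intro h1
    exact ht.1 (hf t ht.2 s hs.1 h0 hs.2 h1)
  rw [← Finset.sum_erase_add _ _ hs.1]
  rcases Nat.eq_zero_or_pos (deg (f s)) with h0 | h0
  · rw [Finset.sum_eq_zero, zero_add]
    · exact hs.2
    · intro t ht
      rcases hlt t ht with h1 | h1
      · exact h1
      · omega
  · have h2 : deg (∑ t ∈ S.erase s, f t) < deg (f s) := by
      have := h.deg_sum_le (S.erase s) f (deg (f s) - 1) (by
        intro t ht
        rcases hlt t ht with h1 | h1
        · rw [h1, h.zero]; omega
        · omega)
      omega
    apply h.ne_zero_of_pos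
    rw [h.deg_add_eq h2]; exact h0

/-- evaluation of bivariate polynomials. -/
noncomputable def ev {k B : Type*} [Field k] [CommRing B] [Algebra k B] (x y : B) : k[X][X] →+* B :=
  eval₂RingHom (aeval x : k[X] →ₐ[k] B).toRingHom y

theorem ev_C {k B : Type*} [Field k] [CommRing B] [Algebra k B] (x y : B) (p : k[X]) :
    ev x y (C p) = aeval x p := by
  simp [ev]

theorem ev_X {k B : Type*} [Field k] [CommRing B] [Algebra k B] (x y : B) :
    ev (k := k) x y X = y := by
  simp [ev]

theorem ev_sum {k B : Type*} [Field k] [CommRing B] [Algebra k B] (x y : B) (g : k[X][X]) {m : ℕ}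
    (hg : g.natDegree < m) : ev x y g = ∑ j ∈ Finset.range m, aeval x (g.coeff j) * y ^ j := by
  unfold ev
  rw [coe_eval₂RingHom, eval₂_eq_sum_range' _ hg]
  rfl

theorem mono_deg_inj {m a b a' b' : ℕ} (hb : b < m) (hb' : b' < m)
    (h : a * m + b * (m + 1) = a' * m + b' * (m + 1)) : a = a' ∧ b = b' := by
  have h1 : (a * m + b * (m + 1)) % m = b := by
    rw [show a * m + b * (m + 1) = b + (a + b) * m by ring, Nat.add_mul_mod_self_right,
      Nat.mod_eq_of_lt hb]
  have h2 : (a' * m + b' * (m + 1)) % m = b' := by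
    rw [show a' * m + b' * (m + 1) = b' + (a' + b') * m by ring, Nat.add_mul_mod_self_right,
      Nat.mod_eq_of_lt hb']
  have h3 : b = b' := by rw [← h1, ← h2, h]
  subst h3
  refine ⟨?_, rfl⟩
  have h4 : a * m = a' * m := by omega
  exact Nat.eq_of_mul_eq_mul_right (by omega) h4

theorem ev_ne_zero (h : DegRing k B deg) {x y : B} {m : ℕ} (hm : 0 < m) (hx : deg x = m)
    (hy : deg y = m + 1) {g : k[X][X]} (hg : g ≠ 0) (hgm : g.natDegree < m) : ev x y g ≠ 0 := by
  rw [ev_sum x y g hgm]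
  have hx' : 0 < deg x := by omega
  have hy0 : y ≠ 0 := h.ne_zero_of_pos (by omega)
  have hne : ∀ j, aeval x (g.coeff j) * y ^ j ≠ 0 →
      deg (aeval x (g.coeff j) * y ^ j) = (g.coeff j).natDegree * m + j * (m + 1) := by
    intro j hj
    rw [h.mul _ _ (left_ne_zero_of_mul hj) (right_ne_zero_of_mul hj), h.deg_aeval hx', hx,
      h.deg_pow hy0, hy]
  apply h.sum_ne_zero_of_distinct
  · intro s hs t ht hs0 ht0 he
    rw [hne s hs0, hne t ht0] at he
    exact (mono_deg_inj (Finset.mem_range.1 hs) (Finset.mem_range.1 ht) he).2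
  · refine ⟨g.natDegree, Finset.mem_range.2 hgm, ?_⟩
    apply mul_ne_zero _ (pow_ne_zero _ hy0)
    intro h0
    rw [← map_zero (aeval x : k[X] →ₐ[k] B)] at h0
    have := h.aeval_inj hx' h0
    rw [coeff_natDegree, leadingCoeff_eq_zero] at this
    exact hg this

theorem exists_mono {m N : ℕ} (hm : 0 < m) (hN : m * m ≤ N) :
    ∃ i j, j < m ∧ i * m + j * (m + 1) = N := by
  refine ⟨N / m - N % m, N % m, Nat.mod_lt _ hm, ?_⟩
  have h1 := Nat.div_add_mod N m
  have h2 := Nat.mod_lt N hm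
  have h3 : m ≤ N / m := by
    rw [Nat.le_div_iff_mul_le hm]; exact hN
  obtain ⟨c, hc⟩ := Nat.exists_eq_add_of_le (show N % m ≤ N / m by omega)
  rw [hc, Nat.add_sub_cancel_left]
  rw [hc] at h1
  nlinarith

theorem ev_decomp (h : DegRing k B deg) (hle : ∀ n, h.l (n+1) ≤ h.l n + 1) {x y : B} {m : ℕ}
    (hm : 0 < m) (hx : deg x = m) (hy : deg y = m + 1) (n : ℕ) :
    ∀ b, deg b ≤ m * m + n → ∃ g : k[X][X], g.natDegree < m ∧ deg (b - ev x y g) ≤ m * m := by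
  induction n with
  | zero => exact fun b hb => ⟨0, by simpa using hm, by simpa using hb⟩
  | succ n ih =>
    intro b hb
    have hx0 : x ≠ 0 := h.ne_zero_of_pos (by omega)
    have hy0 : y ≠ 0 := h.ne_zero_of_pos (by omega)
    obtain ⟨i, j, hj, hij⟩ := exists_mono (N := m * m + n + 1) hm (by omega)
    obtain ⟨c, hc⟩ := h.reduce hle (n := m * m + n) (a := x ^ i * y ^ j) (b := b) (by
      rw [h.mul _ _ (pow_ne_zero _ hx0) (pow_ne_zero _ hy0), h.deg_pow hx0, h.deg_pow hy0, hx, hy, hij])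
      (by omega)
    obtain ⟨g, hg, hg2⟩ := ih _ hc
    refine ⟨g + C (C c * X ^ i) * X ^ j, ?_, ?_⟩
    · refine lt_of_le_of_lt (natDegree_add_le _ _) (max_lt hg ?_)
      exact lt_of_le_of_lt (natDegree_C_mul_X_pow_le _ _) hj
    · convert hg2 using 2
      rw [map_add, map_mul, map_pow, ev_C, ev_X, map_mul, aeval_C, map_pow, aeval_X,
        Algebra.smul_def]
      ring

theorem exists_ev_mul (h : DegRing k B deg) [Finite k] (hle : ∀ n, h.l (n+1) ≤ h.l n + 1) {x y : B} {m : ℕ}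
    (hm : 0 < m) (hx : deg x = m) (hy : deg y = m + 1) :
    ∃ d : k[X], d ≠ 0 ∧ ∀ b, ∃ g : k[X][X], aeval x d * b = ev x y g := by
  classical
  have hdec : ∀ b, ∃ g : k[X][X], deg (b - ev x y g) ≤ m * m := by
    intro b
    obtain ⟨g, _, h2⟩ := h.ev_decomp hle hm hx hy (deg b) b (by omega)
    exact ⟨g, h2⟩
  have hone : ∀ b : B, ∃ d : k[X], d ≠ 0 ∧ ∃ g : k[X][X], aeval x d * b = ev x y g := by
    intro b
    choose G hG using fun i : ℕ => hdec (x ^ i * b)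
    have hfin := h.finite_deg_le (m * m)
    obtain ⟨i, j, hij, he⟩ := Set.Finite.exists_lt_map_eq_of_forall_mem
      (f := fun i => x ^ i * b - ev x y (G i)) (fun i => hG i) hfin
    refine ⟨X ^ j - X ^ i, ?_, G j - G i, ?_⟩
    · intro h0
      have := congrArg natDegree (sub_eq_zero.1 h0)
      rw [natDegree_X_pow, natDegree_X_pow] at this
      omega
    · rw [map_sub, map_sub, map_pow, map_pow, aeval_X]
      linear_combination -he
  choose D hD0 hD using hone
  refine ⟨∏ r ∈ h.LF (m * m), D r, Finset.prod_ne_zero_iff.2 (fun r _ => hD0 r), ?_⟩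
  intro b
  obtain ⟨g, hg⟩ := hdec b
  set r := b - ev x y g with hr
  have hb : b = ev x y g + r := by rw [hr]; ring
  obtain ⟨g', hg'⟩ := hD r
  refine ⟨C (∏ r ∈ h.LF (m * m), D r) * g + C (∏ s ∈ (h.LF (m * m)).erase r, D s) * g', ?_⟩
  have hmem : r ∈ h.LF (m * m) := (h.mem_LF _ _).2 hg
  rw [map_add, map_mul, map_mul, ev_C, ev_C, ← hg', hb, ← Finset.prod_erase_mul _ _ hmem]
  simp only [map_mul]
  ring

end DegRing
end

section
open Polynomial

namespace DegRing
variable {k B : Type*} [Field k] [CommRing B] [IsDomain B] [Algebra k B] {deg : B → ℕ}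

theorem l_le (h : DegRing k B deg) (hle : ∀ n, h.l (n+1) ≤ h.l n + 1) (n : ℕ) : h.l n ≤ n + 1 := by
  induction n with
  | zero => rw [h.l_zero]
  | succ n ih => have := hle n; omega

theorem exists_rel (h : DegRing k B deg) (hle : ∀ n, h.l (n+1) ≤ h.l n + 1) {x y : B} {m : ℕ}
    (hm : 0 < m) (hx : deg x = m) (hy : deg y = m + 1) :
    ∃ g : k[X][X], g ≠ 0 ∧ g.natDegree ≤ m ∧ ev x y g = 0 := by
  classical
  set I := m * m + m with hI
  set N := I * m + m * (m + 1) with hN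
  have hx0 : x ≠ 0 := h.ne_zero_of_pos (by omega)
  have hy0 : y ≠ 0 := h.ne_zero_of_pos (by omega)
  have := h.L_fin N
  let T : (Fin (I+1) × Fin (m+1) → k) →ₗ[k] h.L N :=
    Fintype.linearCombination k (fun s : Fin (I+1) × Fin (m+1) =>
      (⟨x ^ (s.1 : ℕ) * y ^ (s.2 : ℕ), by
        rw [h.mem_L, h.mul _ _ (pow_ne_zero _ hx0) (pow_ne_zero _ hy0), h.deg_pow hx0, h.deg_pow hy0, hx, hy]
        have h1 : (s.1 : ℕ) ≤ I := by omega
        have h2 : (s.2 : ℕ) ≤ m := by omega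
        rw [hN]
        exact add_le_add (Nat.mul_le_mul_right _ h1) (Nat.mul_le_mul_right _ h2)⟩ : h.L N))
  have hlt : Module.finrank k (h.L N) < Module.finrank k (Fin (I+1) × Fin (m+1) → k) := by
    rw [Module.finrank_fintype_fun_eq_card, Fintype.card_prod, Fintype.card_fin, Fintype.card_fin]
    have := h.l_le hle N
    unfold l at this
    refine lt_of_le_of_lt this ?_
    rw [hN, hI]; nlinarith
  have hker := LinearMap.ker_ne_bot_of_finrank_lt (f := T) hlt
  obtain ⟨a, ha, ha0⟩ := Submodule.exists_mem_ne_zero_of_ne_bot hker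
  rw [LinearMap.mem_ker] at ha
  let g : k[X][X] := ∑ j : Fin (m+1), C (∑ i : Fin (I+1), C (a (i,j)) * X ^ (i:ℕ)) * X ^ (j:ℕ)
  have hcoef : ∀ (i : Fin (I+1)) (j : Fin (m+1)), (g.coeff j).coeff i = a (i, j) := by
    intro i j
    have h1 : g.coeff j = ∑ i : Fin (I+1), C (a (i,j)) * X ^ (i:ℕ) := by
      simp only [g, finsetSum_coeff, coeff_C_mul, coeff_X_pow, Fin.val_inj, mul_ite, mul_one,
        mul_zero, Finset.sum_ite_eq, Finset.mem_univ, if_true]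
    rw [h1]
    simp only [finsetSum_coeff, coeff_C_mul, coeff_X_pow, Fin.val_inj, mul_ite, mul_one,
        mul_zero, Finset.sum_ite_eq, Finset.mem_univ, if_true]
  refine ⟨g, ?_, ?_, ?_⟩
  · intro h0
    apply ha0
    ext ⟨i, j⟩
    rw [← hcoef, h0]; simp
  · apply natDegree_sum_le_of_forall_le
    intro j _
    exact (natDegree_C_mul_X_pow_le _ _).trans (by omega)
  · have h1 := congrArg (Subtype.val) ha
    simp only [T, Fintype.linearCombination_apply, Submodule.coe_sum, Submodule.coe_smul,
      ZeroMemClass.coe_zero] at h1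
    rw [Fintype.sum_prod_type_right] at h1
    rw [← h1]
    simp only [g, map_sum, map_mul, ev_C, ev_X, map_pow, aeval_C, aeval_X, Finset.sum_mul,
      Algebra.smul_def, mul_assoc]

theorem exists_f (h : DegRing k B deg) [Finite k] (hle : ∀ n, h.l (n+1) ≤ h.l n + 1) {x y : B} {m : ℕ}
    (hm : 0 < m) (hx : deg x = m) (hy : deg y = m + 1) :
    ∃ f : k[X][X], f.Monic ∧ f.natDegree = m ∧ ev x y f = 0 ∧ ∀ g, ev x y g = 0 → f ∣ g := by
  classical
  let _ : Algebra k[X] B := (aeval x : k[X] →ₐ[k] B).toRingHom.toAlgebra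
  have hinj := h.aeval_inj (x := x) (by omega)
  have hFaith : FaithfulSMul k[X] B := (faithfulSMul_iff_algebraMap_injective k[X] B).2 hinj
  have hsm : ∀ (p : k[X]) (b : B), p • b = aeval x p * b := fun p b => rfl
  have hev : ∀ g : k[X][X], aeval y g = ev x y g := fun g => rfl
  have hfin : Module.Finite k[X] B := by
    refine ⟨⟨(Finset.range m).image (fun j => y ^ j) ∪ h.LF (m * m), ?_⟩⟩
    rw [eq_top_iff]
    rintro b -
    obtain ⟨g, hg, hr⟩ := h.ev_decomp hle hm hx hy (deg b) b (by omega)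
    have hb : b = ev x y g + (b - ev x y g) := by ring
    rw [hb]
    apply Submodule.add_mem
    · rw [ev_sum x y g hg]
      apply Submodule.sum_mem
      intro j hj
      rw [← hsm]
      apply Submodule.smul_mem
      apply Submodule.subset_span
      simp only [Finset.coe_union, Finset.coe_image]
      left
      exact ⟨j, hj, rfl⟩
    · apply Submodule.subset_span
      simp only [Finset.coe_union]
      right
      exact (h.mem_LF _ _).2 hr
  have hintg : IsIntegral k[X] y := Algebra.IsIntegral.isIntegral y
  have hmon := minpoly.monic hintg
  have hroot : ev x y (minpoly k[X] y) = 0 := by rw [← hev]; exact minpoly.aeval _ _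
  refine ⟨minpoly k[X] y, hmon, ?_, hroot, ?_⟩
  · apply le_antisymm
    · obtain ⟨g, hg0, hgm, hg⟩ := h.exists_rel hle hm hx hy
      have h1 : minpoly k[X] y ∣ g := minpoly.isIntegrallyClosed_dvd hintg (by rw [hev]; exact hg)
      exact (natDegree_le_of_dvd h1 hg0).trans hgm
    · by_contra hlt
      exact h.ev_ne_zero hm hx hy hmon.ne_zero (by omega) hroot
  · intro g hg
    exact minpoly.isIntegrallyClosed_dvd hintg (by rw [hev]; exact hg)

/-- data for Stepanov's argument. -/
structure Stp (h : DegRing k B deg) (x y : B) (m : ℕ) (f : k[X][X]) (d : k[X]) : Prop where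
  hm : 0 < m
  hmk : (m : k) ≠ 0
  hx : deg x = m
  hy : deg y = m + 1
  mon : f.Monic
  nd : f.natDegree = m
  root : ev x y f = 0
  ker : ∀ g, ev x y g = 0 → f ∣ g
  hd0 : d ≠ 0
  hd : ∀ b, ∃ g : k[X][X], aeval x d * b = ev x y g

theorem exists_Stp (h : DegRing k B deg) [Finite k] (n0 : ℕ)
    (hn0 : ∀ n, n0 ≤ n → h.l (n + 1) = h.l n + 1) : ∃ x y m f d, Stp h x y m f d := by
  have hle := h.l_succ_le n0 hn0
  have hex : ∀ n, n0 ≤ n → ∃ b, deg b = n + 1 := by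
    intro n hn
    by_contra hc
    push Not at hc
    have := h.l_eq_of_not n hc
    have := hn0 n hn
    omega
  obtain ⟨p, hp⟩ := CharP.exists k
  have hp0 := CharP.char_ne_zero_of_finite k p
  obtain ⟨x, hx⟩ := hex (p * n0) (by nlinarith [Nat.pos_of_ne_zero hp0])
  obtain ⟨y, hy⟩ := hex (p * n0 + 1) (by nlinarith [Nat.pos_of_ne_zero hp0])
  obtain ⟨f, hf1, hf2, hf3, hf4⟩ := h.exists_f hle (m := p * n0 + 1) (by omega) hx hy
  obtain ⟨d, hd0, hd⟩ := h.exists_ev_mul hle (m := p * n0 + 1) (by omega) hx hy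
  exact ⟨x, y, p * n0 + 1, f, d, ⟨by omega, by simp, hx, hy, hf1, hf2, hf3, hf4, hd0, hd⟩⟩

end DegRing
end

section
open Polynomial

namespace DegRing
variable {k B : Type*} [Field k] [CommRing B] [IsDomain B] [Algebra k B] {deg : B → ℕ}
  {Ω : Type*} [Field Ω] [Algebra k Ω]

theorem map_ev (P : B →ₐ[k] Ω) (x y : B) (g : k[X][X]) : P (ev x y g) = ev (P x) (P y) g := by
  unfold ev
  rw [coe_eval₂RingHom, coe_eval₂RingHom, ← AlgHom.coe_toRingHom, hom_eval₂]
  congr 1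
  ext p
  · simp
  · simp

theorem Stp.extend {h : DegRing k B deg} {x y : B} {m : ℕ} {f : k[X][X]} {d : k[X]}
    (S : Stp h x y m f d) {α β : Ω} (hr : ev α β f = 0) (hd : aeval α d ≠ 0) :
    ∃ P : B →ₐ[k] Ω, P x = α ∧ P y = β := by
  have key : ∀ g g' : k[X][X], ev x y g = ev x y g' → ev α β g = ev α β g' := by
    intro g g' e
    obtain ⟨s, hs⟩ := S.ker (g - g') (by rw [map_sub, e, sub_self])
    rw [← sub_eq_zero, ← map_sub, hs, map_mul, hr, zero_mul]
  choose G hG using S.hd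
  have h1 : ∀ (b : B) (g : k[X][X]), aeval x d * b = ev x y g → ev α β (G b) / aeval α d = ev α β g / aeval α d := by
    intro b g e
    rw [key (G b) g (by rw [← hG, e])]
  have h2 : ∀ g : k[X][X], ev α β (G (ev x y g)) / aeval α d = ev α β g := by
    intro g
    rw [h1 _ (C d * g) (by rw [map_mul, ev_C]), map_mul, ev_C, mul_div_cancel_left₀ _ hd]
  have hmul : ∀ a b, ev α β (G (a * b)) / aeval α d =
      (ev α β (G a) / aeval α d) * (ev α β (G b) / aeval α d) := by
    intro a b
    have e : ev α β (C d * G (a * b)) = ev α β (G a * G b) := by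
      apply key
      rw [map_mul, map_mul, ev_C, ← hG, ← hG, ← hG]; ring
    rw [map_mul, map_mul, ev_C] at e
    field_simp
    linear_combination e
  have hadd : ∀ a b, ev α β (G (a + b)) / aeval α d =
      (ev α β (G a) / aeval α d) + (ev α β (G b) / aeval α d) := by
    intro a b
    rw [h1 (a + b) (G a + G b) (by rw [map_add, ← hG, ← hG]; ring), map_add, add_div]
  have hal : ∀ c : k, ev α β (G (algebraMap k B c)) / aeval α d = algebraMap k Ω c := by
    intro c
    have : algebraMap k B c = ev x y (C (C c)) := by rw [ev_C, aeval_C]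
    rw [this, h2, ev_C, aeval_C]
  let P : B →ₐ[k] Ω :=
    { toFun := fun b => ev α β (G b) / aeval α d
      map_one' := by have := hal 1; rwa [map_one, map_one] at this
      map_mul' := hmul
      map_zero' := by have := hal 0; rwa [map_zero, map_zero] at this
      map_add' := hadd
      commutes' := hal }
  refine ⟨P, ?_, ?_⟩
  · have : x = ev x y (C (X : k[X])) := by rw [ev_C, aeval_X]
    show ev α β (G x) / aeval α d = α
    rw [this, h2, ev_C, aeval_X]
  · have := h2 X
    rw [ev_X, ev_X] at this
    exact this

theorem Stp.deriv_ne {h : DegRing k B deg} {x y : B} {m : ℕ} {f : k[X][X]} {d : k[X]}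
    (S : Stp h x y m f d) : ev x y (derivative f) ≠ 0 := by
  apply h.ev_ne_zero S.hm S.hx S.hy
  · intro h0
    have h1 := coeff_derivative f (m - 1)
    obtain ⟨m', rfl⟩ : ∃ m', m = m' + 1 := ⟨m - 1, by have := S.hm; omega⟩
    have h2 : f.coeff (m' + 1) = 1 := by rw [← S.nd]; exact S.mon
    rw [h0, Nat.add_sub_cancel, h2, coeff_zero, one_mul] at h1
    have h3 : ((m' + 1 : ℕ) : k[X]) = 0 := by rw [Nat.cast_add, Nat.cast_one, ← h1]
    rw [← C_eq_natCast, C_eq_zero] at h3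
    exact S.hmk h3
  · have := natDegree_derivative_lt (p := f) (by rw [S.nd]; have := S.hm; omega)
    rw [S.nd] at this; exact this

theorem eval_map_ev (α β : Ω) (f : k[X][X]) :
    eval β (f.map (aeval α : k[X] →ₐ[k] Ω).toRingHom) = ev α β f := by
  rw [eval_map]; rfl

theorem Stp.points [Finite k] [IsAlgClosed Ω] {h : DegRing k B deg} {x y : B} {m : ℕ} {f : k[X][X]}
    {d : k[X]} (S : Stp h x y m f d) : ∃ c : ℕ, ∀ n, 1 ≤ n → ∃ T : Finset (B →ₐ[k] Ω),
      (∀ P ∈ T, P x ^ (Nat.card k ^ n) = P x ∧ aeval (P x) d ≠ 0) ∧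
      m * Nat.card k ^ n ≤ T.card + c := by
  classical
  have hZ := h.zeros_finite (Ω := Ω) S.deriv_ne
  let A : Finset Ω := (d.map (algebraMap k Ω)).roots.toFinset ∪ hZ.toFinset.image (fun P => P x)
  have hA1 : ∀ α, α ∉ A → aeval α d ≠ 0 := by
    intro α hα h0
    apply hα
    apply Finset.mem_union_left
    rw [Multiset.mem_toFinset, mem_roots (Polynomial.map_ne_zero S.hd0), IsRoot, eval_map]
    exact h0
  have hA2 : ∀ α, α ∉ A → (f.map (aeval α : k[X] →ₐ[k] Ω).toRingHom).roots.toFinset.card = m := by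
    intro α hα
    set F := f.map (aeval α : k[X] →ₐ[k] Ω).toRingHom with hF
    have hFm : F.Monic := S.mon.map _
    have hnd : F.roots.Nodup := by
      rw [Multiset.nodup_iff_count_le_one]
      intro β
      rw [count_roots]
      by_contra hc
      push Not at hc
      rw [one_lt_rootMultiplicity_iff_isRoot hFm.ne_zero] at hc
      obtain ⟨h1, h2⟩ := hc
      rw [IsRoot, hF, derivative_map, eval_map_ev] at h2
      rw [IsRoot, hF, eval_map_ev] at h1
      obtain ⟨P, hx, hy⟩ := S.extend h1 (hA1 α hα)
      apply hα
      apply Finset.mem_union_right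
      rw [Finset.mem_image]
      refine ⟨P, ?_, hx⟩
      rw [hZ.mem_toFinset]
      show P _ = 0
      rw [map_ev, hx, hy]; exact h2
    rw [Multiset.toFinset_card_of_nodup hnd, ← (IsAlgClosed.splits F).natDegree_eq_card_roots, hF,
      S.mon.natDegree_map, S.nd]
  refine ⟨m * A.card, ?_⟩
  intro n hn
  set Q := Nat.card k ^ n with hQ
  have hQ1 : 1 < Q := Nat.one_lt_pow (by omega) Finite.one_lt_card
  let R : Finset Ω := (X ^ Q - X : Polynomial Ω).roots.toFinset
  have hne : (X ^ Q - X : Polynomial Ω) ≠ 0 := FiniteField.X_pow_card_sub_X_ne_zero Ω hQ1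
  have hR : ∀ α, α ∈ R ↔ α ^ Q = α := by
    intro α
    rw [Multiset.mem_toFinset, mem_roots hne, IsRoot, eval_sub, eval_pow, eval_X, sub_eq_zero]
  have hRc : R.card = Q := by
    obtain ⟨p, hp⟩ := CharP.exists k
    have hpΩ : CharP Ω p := charP_of_injective_algebraMap (algebraMap k Ω).injective p
    have hpp : p.Prime := CharP.char_is_prime k p
    have hsep : (X ^ Q - X : Polynomial Ω).Separable := by
      apply galois_poly_separable p Q
      have : p ∣ Nat.card k := by
        let _ := Fintype.ofFinite k
        obtain ⟨e, _, he⟩ := FiniteField.card k p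
        rw [Nat.card_eq_fintype_card, he]
        exact dvd_pow_self _ e.ne_zero
      exact this.trans (dvd_pow_self _ (by omega))
    rw [Multiset.toFinset_card_of_nodup (nodup_roots hsep),
      ← (IsAlgClosed.splits _).natDegree_eq_card_roots, FiniteField.X_pow_card_sub_X_natDegree_eq Ω hQ1]
  let I : Finset (Σ _ : Ω, Ω) := (R \ A).sigma
    (fun α => (f.map (aeval α : k[X] →ₐ[k] Ω).toRingHom).roots.toFinset)
  have hI : I.card = m * (R \ A).card := by
    rw [Finset.card_sigma, Finset.sum_congr rfl (fun α hα => hA2 α (Finset.mem_sdiff.1 hα).2),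
      Finset.sum_const, smul_eq_mul, mul_comm]
  have hex : ∀ s : I, ∃ P : B →ₐ[k] Ω, P x = s.1.1 ∧ P y = s.1.2 := by
    rintro ⟨⟨α, β⟩, hs⟩
    rw [Finset.mem_sigma, Finset.mem_sdiff] at hs
    obtain ⟨⟨h1, h2⟩, h3⟩ := hs
    apply S.extend _ (hA1 α h2)
    rw [Multiset.mem_toFinset, mem_roots (S.mon.map _).ne_zero, IsRoot, eval_map_ev] at h3
    exact h3
  choose Pt hPx hPy using hex
  refine ⟨Finset.univ.image Pt, ?_, ?_⟩
  · intro P hP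
    rw [Finset.mem_image] at hP
    obtain ⟨s, _, rfl⟩ := hP
    rw [hPx]
    have hs := s.2
    rw [Finset.mem_sigma, Finset.mem_sdiff] at hs
    exact ⟨(hR _).1 hs.1.1, hA1 _ hs.1.2⟩
  · rw [Finset.card_image_of_injective, Finset.card_univ, Fintype.card_coe, hI]
    · have := Finset.le_card_sdiff A R
      rw [hRc] at this
      have h2 : Q ≤ (R \ A).card + A.card := by omega
      rw [← mul_add]
      exact Nat.mul_le_mul_left _ h2
    · intro s t hst
      apply Subtype.ext
      have e1 : s.1.1 = t.1.1 := by rw [← hPx, ← hPx, hst]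
      have e2 : s.1.2 = t.1.2 := by rw [← hPy, ← hPy, hst]
      exact Sigma.ext e1 (heq_of_eq e2)

/-- a point fixed on `x` and `y` with `d` nonvanishing is fixed. -/
theorem Stp.fix_of [Finite k] {h : DegRing k B deg} {x y : B} {m : ℕ} {f : k[X][X]}
    {d : k[X]} (S : Stp h x y m f d) {n : ℕ} {P : B →ₐ[k] Ω}
    (hx : P x ^ (Nat.card k ^ n) = P x) (hy : P y ^ (Nat.card k ^ n) = P y)
    (hd : aeval (P x) d ≠ 0) : P ∈ Fix k B Ω n := by
  let _ := Fintype.ofFinite k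
  let φ : Ω →ₐ[k] Ω := (FiniteField.frobeniusAlgHom k Ω) ^ n
  have hφ : ∀ z, φ z = z ^ (Nat.card k ^ n) := by
    intro z
    show ((FiniteField.frobeniusAlgHom k Ω) ^ n) z = _
    rw [AlgHom.coe_pow, FiniteField.coe_frobeniusAlgHom, pow_iterate, ← Nat.card_eq_fintype_card]
  intro b
  rw [← hφ]
  have hev : ∀ g : k[X][X], φ (P (ev x y g)) = P (ev x y g) := by
    intro g
    have := map_ev (φ.comp P) x y g
    rw [AlgHom.comp_apply, AlgHom.comp_apply, AlgHom.comp_apply, hφ (P x), hφ (P y), hx, hy] at this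
    rw [this, map_ev]
  obtain ⟨g, hg⟩ := S.hd b
  have h1 := hev g
  have h2 := hev (C d)
  rw [ev_C] at h2
  rw [← hg, map_mul, map_mul, h2] at h1
  refine mul_left_cancel₀ ?_ h1
  rw [← ev_C x y d, map_ev, ev_C]
  exact hd

end DegRing
end

section
open Polynomial

namespace DegRing
variable {k B : Type*} [Field k] [CommRing B] [IsDomain B] [Algebra k B] {deg : B → ℕ}
  {Ω : Type*} [Field Ω] [Algebra k Ω]

theorem deg_mul_le (h : DegRing k B deg) (a b : B) : deg (a * b) ≤ deg a + deg b := by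
  by_cases ha : a = 0
  · rw [ha, zero_mul, h.zero]; omega
  by_cases hb : b = 0
  · rw [hb, mul_zero, h.zero]; omega
  rw [h.mul a b ha hb]

theorem deg_pow_le (h : DegRing k B deg) (a : B) (n : ℕ) : deg (a ^ n) ≤ n * deg a := by
  by_cases ha : a = 0
  · rcases Nat.eq_zero_or_pos n with rfl | hn
    · rw [pow_zero, h.deg_one]; omega
    · rw [ha, zero_pow (by omega), h.zero]; omega
  rw [h.deg_pow ha]

theorem deg_sub_le (h : DegRing k B deg) (a b : B) : deg (a - b) ≤ max (deg a) (deg b) := by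
  rw [sub_eq_add_neg]
  refine (h.add _ _).trans ?_
  rw [h.deg_neg]

theorem stp_ineq {M γ H R t e : ℕ} (he : e = γ + M) (hR : e + M * e ^ 2 + M * (H + 1) + 1 ≤ R)
    (ht : M * R + (M * e + 1) ≤ t * (M + 1)) :
    (R * (R - 1) + t * (M + 1) + H + 1) * M < (R - γ) * (t * (M + 1)) := by
  obtain ⟨r, rfl⟩ := Nat.exists_eq_add_of_le (show e ≤ R by omega)
  have hr : M * e ^ 2 + M * (H + 1) + 1 ≤ r := by omega
  obtain ⟨w, hw⟩ : ∃ w, e + r = w + 1 := ⟨e + r - 1, by omega⟩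
  have h1 : e + r - γ = M + r := by omega
  rw [h1]
  generalize t * (M + 1) = s at *
  have h2 : r * (M * (e + r) + (M * e + 1)) ≤ r * s := Nat.mul_le_mul_left _ ht
  have h3 : (e + r) * (e + r - 1) ≤ (e + r) * (e + r) := Nat.mul_le_mul_left _ (by omega)
  have h4 : (e + r) * (e + r - 1) * M ≤ (e + r) * (e + r) * M := Nat.mul_le_mul_right _ h3
  nlinarith

theorem Stp.aux [Finite k] {h : DegRing k B deg} {x y : B} {m : ℕ} {f : k[X][X]}
    {d : k[X]} (S : Stp h x y m f d) (hle : ∀ n, h.l (n+1) ≤ h.l n + 1) {γ : ℕ}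
    (hγ : ∀ n, n + 1 ≤ h.l n + γ) (p : ℕ) [Fact p.Prime] [CharP k p] (g : B[X]) (M : ℕ)
    (hM : m = M + 1) :
    ∃ C R0 : ℕ, ∀ a b : ℕ, a ≤ b → R0 ≤ p ^ a → ∃ t, ∃ u : Fin t × Fin (M + 1) → B,
      (∀ l : Fin M, ∑ i : Fin t, (u (i, l.castSucc)) ^ p ^ a * x ^ (i : ℕ) =
        (∑ i : Fin t, (u (i, Fin.last M)) ^ p ^ a * x ^ (i : ℕ)) * g.coeff l) ∧
      (∑ s, u s * (x ^ (s.1 : ℕ) * y ^ (s.2 : ℕ)) ^ p ^ b) ≠ 0 ∧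
      deg (∑ s, u s * (x ^ (s.1 : ℕ) * y ^ (s.2 : ℕ)) ^ p ^ b) ≤ M * (p ^ a * p ^ b) + C * p ^ b := by
  classical
  have hB : CharP B p := charP_of_injective_algebraMap (algebraMap k B).injective p
  have hx0 : x ≠ 0 := h.ne_zero_of_pos (by have := S.hx; have := S.hm; omega)
  have hy0 : y ≠ 0 := h.ne_zero_of_pos (by have := S.hy; omega)
  have hxd := S.hx
  have hyd := S.hy
  rw [hM] at hxd hyd
  set H := ∑ l ∈ Finset.range M, deg (g.coeff l) with hH
  have hHl : ∀ l : Fin M, deg (g.coeff l) ≤ H := fun l =>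
    Finset.single_le_sum (f := fun l => deg (g.coeff l)) (fun _ _ => Nat.zero_le _)
      (Finset.mem_range.2 l.2)
  set e := γ + M with he
  refine ⟨M * e + 1 + (M + 1) + M * (M + 2) + 1, e + M * e ^ 2 + M * (H + 1) + 1, ?_⟩
  intro a b hab hR
  set R := p ^ a with hRd
  set W := p ^ b with hWd
  have hp0 : 0 < p := (Fact.out : p.Prime).pos
  have hRW : R ≤ W := Nat.pow_le_pow_right hp0 hab
  have hR1 : 0 < R := pow_pos hp0 a
  set t := (M * R + (M * e + 1)) / (M + 1) + 1 with ht
  have ht1 : M * R + (M * e + 1) ≤ t * (M + 1) := by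
    have := Nat.div_add_mod (M * R + (M * e + 1)) (M + 1)
    have h2 := Nat.mod_lt (M * R + (M * e + 1)) (show 0 < M + 1 by omega)
    rw [ht]; nlinarith
  have ht2 : t * (M + 1) ≤ M * R + (M * e + 1) + (M + 1) := by
    have := Nat.div_mul_le_self (M * R + (M * e + 1)) (M + 1)
    rw [ht]; nlinarith
  have hineq := stp_ineq he hR ht1
  set N' := R * (R - 1) + t * (M + 1) + H with hN'
  let F : (Fin t × Fin (M + 1) → h.L (R - 1)) → Fin (M + 1) → B :=
    fun u l => ∑ i : Fin t, iterateFrobenius B p a (u (i, l)) * x ^ (i : ℕ)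
  have hFsub : ∀ u v l, F (u - v) l = F u l - F v l := by
    intro u v l
    simp only [F, Pi.sub_apply, Submodule.coe_sub, map_sub, sub_mul, Finset.sum_sub_distrib]
  have hFdeg : ∀ u l, deg (F u l) ≤ R * (R - 1) + t * (M + 1) := by
    intro u l
    apply h.deg_sum_le
    intro i _
    refine (h.deg_mul_le _ _).trans (add_le_add ?_ ?_)
    · rw [iterateFrobenius_def]
      refine (h.deg_pow_le _ _).trans ?_
      exact Nat.mul_le_mul_left _ (u (i, l)).2
    · rw [h.deg_pow hx0, hxd]
      exact Nat.mul_le_mul_right _ i.2.le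
  let T : (Fin t × Fin (M + 1) → h.L (R - 1)) → (Fin M → h.L N') := fun u l =>
    ⟨F u l.castSucc - F u (Fin.last M) * g.coeff l, by
      rw [h.mem_L]
      refine (h.deg_sub_le _ _).trans (max_le ?_ ?_)
      · exact (hFdeg _ _).trans (by omega)
      · exact (h.deg_mul_le _ _).trans (add_le_add (hFdeg _ _) (hHl l))⟩
  have hfin1 : Finite (h.L (R - 1)) := h.L_finite _
  have hfin2 : Finite (h.L N') := h.L_finite _
  have hcard : ¬ Function.Injective T := by
    intro hinj
    have h1 := Nat.card_le_card_of_injective T hinj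
    have hL : ∀ n, Nat.card (h.L n) = Nat.card k ^ h.l n := fun n => by
      have := h.L_fin n
      exact Module.natCard_eq_pow_finrank
    rw [Nat.card_fun, Nat.card_fun, hL, hL, ← pow_mul, ← pow_mul, Nat.card_prod, Nat.card_fin,
      Nat.card_fin, Nat.card_fin] at h1
    have h2 := (Nat.pow_le_pow_iff_right (Finite.one_lt_card (α := k))).1 h1
    have h3 := h.l_le hle N'
    have h4 := hγ (R - 1)
    have h5 : (R - γ) * (t * (M + 1)) ≤ h.l (R - 1) * (t * (M + 1)) :=
      Nat.mul_le_mul_right _ (by omega)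
    have h6 : h.l N' * M ≤ (N' + 1) * M := Nat.mul_le_mul_right _ h3
    omega
  rw [Function.Injective] at hcard
  push Not at hcard
  obtain ⟨u1, u2, hT, hne⟩ := hcard
  set u := u1 - u2 with hu
  have hu0 : u ≠ 0 := sub_ne_zero.2 hne
  refine ⟨t, fun s => (u s : B), ?_, ?_, ?_⟩
  · intro l
    have h1 := congrArg Subtype.val (congrFun hT l)
    simp only [T] at h1
    have h2 : F u l.castSucc = F u (Fin.last M) * g.coeff l := by
      rw [hu, hFsub, hFsub]; linear_combination h1
    simpa only [F, iterateFrobenius_def] using h2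
  · have hmono : ∀ s : Fin t × Fin (M+1), (u s : B) * (x ^ (s.1 : ℕ) * y ^ (s.2 : ℕ)) ^ W ≠ 0 →
        deg ((u s : B) * (x ^ (s.1 : ℕ) * y ^ (s.2 : ℕ)) ^ W) =
          deg (u s : B) + W * ((s.1 : ℕ) * (M + 1) + (s.2 : ℕ) * (M + 1 + 1)) := by
      intro s hs
      rw [h.mul _ _ (left_ne_zero_of_mul hs) (right_ne_zero_of_mul hs),
        h.deg_pow (mul_ne_zero (pow_ne_zero _ hx0) (pow_ne_zero _ hy0)),
        h.mul _ _ (pow_ne_zero _ hx0) (pow_ne_zero _ hy0), h.deg_pow hx0, h.deg_pow hy0, hxd, hyd]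
    have hlt : ∀ s, deg (u s : B) < W := by
      intro s
      have : deg (u s : B) ≤ R - 1 := (u s).2
      omega
    apply h.sum_ne_zero_of_distinct
    · intro s _ s' _ hs hs' hd
      rw [hmono s hs, hmono s' hs'] at hd
      have hdiv := congrArg (fun z => z / W) hd
      rw [Nat.add_mul_div_left _ _ (by omega), Nat.add_mul_div_left _ _ (by omega),
        Nat.div_eq_of_lt (hlt s), Nat.div_eq_of_lt (hlt s'), zero_add, zero_add] at hdiv
      obtain ⟨h1, h2⟩ := mono_deg_inj s.2.2 s'.2.2 hdiv
      exact Prod.ext (Fin.ext h1) (Fin.ext h2)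
    · by_contra hc
      push Not at hc
      apply hu0
      funext s
      have := hc s (Finset.mem_univ _)
      rcases mul_eq_zero.1 this with h1 | h1
      · exact Subtype.ext h1
      · exact absurd h1 (pow_ne_zero _ (mul_ne_zero (pow_ne_zero _ hx0) (pow_ne_zero _ hy0)))
  · apply h.deg_sum_le
    intro s _
    refine (h.deg_mul_le _ _).trans ?_
    have h1 : deg (u s : B) ≤ R - 1 := (u s).2
    have h2 : deg ((x ^ (s.1 : ℕ) * y ^ (s.2 : ℕ)) ^ W) ≤ W * (t * (M + 1) + M * (M + 2)) := by
      rw [h.deg_pow (mul_ne_zero (pow_ne_zero _ hx0) (pow_ne_zero _ hy0)),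
        h.mul _ _ (pow_ne_zero _ hx0) (pow_ne_zero _ hy0), h.deg_pow hx0, h.deg_pow hy0, hxd, hyd]
      apply Nat.mul_le_mul_left
      apply add_le_add
      · exact Nat.mul_le_mul_right _ s.1.2.le
      · exact Nat.mul_le_mul_right _ (by omega)
    have h3 : W * (t * (M + 1) + M * (M + 2)) ≤
        W * (M * R + (M * e + 1) + (M + 1) + M * (M + 2)) := Nat.mul_le_mul_left _ (by omega)
    calc _ ≤ W + W * (M * R + (M * e + 1) + (M + 1) + M * (M + 2)) :=
          add_le_add (h1.trans (by omega)) (h2.trans h3)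
      _ = _ := by ring

end DegRing
end

section
open Polynomial

namespace DegRing
variable {k B : Type*} [Field k] [CommRing B] [IsDomain B] [Algebra k B] {deg : B → ℕ}
  {Ω : Type*} [Field Ω] [Algebra k Ω]

theorem Stp.bad [Finite k] {h : DegRing k B deg} {x y : B} {m : ℕ} {f : k[X][X]}
    {d : k[X]} (S : Stp h x y m f d) (hle : ∀ n, h.l (n+1) ≤ h.l n + 1) {γ : ℕ}
    (hγ : ∀ n, n + 1 ≤ h.l n + γ) (p : ℕ) [Fact p.Prime] [CharP k p] :
    ∃ C R0 : ℕ, ∀ n a b : ℕ, a ≤ b → R0 ≤ p ^ a → Nat.card k ^ n = p ^ a * p ^ b →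
      {P : B →ₐ[k] Ω | P x ^ (Nat.card k ^ n) = P x ∧ P y ^ (Nat.card k ^ n) ≠ P y}.Finite ∧
      {P : B →ₐ[k] Ω | P x ^ (Nat.card k ^ n) = P x ∧ P y ^ (Nat.card k ^ n) ≠ P y}.ncard
        ≤ (m - 1) * Nat.card k ^ n + C * p ^ b := by
  obtain ⟨M, rfl⟩ : ∃ M, m = M + 1 := ⟨m - 1, by have := S.hm; omega⟩
  have hΩ : CharP Ω p := charP_of_injective_algebraMap (algebraMap k Ω).injective p
  set fB : B[X] := f.map (aeval x : k[X] →ₐ[k] B).toRingHom with hfB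
  have hroot : fB.IsRoot y := by
    rw [IsRoot, hfB, eval_map]; exact S.root
  set g := fB /ₘ (X - C y) with hg
  have hfg : (X - C y) * g = fB := mul_divByMonic_eq_iff_isRoot.2 hroot
  have hfBm : fB.Monic := S.mon.map _
  have hgm : g.Monic := (monic_X_sub_C y).of_mul_monic_left (by rw [hfg]; exact hfBm)
  have hgd : g.natDegree = M := by
    have h1 := (monic_X_sub_C y).natDegree_mul hgm
    rw [hfg, natDegree_X_sub_C, hfB, S.mon.natDegree_map, S.nd] at h1
    omega
  obtain ⟨C0, R0, hC⟩ := S.aux hle hγ p g M rfl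
  refine ⟨C0, R0, ?_⟩
  intro n a b hab hR hQ
  obtain ⟨t, u, hu1, hu2, hu3⟩ := hC a b hab hR
  set G := ∑ s, u s * (x ^ (s.1 : ℕ) * y ^ (s.2 : ℕ)) ^ p ^ b with hG
  have hsub : {P : B →ₐ[k] Ω | P x ^ (Nat.card k ^ n) = P x ∧ P y ^ (Nat.card k ^ n) ≠ P y} ⊆
      {P : B →ₐ[k] Ω | P G = 0} := by
    rintro P ⟨hx, hy⟩
    let _ := Fintype.ofFinite k
    let φ : Ω →ₐ[k] Ω := (FiniteField.frobeniusAlgHom k Ω) ^ n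
    have hφ : ∀ z, φ z = z ^ (Nat.card k ^ n) := by
      intro z
      show ((FiniteField.frobeniusAlgHom k Ω) ^ n) z = _
      rw [AlgHom.coe_pow, FiniteField.coe_frobeniusAlgHom, pow_iterate, ← Nat.card_eq_fintype_card]
    set β' := P y ^ (Nat.card k ^ n) with hβ'
    have h1 : ev (P x) β' f = 0 := by
      have := map_ev (φ.comp P) x y f
      rw [S.root, map_zero, AlgHom.comp_apply, AlgHom.comp_apply, hφ, hφ, hx] at this
      exact this.symm
    have h2 : eval₂ P.toRingHom β' fB = 0 := by
      rw [← h1, hfB, eval₂_map]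
      unfold ev
      rw [coe_eval₂RingHom]
      congr 1
      ext z
      · simp
      · simp
    have h3 : eval₂ P.toRingHom β' g = 0 := by
      rw [← hfg, eval₂_mul, eval₂_sub, eval₂_X, eval₂_C] at h2
      rcases mul_eq_zero.1 h2 with h4 | h4
      · exact absurd (sub_eq_zero.1 h4) hy
      · exact h4
    rw [eval₂_eq_sum_range, hgd] at h3
    set Fl := P (∑ i : Fin t, (u (i, Fin.last M)) ^ p ^ a * x ^ (i : ℕ)) with hFl
    have h5 : ∀ l : Fin (M+1), P (∑ i : Fin t, (u (i, l)) ^ p ^ a * x ^ (i : ℕ)) =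
        Fl * P (g.coeff l) := by
      intro l
      induction l using Fin.lastCases with
      | last =>
        have : g.coeff M = 1 := by rw [← hgd]; exact hgm
        rw [Fin.val_last, this, map_one, mul_one]
      | cast l => rw [hu1 l, map_mul]; rfl
    show P G = 0
    have h6 : (P G) ^ p ^ a = 0 := by
      have e1 : (P G) ^ p ^ a = ∑ l : Fin (M+1),
          P (∑ i : Fin t, (u (i, l)) ^ p ^ a * x ^ (i : ℕ)) * β' ^ (l : ℕ) := by
        rw [← iterateFrobenius_def, hG, map_sum, map_sum, Fintype.sum_prod_type_right]
        apply Finset.sum_congr rfl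
        intro l _
        rw [map_sum, Finset.sum_mul]
        apply Finset.sum_congr rfl
        intro i _
        rw [iterateFrobenius_def]
        simp only [map_mul, map_pow]
        rw [hβ', hQ, mul_pow, ← pow_mul _ (p ^ b) (p ^ a), mul_comm (p ^ b) (p ^ a), ← hQ, mul_pow,
          pow_right_comm (P x), hx, pow_right_comm (P y)]
        ring
      rw [e1]
      simp_rw [h5, mul_assoc]
      rw [← Finset.mul_sum, Fin.sum_univ_eq_sum_range (fun l => P (g.coeff l) * β' ^ l) (M+1)]
      have : ∑ l ∈ Finset.range (M+1), P (g.coeff l) * β' ^ l = 0 := h3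
      rw [this, mul_zero]
    exact (pow_eq_zero_iff (pow_pos (Fact.out : p.Prime).pos a).ne').1 h6
  refine ⟨(h.zeros_finite hu2).subset hsub, ?_⟩
  refine (Set.ncard_le_ncard hsub (h.zeros_finite hu2)).trans ((h.zeros_ncard_le hu2).trans ?_)
  rw [hQ, Nat.add_sub_cancel]
  exact hu3

end DegRing
end

section
open Polynomial

namespace DegRing
variable {k B : Type*} [Field k] [CommRing B] [IsDomain B] [Algebra k B] {deg : B → ℕ}

theorem weil_bound [Finite k] [IsPrincipalIdealRing B] (h : DegRing k B deg) (n0 : ℕ)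
    (hn0 : ∀ n, n0 ≤ n → h.l (n + 1) = h.l n + 1) :
    ∃ K : ℕ, ∀ n, 1 ≤ n → (Nat.card k : ℝ) ^ n - K * (√(Nat.card k)) ^ n ≤
      h.Nt n / ((Nat.card k : ℝ) - 1) := by
  classical
  have hle := h.l_succ_le n0 hn0
  have hγ : ∀ n, n + 1 ≤ h.l n + (n0 + 1) := by
    intro n
    rcases le_total n n0 with h1 | h1
    · omega
    · obtain ⟨c, rfl⟩ := Nat.exists_eq_add_of_le h1
      have : ∀ c, c ≤ h.l (n0 + c) := by
        intro c
        induction c with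
        | zero => omega
        | succ c ih => have := hn0 (n0 + c) (by omega); rw [← add_assoc, this]; omega
      have := this c
      omega
  obtain ⟨p, hp⟩ := CharP.exists k
  have hpp : Fact p.Prime := ⟨CharP.char_is_prime k p⟩
  obtain ⟨r, hr1, hr⟩ : ∃ r : ℕ, 0 < r ∧ Nat.card k = p ^ r := by
    let _ := Fintype.ofFinite k
    obtain ⟨e, _, he⟩ := FiniteField.card k p
    exact ⟨e, e.pos, by rw [Nat.card_eq_fintype_card, he]⟩
  obtain ⟨x, y, m, f, d, S⟩ := h.exists_Stp n0 hn0
  obtain ⟨c, hc⟩ := S.points (Ω := AlgebraicClosure k)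
  obtain ⟨C0, R0, hbad⟩ := S.bad (Ω := AlgebraicClosure k) hle hγ p
  have hq1 : 1 < Nat.card k := Finite.one_lt_card
  refine ⟨c + C0 * p + Nat.card k ^ (2 * R0), ?_⟩
  intro n hn
  have hqR : (1:ℝ) < (Nat.card k : ℝ) := by exact_mod_cast hq1
  set s := (√(Nat.card k : ℝ)) ^ n with hs
  have hs1 : 1 ≤ s := one_le_pow₀ (Real.one_le_sqrt.2 hqR.le)
  have hs2 : s * s = (Nat.card k : ℝ) ^ n := by
    rw [hs, ← mul_pow, Real.mul_self_sqrt (by positivity)]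
  have hfix : ((Fix k B (AlgebraicClosure k) n).ncard : ℝ) ≤ h.Nt n / ((Nat.card k : ℝ) - 1) := by
    rw [le_div_iff₀ (by linarith)]
    have := h.Fix_le_Nt (Ω := AlgebraicClosure k) hn
    have h2 : (((Nat.card k - 1) * (Fix k B (AlgebraicClosure k) n).ncard : ℕ) : ℝ) ≤ h.Nt n := by
      exact_mod_cast this
    rw [Nat.cast_mul, Nat.cast_sub hq1.le, Nat.cast_one] at h2
    linarith
  refine le_trans ?_ hfix
  push_cast
  have hpos : (0:ℝ) ≤ (Nat.card k : ℝ) ^ (2 * R0) * s := by positivity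
  rcases le_total n (2 * R0) with hn1 | hn1
  · have h1 : (Nat.card k : ℝ) ^ n ≤ (Nat.card k : ℝ) ^ (2 * R0) := pow_le_pow_right₀ hqR.le hn1
    have h2 : (Nat.card k : ℝ) ^ (2 * R0) * 1 ≤ (Nat.card k : ℝ) ^ (2 * R0) * s :=
      mul_le_mul_of_nonneg_left hs1 (by positivity)
    have h3 : (0:ℝ) ≤ (c + C0 * p) * s := by positivity
    have h4 : (0:ℝ) ≤ ((Fix k B (AlgebraicClosure k) n).ncard : ℝ) := by positivity
    nlinarith
  · obtain ⟨T, hT1, hT2⟩ := hc n hn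
    set N := r * n with hN
    have hNn : n ≤ N := by rw [hN]; nlinarith
    have hQ : Nat.card k ^ n = p ^ (N / 2) * p ^ (N - N / 2) := by
      rw [hr, ← pow_mul, ← pow_add]; congr 1; omega
    obtain ⟨hbf, hbc⟩ := hbad n (N / 2) (N - N / 2) (by omega)
      (by
        have : R0 ≤ N / 2 := by omega
        exact this.trans (Nat.lt_pow_self hpp.out.one_lt).le) hQ
    have hff := h.Fix_finite (Ω := AlgebraicClosure k) hn
    have hsub : (T : Set (B →ₐ[k] AlgebraicClosure k)) ⊆ Fix k B (AlgebraicClosure k) n ∪ 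
        {P : B →ₐ[k] AlgebraicClosure k | P x ^ (Nat.card k ^ n) = P x ∧ P y ^ (Nat.card k ^ n) ≠ P y} := by
      intro P hP
      obtain ⟨h1, h2⟩ := hT1 P hP
      by_cases h3 : P y ^ (Nat.card k ^ n) = P y
      · exact Or.inl (S.fix_of h1 h3 h2)
      · exact Or.inr ⟨h1, h3⟩
    have hcard := (Set.ncard_le_ncard hsub (hff.union hbf)).trans (Set.ncard_union_le _ _)
    rw [Set.ncard_coe_finset] at hcard
    obtain ⟨M, hM⟩ : ∃ M, m = M + 1 := ⟨m - 1, by have := S.hm; omega⟩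
    rw [hM, Nat.add_sub_cancel] at hbc
    rw [hM, Nat.add_mul, one_mul] at hT2
    have h5 : Nat.card k ^ n ≤ (Fix k B (AlgebraicClosure k) n).ncard + c + C0 * p ^ (N - N / 2) := by
      omega
    have h5' : (Nat.card k : ℝ) ^ n ≤ (Fix k B (AlgebraicClosure k) n).ncard + c
        + C0 * (p:ℝ) ^ (N - N / 2) := by exact_mod_cast h5
    have hp1 : (1:ℝ) ≤ p := by exact_mod_cast hpp.out.one_lt.le
    have hw : (p:ℝ) ^ (N - N / 2) ≤ p * s := by
      have e1 : (p:ℝ) ^ (N - N / 2) ≤ p * p ^ (N / 2) := by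
        rw [← pow_succ']; exact pow_le_pow_right₀ hp1 (by omega)
      have e2 : (p:ℝ) ^ (N / 2) * p ^ (N - N / 2) = s * s := by
        rw [hs2]; exact_mod_cast hQ.symm
      have e3 : (0:ℝ) < (p:ℝ) ^ (N - N / 2) := by positivity
      by_contra hlt
      push Not at hlt
      have e4 : p * s * (p * s) < (p:ℝ) ^ (N - N / 2) * (p:ℝ) ^ (N - N / 2) :=
        mul_lt_mul'' hlt hlt (by positivity) (by positivity)
      have e5 : (p:ℝ) ^ (N - N / 2) * (p:ℝ) ^ (N - N / 2) ≤ p * (s * s) := by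
        rw [← e2, ← mul_assoc]
        exact mul_le_mul_of_nonneg_right e1 e3.le
      have e6 : p * (s * s) ≤ p * s * (p * s) := by
        have : (0:ℝ) ≤ (s * s) * p := by positivity
        nlinarith
      linarith
    have h6 : (C0:ℝ) * (p:ℝ) ^ (N - N / 2) ≤ C0 * (p * s) := mul_le_mul_of_nonneg_left hw (by positivity)
    have h7 : (c:ℝ) * 1 ≤ c * s := mul_le_mul_of_nonneg_left hs1 (by positivity)
    nlinarith

end DegRing
end

section
open Polynomial

open TensorProduct in
/-- constant field extension of a domain in which the constants are algebraically closed. -/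
theorem noZeroDiv_tensor {k B : Type*} (k' : Type*) [Field k] [CommRing B] [IsDomain B] [Algebra k B]
    [Field k'] [Algebra k k'] [FiniteDimensional k k'] [Algebra.IsSeparable k k']
    (hc : ∀ b : FractionRing B, (algebraMap k (FractionRing B)).IsIntegralElem b →
      ∃ c : k, algebraMap k (FractionRing B) c = b) : NoZeroDivisors (k' ⊗[k] B) := by
  let K := FractionRing B
  let Kb := AlgebraicClosure K
  let j : k' →ₐ[k] Kb := IsAlgClosed.lift
  let pb := Field.powerBasisOfFiniteOfSeparable k k'
  have hintg : IsIntegral k (j pb.gen) := (Algebra.IsIntegral.isIntegral (R := k) pb.gen).map j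
  have hintK : IsIntegral K (j pb.gen) := hintg.tower_top
  have hmk : minpoly k (j pb.gen) = minpoly k pb.gen :=
    minpoly.algHom_eq j j.injective pb.gen
  have hdvd : minpoly K (j pb.gen) ∣ (minpoly k (j pb.gen)).map (algebraMap k K) :=
    minpoly.dvd_map_of_isScalarTower k K (j pb.gen)
  have hlift : minpoly K (j pb.gen) ∈ Polynomial.lifts (algebraMap k K) := by
    rw [Polynomial.lifts_iff_coeff_lifts]
    intro n
    exact hc _ (Polynomial.isIntegral_coeff_of_dvd _ _ (minpoly.monic hintg) (minpoly.monic hintK) hdvd n)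
  obtain ⟨r, hr, hrd, hrm⟩ := Polynomial.lifts_and_natDegree_eq_and_monic hlift (minpoly.monic hintK)
  have hr0 : aeval (j pb.gen) r = 0 := by
    rw [← Polynomial.aeval_map_algebraMap K, hr, minpoly.aeval]
  have hdeg : pb.dim ≤ (minpoly K (j pb.gen)).natDegree := by
    rw [← hrd, ← pb.natDegree_minpoly, ← hmk]
    exact Polynomial.natDegree_le_of_dvd (minpoly.dvd _ _ hr0) hrm.ne_zero
  have hli0 : LinearIndependent K (fun i : Fin (minpoly K (j pb.gen)).natDegree => (j pb.gen)^(i:ℕ)) :=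
    linearIndependent_pow _
  have hliK : LinearIndependent K (fun i : Fin pb.dim => (j pb.gen)^(i:ℕ)) :=
    hli0.comp (Fin.castLE hdeg) (Fin.castLE_injective hdeg)
  have hli : LinearIndependent B (fun i : Fin pb.dim => (j pb.gen)^(i:ℕ)) :=
    hliK.restrict_scalars' B
  let φ : B ⊗[k] k' →ₐ[B] Kb := Algebra.TensorProduct.lift (Algebra.ofId B Kb) j (fun _ _ => Commute.all _ _)
  let bs := Algebra.TensorProduct.basis B pb.basis
  have hφ : Function.Injective φ := by
    rw [injective_iff_map_eq_zero]
    intro x hx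
    rw [← bs.sum_repr x, map_sum] at hx
    have h1 : ∀ i, φ (bs.repr x i • bs i) = bs.repr x i • (j pb.gen)^(i:ℕ) := by
      intro i
      rw [map_smul]
      congr 1
      simp [φ, bs]
    simp_rw [h1] at hx
    have h2 := Fintype.linearIndependent_iff.1 hli _ hx
    apply bs.repr.injective
    ext i
    simp [h2 i]
  have hcomm := (Algebra.TensorProduct.comm k k' B)
  have hinj : Function.Injective (φ.toRingHom.comp (Algebra.TensorProduct.comm k k' B).toAlgHom.toRingHom) := by
    exact hφ.comp (Algebra.TensorProduct.comm k k' B).injective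
  exact hinj.noZeroDivisors _ (map_zero _) (map_mul _)
end

section
open Polynomial
open scoped TensorProduct

namespace DegRing
variable {k B : Type*} [Field k] [CommRing B] [IsDomain B] [Algebra k B] {deg : B → ℕ}
  {k' : Type*} [Field k'] [Algebra k k']

noncomputable def L' (h : DegRing k B deg) (k' : Type*) [Field k'] [Algebra k k'] (n : ℕ) :
    Submodule k' (k' ⊗[k] B) := (h.L n).baseChange k'

theorem L'_finrank (h : DegRing k B deg) (n : ℕ) : Module.finrank k' (h.L' k' n) = h.l n := by
  unfold L' l
  rw [← (Submodule.toBaseChange.toLinearEquiv k' (h.L n)).finrank_eq, Module.finrank_baseChange]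

theorem L'_finite (h : DegRing k B deg) (n : ℕ) : Module.Finite k' (h.L' k' n) := by
  have := h.L_fin n
  exact Module.Finite.equiv (Submodule.toBaseChange.toLinearEquiv k' (h.L n))

theorem L'_mono (h : DegRing k B deg) {m n : ℕ} (hmn : m ≤ n) : h.L' k' m ≤ h.L' k' n :=
  Submodule.baseChange_mono k' (h.L_mono hmn)

theorem L'_mul (h : DegRing k B deg) {m n : ℕ} {f g : k' ⊗[k] B} (hf : f ∈ h.L' k' m)
    (hg : g ∈ h.L' k' n) : f * g ∈ h.L' k' (m + n) := by
  have h1 : h.L' k' m * h.L' k' n ≤ h.L' k' (m+n) := by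
    unfold L'
    rw [Submodule.baseChange_eq_span, Submodule.baseChange_eq_span, Submodule.span_mul_span,
      Submodule.span_le]
    rintro _ ⟨_, ⟨a, ha, rfl⟩, _, ⟨b, hb, rfl⟩, rfl⟩
    have : (1:k') ⊗ₜ[k] a * (1:k') ⊗ₜ[k] b = 1 ⊗ₜ[k] (a*b) := by
      rw [Algebra.TensorProduct.tmul_mul_tmul, one_mul]
    show (1:k') ⊗ₜ[k] a * (1:k') ⊗ₜ[k] b ∈ _
    rw [this]
    apply Submodule.tmul_mem_baseChange_of_mem
    have ha' := (h.mem_L m a).1 ha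
    have hb' := (h.mem_L n b).1 hb
    rw [h.mem_L]
    by_cases h0 : a = 0
    · subst h0; rw [zero_mul, h.zero]; omega
    by_cases h0' : b = 0
    · subst h0'; rw [mul_zero, h.zero]; omega
    rw [h.mul _ _ h0 h0']; omega
  exact h1 (Submodule.mul_mem_mul hf hg)

theorem exists_mem_L' (h : DegRing k B deg) (f : k' ⊗[k] B) : ∃ n, f ∈ h.L' k' n := by
  induction f using TensorProduct.induction_on with
  | zero => exact ⟨0, Submodule.zero_mem _⟩
  | tmul a b => exact ⟨deg b, Submodule.tmul_mem_baseChange_of_mem _ ((h.mem_L _ _).2 le_rfl)⟩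
  | add x y hx hy =>
    obtain ⟨m, hm⟩ := hx
    obtain ⟨n, hn⟩ := hy
    exact ⟨max m n, Submodule.add_mem _ (h.L'_mono (le_max_left _ _) hm)
      (h.L'_mono (le_max_right _ _) hn)⟩

theorem exists_mem_L'_finset (h : DegRing k B deg) (s : Finset (k' ⊗[k] B)) :
    ∃ n, ∀ f ∈ s, f ∈ h.L' k' n := by
  choose N hN using h.exists_mem_L' (k' := k')
  exact ⟨s.sup N, fun f hf => h.L'_mono (Finset.le_sup hf) (hN f)⟩

theorem rank_quot' [NoZeroDivisors (k' ⊗[k] B)] (h : DegRing k B deg) {δ n0 : ℕ}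
    (hδ : ∀ n, n0 ≤ n → h.l (n + δ) = h.l n + δ) (m : ℕ) {f : k' ⊗[k] B} (hf : f ≠ 0)
    (hfm : f ∈ h.L' k' (δ * m)) :
    Module.rank k' ((k' ⊗[k] B) ⧸ Ideal.span {f}) ≤ (δ * m : ℕ) := by
  classical
  have hδm : ∀ m n, n0 ≤ n → h.l (n + δ * m) = h.l n + δ * m := by
    intro m
    induction m with
    | zero => intro n _; simp
    | succ m ih =>
      intro n hn
      rw [mul_add, mul_one, ← add_assoc, hδ _ (by omega), ih n hn]; omega
  apply rank_le
  intro s hs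
  let lift : (k' ⊗[k] B) ⧸ Ideal.span {f} → k' ⊗[k] B := Function.surjInv Ideal.Quotient.mk_surjective
  have hlift : ∀ x, Ideal.Quotient.mk (Ideal.span {f}) (lift x) = x :=
    Function.surjInv_eq Ideal.Quotient.mk_surjective
  obtain ⟨N0, hN0⟩ := h.exists_mem_L'_finset (s.image lift)
  set N := N0 + n0 with hN
  have hfin := h.L'_finite (k' := k') (N + δ * m)
  let ψ : h.L' k' (N + δ * m) →ₗ[k'] ((k' ⊗[k] B) ⧸ Ideal.span {f}) :=
    (Ideal.Quotient.mkₐ k' (Ideal.span {f})).toLinearMap ∘ₗ (h.L' k' (N + δ*m)).subtype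
  let μ : h.L' k' N →ₗ[k'] h.L' k' (N + δ * m) :=
    LinearMap.codRestrict _ (LinearMap.mulLeft k' f ∘ₗ (h.L' k' N).subtype) (by
      intro c
      rw [add_comm]
      exact h.L'_mul hfm c.2)
  have hμ : Function.Injective μ := by
    intro a b hab
    have h1 : f * (a : k' ⊗[k] B) = f * (b : k' ⊗[k] B) := congrArg Subtype.val hab
    have h2 : f * ((a : k' ⊗[k] B) - b) = 0 := by rw [mul_sub, h1, sub_self]
    rcases mul_eq_zero.1 h2 with h3 | h3
    · exact absurd h3 hf
    · exact Subtype.ext (sub_eq_zero.1 h3)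
  have hle : LinearMap.range μ ≤ LinearMap.ker ψ := by
    rintro _ ⟨a, rfl⟩
    rw [LinearMap.mem_ker]
    show Ideal.Quotient.mk (Ideal.span {f}) (f * (a : k' ⊗[k] B)) = 0
    rw [Ideal.Quotient.eq_zero_iff_mem]
    exact Ideal.mul_mem_right _ _ (Ideal.mem_span_singleton_self f)
  have h1 : Module.finrank k' (LinearMap.range μ) = h.l N := by
    rw [LinearMap.finrank_range_of_inj hμ, h.L'_finrank]
  have h2 := Submodule.finrank_mono hle
  have h3 := ψ.finrank_range_add_finrank_ker
  rw [h.L'_finrank, hδm m N (by omega)] at h3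
  have h4 : s.card ≤ Module.finrank k' (LinearMap.range ψ) := by
    rw [← finrank_span_finset_eq_card hs]
    apply Submodule.finrank_mono
    rw [Submodule.span_le]
    intro x hx
    refine ⟨⟨lift x, h.L'_mono (by omega) (hN0 _ (Finset.mem_image_of_mem _ hx))⟩, hlift x⟩
  omega

theorem zeros' {Ω : Type*} [Field Ω] [Algebra k' Ω] [NoZeroDivisors (k' ⊗[k] B)]
    (h : DegRing k B deg) {δ n0 : ℕ}
    (hδ : ∀ n, n0 ≤ n → h.l (n + δ) = h.l n + δ) (m : ℕ) {f : k' ⊗[k] B} (hf : f ≠ 0)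
    (hfm : f ∈ h.L' k' (δ * m)) :
    {P : k' ⊗[k] B →ₐ[k'] Ω | P f = 0}.Finite ∧
    {P : k' ⊗[k] B →ₐ[k'] Ω | P f = 0}.ncard ≤ δ * m := by
  have h1 := h.rank_quot' hδ m hf hfm
  have hfin : Module.Finite k' ((k' ⊗[k] B) ⧸ Ideal.span {f}) := by
    rw [← Module.rank_lt_aleph0_iff]
    exact lt_of_le_of_lt h1 (Cardinal.natCast_lt_aleph0)
  have h2 : Module.finrank k' ((k' ⊗[k] B) ⧸ Ideal.span {f}) ≤ δ * m :=
    Module.finrank_le_of_rank_le h1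
  constructor
  · exact Set.finite_coe_iff.1 (Finite.of_equiv _ (zerosEquiv k' Ω f).symm)
  · rw [← Nat.card_coe_set_eq, Nat.card_congr (zerosEquiv k' Ω f)]
    exact (card_algHom_le_finrank k' _ Ω).trans h2

end DegRing
end

section
open Polynomial
open scoped TensorProduct

namespace DegRing
variable {k B : Type*} [Field k] [CommRing B] [IsDomain B] [Algebra k B] {deg : B → ℕ}
  {k' : Type*} [Field k'] [Algebra k k']
  {Ω : Type*} [Field Ω] [Algebra k Ω] [Algebra k' Ω] [IsScalarTower k k' Ω]

noncomputable def extP (k' : Type*) [Field k'] [Algebra k k'] [Algebra k' Ω] [IsScalarTower k k' Ω]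
    (P : B →ₐ[k] Ω) : k' ⊗[k] B →ₐ[k'] Ω :=
  Algebra.TensorProduct.lift (Algebra.ofId k' Ω) P (fun _ _ => Commute.all _ _)

theorem extP_tmul (P : B →ₐ[k] Ω) (a : k') (b : B) :
    extP k' P (a ⊗ₜ[k] b) = algebraMap k' Ω a * P b := by
  simp [extP, Algebra.ofId_apply]

theorem extP_injective : Function.Injective (extP (k := k) (B := B) (Ω := Ω) k') := by
  intro P Q hPQ
  ext b
  have := congrArg (fun F => F ((1:k') ⊗ₜ[k] b)) hPQ
  simpa [extP_tmul] using this

theorem extP_pow [Finite k] [Finite k'] [IsPrincipalIdealRing B] (h : DegRing k B deg)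
    {e : ℕ} (he : Nat.card k' = Nat.card k ^ e) {p : B} (hp : Prime p) (hep : e ∣ deg p)
    (P : B →ₐ[k] Ω) (hP : P p = 0) (f : k' ⊗[k] B) :
    extP k' P f ^ (Nat.card k ^ deg p) = extP k' P f := by
  classical
  letI := Fintype.ofFinite k
  letI := Fintype.ofFinite k'
  have hpow : ∀ x : Ω, (FiniteField.frobeniusAlgHom k Ω ^ deg p) x = x ^ (Nat.card k ^ deg p) := by
    intro x
    rw [AlgHom.coe_pow, FiniteField.coe_frobeniusAlgHom, pow_iterate, ← Nat.card_eq_fintype_card]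
  rw [← hpow]
  induction f using TensorProduct.induction_on with
  | zero => simp
  | add x y hx hy => rw [map_add, map_add, hx, hy]
  | tmul a b =>
    rw [extP_tmul, map_mul, hpow, hpow]
    congr 1
    · obtain ⟨c, hc⟩ := hep
      rw [← map_pow, hc, pow_mul, ← he, Nat.card_eq_fintype_card, FiniteField.pow_card_pow]
    · have h1 := h.pow_card_sub_mem hp b
      obtain ⟨c, hc⟩ := h1
      have h2 := congrArg P hc
      rw [map_sub, map_pow, map_mul, hP, zero_mul] at h2
      exact sub_eq_zero.1 h2

theorem L'_fin [Finite k'] (h : DegRing k B deg) (n : ℕ) : Finite (h.L' k' n) := by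
  have := h.L'_finite (k' := k') n
  exact Module.finite_of_finite k'

theorem L'_card [Finite k'] (h : DegRing k B deg) {e : ℕ} (he : Nat.card k' = Nat.card k ^ e) (n : ℕ) :
    Nat.card (h.L' k' n) = Nat.card k ^ (e * h.l n) := by
  have := h.L'_finite (k' := k') n
  rw [pow_mul, ← he, ← h.L'_finrank (k' := k')]
  exact Module.natCard_eq_pow_finrank

theorem card_ker [Finite k] [Finite k'] [IsPrincipalIdealRing B] (h : DegRing k B deg)
    {e : ℕ} (he : Nat.card k' = Nat.card k ^ e) {p : B} (hp : Prime p) (hep : e ∣ deg p)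
    (P : B →ₐ[k] Ω) (hP : P p = 0) (n : ℕ) :
    Nat.card k ^ (e * h.l n) ≤ Nat.card {f : h.L' k' n // extP k' P f.1 = 0} * Nat.card k ^ deg p := by
  classical
  have := h.L'_fin (k' := k') n
  let ψ : h.L' k' n →+ Ω := ((extP k' P).toLinearMap ∘ₗ (h.L' k' n).subtype).toAddMonoidHom
  have h1 : Nat.card (h.L' k' n) = Nat.card ψ.ker * Nat.card ψ.range := by
    rw [AddSubgroup.card_eq_card_quotient_mul_card_addSubgroup ψ.ker, mul_comm]
    congr 1
    exact Nat.card_congr (QuotientAddGroup.quotientKerEquivRange ψ).toEquiv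
  rw [h.L'_card he] at h1
  rw [h1]
  have h2 : Nat.card ψ.ker = Nat.card {f : h.L' k' n // extP k' P f.1 = 0} := rfl
  rw [h2]
  apply Nat.mul_le_mul_left
  have hq : 1 < Nat.card k := Finite.one_lt_card
  have hQ : 1 < Nat.card k ^ deg p := Nat.one_lt_pow (h.deg_prime_pos hp).ne' hq
  have h3 : (ψ.range : Set Ω) ⊆ ((X ^ (Nat.card k ^ deg p) - X : Polynomial Ω).roots.toFinset : Finset Ω) := by
    rintro _ ⟨f, rfl⟩
    rw [Finset.mem_coe, Multiset.mem_toFinset, mem_roots (FiniteField.X_pow_card_sub_X_ne_zero Ω hQ)]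
    have := h.extP_pow he hp hep P hP f.1
    simp only [IsRoot, eval_sub, eval_pow, eval_X]
    rw [sub_eq_zero]; exact this
  have h4 := Set.ncard_le_ncard h3 (Finset.finite_toSet _)
  rw [Set.ncard_coe_finset] at h4
  have h5 : Nat.card ψ.range = (ψ.range : Set Ω).ncard := rfl
  rw [h5]
  refine h4.trans ((Multiset.toFinset_card_le _).trans ((card_roots' _).trans ?_))
  rw [FiniteField.X_pow_card_sub_X_natDegree_eq Ω hQ]

end DegRing
end

section
open Polynomial
open scoped TensorProduct

namespace DegRing
variable {k B : Type*} [Field k] [CommRing B] [IsDomain B] [Algebra k B] {deg : B → ℕ}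
  {k' : Type*} [Field k'] [Algebra k k']
  {Ω : Type*} [Field Ω] [Algebra k Ω] [Algebra k' Ω] [IsScalarTower k k' Ω]

open Classical in
theorem card_primes_of_point [Finite k] [IsPrincipalIdealRing B] (h : DegRing k B deg) (D : ℕ)
    (P : B →ₐ[k] Ω) : ((h.Pr D).filter (fun p => P p = 0)).card ≤ Nat.card k - 1 := by
  rcases ((h.Pr D).filter (fun p => P p = 0)).eq_empty_or_nonempty with h0 | ⟨p, hp⟩
  · rw [h0]; simp
  rw [Finset.mem_filter, h.mem_Pr] at hp
  obtain ⟨⟨hd, hpp⟩, hP⟩ := hp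
  rw [← h.card_assoc hpp.ne_zero D hd]
  apply Finset.card_le_card
  intro z hz
  rw [Finset.mem_filter, h.mem_Pr] at hz
  obtain ⟨⟨hzd, hz⟩, hPz⟩ := hz
  rw [Finset.mem_filter, h.mem_LF]
  refine ⟨hzd, ?_⟩
  have hmax := isMaximal_of_prime hpp
  have hker : RingHom.ker P ≠ ⊤ := RingHom.ker_ne_top _
  have heq : Ideal.span {p} = RingHom.ker P := by
    apply hmax.eq_of_le hker
    rw [Ideal.span_singleton_le_iff_mem]; exact hP
  have : z ∈ Ideal.span {p} := by rw [heq]; exact hPz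
  rw [Ideal.mem_span_singleton] at this
  exact hpp.irreducible.associated_of_dvd hz.irreducible this

theorem count_bound [Finite k] [Finite k'] [IsAlgClosed Ω] [IsPrincipalIdealRing B]
    [NoZeroDivisors (k' ⊗[k] B)] (h : DegRing k B deg)
    {δ n0 : ℕ} (hδ : ∀ n, n0 ≤ n → h.l (n + δ) = h.l n + δ)
    {e : ℕ} (he : Nat.card k' = Nat.card k ^ e) (hed : ∀ b, e ∣ deg b) (m D : ℕ) :
    ∑ p ∈ h.Pr D, (deg p : ℝ) * ((Nat.card k : ℝ) ^ (e * h.l (δ*m)) / (Nat.card k : ℝ) ^ deg p - 1)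
      ≤ ((Nat.card k : ℝ) - 1) * (δ * m : ℕ) * (Nat.card k : ℝ) ^ (e * h.l (δ*m)) := by
  classical
  have hq : 1 < Nat.card k := Finite.one_lt_card
  have hqR : (1:ℝ) < Nat.card k := by exact_mod_cast hq
  have hfinL := h.L'_fin (k' := k') (δ*m)
  have hfinS : ((h.L' k' (δ*m) : Set (k' ⊗[k] B))).Finite := Set.finite_coe_iff.1 hfinL
  set F : Finset (k' ⊗[k] B) := hfinS.toFinset.filter (fun f => f ≠ 0) with hF
  have hFc : F.card ≤ Nat.card k ^ (e * h.l (δ*m)) := by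
    rw [← h.L'_card he, hF]
    refine (Finset.card_filter_le _ _).trans (le_of_eq ?_)
    rw [← Set.ncard_eq_toFinset_card _ hfinS]; rfl
  have hG : (∏ p ∈ h.Pr D, p) ≠ 0 :=
    Finset.prod_ne_zero_iff.2 (fun p hp => ((h.mem_Pr _ _).1 hp).2.ne_zero)
  have hZ := h.zeros_finite (Ω := Ω) hG
  set Z := hZ.toFinset with hZdef
  have hmemZ : ∀ p ∈ h.Pr D, ∀ P : B →ₐ[k] Ω, P p = 0 → P ∈ Z := by
    intro p hp P hP
    rw [hZdef, hZ.mem_toFinset]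
    show P _ = 0
    rw [map_prod]; exact Finset.prod_eq_zero hp hP
  have h1 : ∑ p ∈ h.Pr D, ∑ P ∈ Z with P p = 0, (F.filter (fun f => extP k' P f = 0)).card
      = ∑ f ∈ F, ∑ P ∈ Z with extP k' P f = 0, ((h.Pr D).filter (fun p => P p = 0)).card := by
    simp only [Finset.card_filter, Finset.sum_filter]
    rw [Finset.sum_comm, Finset.sum_comm (s := F)]
    apply Finset.sum_congr rfl
    intro P _
    have e1 : ∀ p ∈ h.Pr D, (if P p = 0 then ∑ f ∈ F, (if extP k' P f = 0 then 1 else 0) else 0) =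
        ∑ f ∈ F, (if P p = 0 ∧ extP k' P f = 0 then 1 else 0) := by
      intro p _
      by_cases hp : P p = 0 <;> simp [hp]
    have e2 : ∀ f ∈ F, (if extP k' P f = 0 then ∑ p ∈ h.Pr D, (if P p = 0 then 1 else 0) else 0) =
        ∑ p ∈ h.Pr D, (if P p = 0 ∧ extP k' P f = 0 then 1 else 0) := by
      intro p _
      by_cases hp : extP k' P p = 0 <;> simp [hp]
    rw [Finset.sum_congr rfl e1, Finset.sum_congr rfl e2, Finset.sum_comm]
  have h2 : ∑ f ∈ F, ∑ P ∈ Z with extP k' P f = 0, ((h.Pr D).filter (fun p => P p = 0)).card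
      ≤ F.card * ((δ * m) * (Nat.card k - 1)) := by
    rw [← smul_eq_mul]
    apply Finset.sum_le_card_nsmul
    intro f hf
    rw [hF, Finset.mem_filter, hfinS.mem_toFinset] at hf
    obtain ⟨hfL, hf0⟩ := hf
    obtain ⟨hz1, hz2⟩ := h.zeros' (Ω := Ω) hδ m hf0 hfL
    have h3 : (Z.filter (fun P => extP k' P f = 0)).card ≤ δ * m := by
      refine le_trans ?_ hz2
      rw [← Set.ncard_coe_finset]
      refine Set.ncard_le_ncard_of_injOn (extP k') ?_ extP_injective.injOn hz1
      intro P hP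
      exact (Finset.mem_filter.1 hP).2
    refine (Finset.sum_le_card_nsmul _ _ (Nat.card k - 1) (fun P _ => h.card_primes_of_point D P)).trans ?_
    rw [smul_eq_mul]
    exact Nat.mul_le_mul_right _ h3
  have h3 : ∀ p ∈ h.Pr D, (deg p : ℝ) * ((Nat.card k : ℝ) ^ (e * h.l (δ*m)) / (Nat.card k : ℝ) ^ deg p - 1)
      ≤ ((∑ P ∈ Z with P p = 0, (F.filter (fun f => extP k' P f = 0)).card : ℕ) : ℝ) := by
    intro p hp
    have hpp := ((h.mem_Pr _ _).1 hp).2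
    have hc : (Z.filter (fun P => P p = 0)).card = deg p := by
      rw [← h.zeros_prime_ncard (Ω := Ω) hpp, ← Set.ncard_coe_finset]
      congr 1
      ext P
      simp only [Finset.coe_filter, Set.mem_setOf_eq]
      exact ⟨fun h => h.2, fun h => ⟨hmemZ p hp P h, h⟩⟩
    rw [Nat.cast_sum, ← hc, ← nsmul_eq_mul]
    apply Finset.card_nsmul_le_sum
    intro P hP
    have hP0 := (Finset.mem_filter.1 hP).2
    have h4 := h.card_ker he hpp (hed p) P hP0 (δ*m)
    have h5 : Nat.card {f : h.L' k' (δ*m) // extP k' P f.1 = 0} ≤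
        (F.filter (fun f => extP k' P f = 0)).card + 1 := by
      have : (insert 0 (F.filter (fun f => extP k' P f = 0))).card ≤
        (F.filter (fun f => extP k' P f = 0)).card + 1 := Finset.card_insert_le _ _
      refine le_trans ?_ this
      rw [← Nat.card_eq_finsetCard]
      refine Nat.card_le_card_of_injective (fun f => ⟨f.1.1, ?_⟩) ?_
      · rw [Finset.mem_insert, Finset.mem_filter, hF, Finset.mem_filter, hfinS.mem_toFinset]
        by_cases h0 : f.1.1 = 0
        · exact Or.inl h0
        · exact Or.inr ⟨⟨f.1.2, h0⟩, f.2⟩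
      · intro a b hab
        have := congrArg Subtype.val hab
        exact Subtype.ext (Subtype.ext this)
    have h6 : Nat.card k ^ (e * h.l (δ*m)) ≤
       ((F.filter (fun f => extP k' P f = 0)).card + 1) * Nat.card k ^ deg p :=
      h4.trans (Nat.mul_le_mul_right _ h5)
    have h7 : (Nat.card k : ℝ) ^ (e * h.l (δ*m)) ≤
       (((F.filter (fun f => extP k' P f = 0)).card : ℝ) + 1) * (Nat.card k : ℝ) ^ deg p := by
      exact_mod_cast h6
    rw [hc, sub_le_iff_le_add, div_le_iff₀ (by positivity)]
    exact h7
  refine (Finset.sum_le_sum h3).trans ?_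
  rw [← Nat.cast_sum, h1]
  have h8 : ((F.card * ((δ * m) * (Nat.card k - 1)) : ℕ) : ℝ) ≤
      ((Nat.card k ^ (e * h.l (δ*m)) * ((δ * m) * (Nat.card k - 1)) : ℕ) : ℝ) := by
    exact_mod_cast Nat.mul_le_mul_right _ hFc
  refine (Nat.cast_le.2 h2).trans (h8.trans (le_of_eq ?_))
  push_cast [Nat.cast_sub hq.le]
  ring

end DegRing
end

section
open Polynomial
open scoped TensorProduct

theorem final_contra (t e : ℕ → ℝ) (ht : ∀ j, 0 ≤ t j) (κ C M0 : ℝ) (hκ : 0 < κ) (hM0 : 0 ≤ M0)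
    (N1 : ℕ) (hN1 : 0 < N1)
    (hT : ∀ n, ∑ j ∈ Finset.Icc 1 n, t j ≤ 25/32 * n + C)
    (hrec : ∀ n : ℕ, n * e n = ∑ j ∈ Finset.Icc 1 n, t j * e (n - j))
    (hM : ∀ i, e i ≤ M0) (hle : ∀ i, N1 ≤ i → e i ≤ κ) (heq : ∀ m, 1 ≤ m → e (N1 * m) = κ) : False := by
  set T : ℕ → ℝ := fun n => ∑ j ∈ Finset.Icc 1 n, t j with hTdef
  have hN1R : (0:ℝ) < N1 := by exact_mod_cast hN1
  -- small increments occur arbitrarily far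
  have hsmall : ∀ m0 : ℕ, ∃ m, m0 ≤ m ∧ T (N1 * (m+1)) - T (N1 * m) ≤ N1 := by
    intro m0
    by_contra hcon
    push Not at hcon
    have h1 : ∀ i : ℕ, T (N1 * m0) + i * N1 ≤ T (N1 * (m0 + i)) := by
      intro i
      induction i with
      | zero => simp
      | succ i ih =>
        have := hcon (m0 + i) (by omega)
        rw [← add_assoc]
        push_cast
        linarith
    have h0 : 0 ≤ T (N1 * m0) := Finset.sum_nonneg (fun j _ => ht j)
    obtain ⟨i, hi⟩ := exists_nat_gt ((25/32 * (N1 * m0) + C) / (7/32 * N1))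
    rw [div_lt_iff₀ (by positivity)] at hi
    have h2 := h1 i
    have h3 := hT (N1 * (m0 + i))
    push_cast at h3
    have h4 : T (N1 * (m0+i)) ≤ 25/32 * (N1 * (m0 + i)) + C := h3
    nlinarith
  obtain ⟨m0, hm0⟩ := exists_nat_gt ((κ * C + M0 * N1) / (7/32 * κ * N1))
  rw [div_lt_iff₀ (by positivity)] at hm0
  obtain ⟨m, hm, hinc⟩ := hsmall m0
  set n := N1 * (m+1) with hn
  have hr := hrec n
  rw [hn, heq (m+1) (by omega), ← hn] at hr
  have hsplit : ∀ g : ℕ → ℝ, ∑ j ∈ Finset.Icc 1 n, g j =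
      ∑ j ∈ Finset.Icc 1 (N1*m), g j + ∑ j ∈ Finset.Ioc (N1*m) n, g j := by
    intro g
    have : N1 * m ≤ n := by rw [hn]; exact Nat.mul_le_mul_left _ (by omega)
    have e1 : ∀ a, Finset.Icc 1 a = Finset.Ioc 0 a := by intro a; ext x; simp; omega
    rw [e1, e1]
    rw [Finset.sum_Ioc_consecutive _ (Nat.zero_le _) this]
  have hTn : T n = T (N1*m) + ∑ j ∈ Finset.Ioc (N1*m) n, t j := hsplit t
  rw [hsplit (fun j => t j * e (n-j))] at hr
  have hA : ∑ j ∈ Finset.Icc 1 (N1*m), t j * e (n-j) ≤ T (N1*m) * κ := by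
    rw [hTdef, Finset.sum_mul]
    apply Finset.sum_le_sum
    intro j hj
    rw [Finset.mem_Icc] at hj
    apply mul_le_mul_of_nonneg_left _ (ht j)
    apply hle
    have : n = N1*m + N1 := by rw [hn]; ring
    omega
  have hB : ∑ j ∈ Finset.Ioc (N1*m) n, t j * e (n-j) ≤ (∑ j ∈ Finset.Ioc (N1*m) n, t j) * M0 := by
    rw [Finset.sum_mul]
    apply Finset.sum_le_sum
    intro j hj
    exact mul_le_mul_of_nonneg_left (hM _) (ht j)
  have hTm : T (N1*m) ≤ 25/32 * n + C := by
    have h1 := hT (N1*m)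
    have h2 : ((N1*m : ℕ):ℝ) ≤ n := by
      rw [hn]; exact_mod_cast Nat.mul_le_mul_left _ (by omega)
    have h3 : T (N1*m) ≤ 25/32 * ((N1*m : ℕ):ℝ) + C := h1
    linarith
  have hI : (∑ j ∈ Finset.Ioc (N1*m) n, t j) * M0 ≤ N1 * M0 :=
    mul_le_mul_of_nonneg_right (by linarith) hM0
  have hnm : (N1:ℝ) * m0 ≤ n := by
    rw [hn]; exact_mod_cast Nat.mul_le_mul_left _ (by omega)
  have hTk : T (N1*m) * κ ≤ (25/32 * n + C) * κ := mul_le_mul_of_nonneg_right hTm hκ.le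
  have h7 : κ * (N1 * m0) ≤ κ * n := mul_le_mul_of_nonneg_left hnm hκ.le
  nlinarith

theorem geom_le_five {x : ℝ} (h0 : 0 ≤ x) (h1 : x ≤ 1/5) (n : ℕ) : ∑ i ∈ Finset.range n, x^i ≤ 5/4 := by
  have h2 := mul_neg_geom_sum x n
  have h3 : 0 ≤ x^n := by positivity
  have h4 : 0 ≤ ∑ i ∈ Finset.range n, x^i := Finset.sum_nonneg (fun i _ => by positivity)
  nlinarith

theorem geom_dvd_le {q : ℝ} (hq : 5 ≤ q) {d : ℕ} (hd : 1 ≤ d) (n : ℕ) :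
    ∑ j ∈ (Finset.Icc 1 n).filter (fun j => d ∣ j), (1:ℝ)/q^j ≤ 5/4 * (1/q^d) := by
  have hx1 : (1:ℝ)/q^d ≤ 1/5 := by
    apply one_div_le_one_div_of_le (by norm_num)
    calc (5:ℝ) ≤ q := hq
      _ = q^1 := (pow_one q).symm
      _ ≤ q^d := pow_le_pow_right₀ (by linarith) hd
  have hx0 : (0:ℝ) ≤ 1/q^d := by positivity
  have hs : (Finset.Icc 1 n).filter (fun j => d ∣ j) ⊆ (Finset.range n).image (fun i => d*(i+1)) := by
    intro j hj
    rw [Finset.mem_filter, Finset.mem_Icc] at hj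
    obtain ⟨⟨h1, h2⟩, c, rfl⟩ := hj
    rw [Finset.mem_image]
    have hc : c ≠ 0 := by rintro rfl; simp at h1
    have : c ≤ d * c := Nat.le_mul_of_pos_left _ hd
    refine ⟨c - 1, by rw [Finset.mem_range]; omega, ?_⟩
    rw [Nat.sub_add_cancel (by omega)]
  calc ∑ j ∈ (Finset.Icc 1 n).filter (fun j => d ∣ j), (1:ℝ)/q^j
      ≤ ∑ j ∈ (Finset.range n).image (fun i => d*(i+1)), (1:ℝ)/q^j :=
        Finset.sum_le_sum_of_subset_of_nonneg hs (fun i _ _ => by positivity)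
    _ = ∑ i ∈ Finset.range n, (1:ℝ)/q^(d*(i+1)) := by
        rw [Finset.sum_image]
        intro a _ b _ hab
        have := Nat.eq_of_mul_eq_mul_left hd hab
        omega
    _ = (∑ i ∈ Finset.range n, (1/q^d)^i) * (1/q^d) := by
        rw [Finset.sum_mul]
        apply Finset.sum_congr rfl
        intro i _
        rw [← pow_succ, div_pow, one_pow, pow_mul]
    _ ≤ 5/4 * (1/q^d) := mul_le_mul_of_nonneg_right (geom_le_five hx0 hx1 n) hx0

namespace DegRing
variable {k B : Type*} [Field k] [CommRing B] [IsDomain B] [Algebra k B] {deg : B → ℕ}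

theorem T_le [Finite k] (h : DegRing k B deg) (hq : 5 ≤ Nat.card k) (n : ℕ) :
    ∑ j ∈ Finset.Icc 1 n, (h.Nt j : ℝ) / (Nat.card k : ℝ)^j ≤
      5/4 * ∑ p ∈ h.Pr n, (deg p : ℝ) / (Nat.card k : ℝ)^deg p := by
  classical
  have hqR : (5:ℝ) ≤ Nat.card k := by exact_mod_cast hq
  have h1 : ∀ j ∈ Finset.Icc 1 n, (h.Nt j : ℝ) / (Nat.card k : ℝ)^j ≤
      ∑ p ∈ h.Pr n, if deg p ∣ j then (deg p : ℝ) * (1 / (Nat.card k : ℝ)^j) else 0 := by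
    intro j hj
    rw [Finset.mem_Icc] at hj
    rw [Nt, ← Finset.sum_filter, Nat.cast_sum, Finset.sum_div]
    simp_rw [div_eq_mul_one_div (deg _ : ℝ)]
    apply Finset.sum_le_sum_of_subset_of_nonneg
    · intro p hp
      rw [Finset.mem_filter, h.mem_Pr] at hp ⊢
      exact ⟨⟨hp.1.1.trans hj.2, hp.1.2⟩, hp.2⟩
    · intro p _ _; positivity
  refine (Finset.sum_le_sum h1).trans ?_
  rw [Finset.sum_comm, Finset.mul_sum]
  apply Finset.sum_le_sum
  intro p hp
  rw [← Finset.sum_filter, ← Finset.mul_sum]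
  have h2 := geom_dvd_le hqR (h.deg_prime_pos ((h.mem_Pr _ _).1 hp).2) n
  have h3 := mul_le_mul_of_nonneg_left h2 (Nat.cast_nonneg (α := ℝ) (deg p))
  refine h3.trans (le_of_eq ?_)
  ring

theorem S_le [Finite k] [IsPrincipalIdealRing B] (h : DegRing k B deg) (hq : 5 ≤ Nat.card k)
    (hc : ∀ b : FractionRing B, (algebraMap k (FractionRing B)).IsIntegralElem b →
      ∃ c : k, algebraMap k (FractionRing B) c = b)
    {δ n0 : ℕ} (hδ : ∀ n, n0 ≤ n → h.l (n + δ) = h.l n + δ) (hδ2 : 2 ≤ δ)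
    (hed : ∀ b, δ ∣ deg b) (D : ℕ) :
    ∑ p ∈ h.Pr D, (deg p : ℝ) / (Nat.card k : ℝ)^deg p ≤
      ((Nat.card k : ℝ) - 1) * (5/8 * D + 5/4 * (δ * n0 + δ)) := by
  have hqR : (5:ℝ) ≤ Nat.card k := by exact_mod_cast hq
  obtain ⟨p, hp⟩ := CharP.exists k
  have hpp : Fact p.Prime := ⟨CharP.char_is_prime k p⟩
  have : NeZero δ := ⟨by omega⟩
  let k' := FiniteField.Extension k p δ
  have he : Nat.card k' = Nat.card k ^ δ := FiniteField.natCard_extension k p δ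
  have hnz : NoZeroDivisors (k' ⊗[k] B) := noZeroDiv_tensor k' hc
  have hl : ∀ i, δ * i ≤ h.l (δ * (n0 + i)) := by
    intro i
    induction i with
    | zero => simp
    | succ i ih =>
      have e1 : δ * (n0 + (i+1)) = δ * (n0 + i) + δ := by ring
      rw [e1, hδ _ (by nlinarith)]
      have : δ * (i+1) = δ * i + δ := by ring
      omega
  set i := D / (δ*δ) + 1 with hi
  set m := n0 + i with hm
  have hD : D + 1 ≤ δ * h.l (δ * m) := by
    have h1 := hl i
    have h2 : D < (δ*δ) * i := by
      rw [hi]; exact Nat.lt_mul_div_succ D (by positivity)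
    have h3 : δ * (δ * i) ≤ δ * h.l (δ*m) := Nat.mul_le_mul_left _ h1
    rw [← mul_assoc] at h3
    omega
  have hcb := h.count_bound (k' := k') (Ω := AlgebraicClosure k') hδ he hed m D
  set Q : ℝ := (Nat.card k : ℝ) ^ (δ * h.l (δ*m)) with hQ
  have hQ0 : 0 < Q := by positivity
  have hterm : ∀ p ∈ h.Pr D, 4/5 * Q * ((deg p : ℝ) / (Nat.card k : ℝ)^deg p) ≤
      (deg p : ℝ) * (Q / (Nat.card k : ℝ) ^ deg p - 1) := by
    intro p hp
    have hdp := ((h.mem_Pr _ _).1 hp).1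
    have h1 : (5:ℝ) ≤ Q / (Nat.card k : ℝ) ^ deg p := by
      rw [le_div_iff₀ (by positivity)]
      calc (5:ℝ) * (Nat.card k : ℝ) ^ deg p ≤ (Nat.card k : ℝ) * (Nat.card k : ℝ) ^ deg p :=
            mul_le_mul_of_nonneg_right hqR (by positivity)
        _ = (Nat.card k : ℝ) ^ (deg p + 1) := by ring
        _ ≤ Q := pow_le_pow_right₀ (by linarith) (by omega)
    have h2 : 4/5 * Q * ((deg p : ℝ) / (Nat.card k : ℝ)^deg p) =
      (deg p : ℝ) * (4/5 * (Q / (Nat.card k : ℝ) ^ deg p)) := by ring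
    rw [h2]
    apply mul_le_mul_of_nonneg_left _ (Nat.cast_nonneg _)
    linarith
  have h1 := (Finset.sum_le_sum hterm).trans hcb
  rw [← Finset.mul_sum] at h1
  set S := ∑ p ∈ h.Pr D, (deg p : ℝ) / (Nat.card k : ℝ)^deg p
  have h2 : 4/5 * S ≤ ((Nat.card k : ℝ) - 1) * (δ * m : ℕ) := by
    have : Q * (4/5 * S) ≤ Q * (((Nat.card k : ℝ) - 1) * (δ * m : ℕ)) := by linarith
    exact le_of_mul_le_mul_left this hQ0
  have h3 : ((δ * m : ℕ) : ℝ) ≤ 1/2 * D + (δ * n0 + δ) := by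
    have h4 : 2 * (δ * (D / (δ*δ))) ≤ D := by
      have : (δ*δ) * (D / (δ*δ)) ≤ D := Nat.mul_div_le _ _
      nlinarith [Nat.zero_le (δ * (D/(δ*δ)))]
    have h5 : (2:ℝ) * (δ * ((D / (δ*δ) : ℕ):ℝ)) ≤ D := by exact_mod_cast h4
    rw [hm, hi]
    rw [Nat.cast_mul, Nat.cast_add, Nat.cast_add, Nat.cast_one]
    linarith
  have h6 := mul_le_mul_of_nonneg_left h3 (show (0:ℝ) ≤ (Nat.card k : ℝ) - 1 by linarith)
  linarith

theorem delta_eq_one [Finite k] [IsPrincipalIdealRing B] (h : DegRing k B deg) (hq : 5 ≤ Nat.card k)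
    (hc : ∀ b : FractionRing B, (algebraMap k (FractionRing B)).IsIntegralElem b →
      ∃ c : k, algebraMap k (FractionRing B) c = b)
    {δ n0 : ℕ} (hδ0 : 0 < δ) (hδ : ∀ n, n0 ≤ n → h.l (n + δ) = h.l n + δ)
    (hed : ∀ b, δ ∣ deg b) : δ = 1 := by
  by_contra hne
  have hδ2 : 2 ≤ δ := by omega
  have hqR : (5:ℝ) ≤ Nat.card k := by exact_mod_cast hq
  set q : ℝ := (Nat.card k : ℝ) with hqdef
  have hq0 : 0 < q := by linarith
  set e : ℕ → ℝ := fun i => ((h.E i).card : ℝ) / q^i with hedef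
  set t : ℕ → ℝ := fun j => (h.Nt j : ℝ) / q^j / (q-1) with htdef
  have he0 : ∀ i, 0 ≤ e i := fun i => by positivity
  have hper : ∀ i, n0 < i → e (i + δ) = e i := by
    intro i hi
    obtain ⟨i, rfl⟩ := Nat.exists_eq_succ_of_ne_zero (show i ≠ 0 by omega)
    have h1 := h.card_E_succ i
    have h2 := h.card_E_succ (i + δ)
    rw [hδ i (by omega), show i + δ + 1 = i + 1 + δ by omega, hδ (i+1) (by omega)] at h2
    have h1R : ((h.E (i+1)).card : ℝ) + q ^ h.l i = q ^ h.l (i+1) := by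
      rw [hqdef]; exact_mod_cast h1
    have h2R : ((h.E (i+1+δ)).card : ℝ) + q ^ (h.l i + δ) = q ^ (h.l (i+1) + δ) := by
      rw [hqdef]; exact_mod_cast h2
    simp only [hedef, Nat.succ_eq_add_one]
    rw [div_eq_div_iff (by positivity) (by positivity)]
    rw [pow_add, pow_add] at h2R
    have h3 : ((h.E (i+1+δ)).card : ℝ) = (h.E (i+1)).card * q^δ := by linear_combination h2R - q^δ * h1R
    rw [h3, pow_add q (i+1) δ]; ring
  set N1 := δ * (n0 + 1) with hN1
  have hN1n : n0 < N1 := by nlinarith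
  set κ := e N1 with hκdef
  have hperm : ∀ j, e (N1 + δ * j) = κ := by
    intro j
    induction j with
    | zero => simp [hκdef]
    | succ j ih =>
      rw [mul_add, mul_one, ← add_assoc, hper _ (by omega), ih]
  have hκ : 0 < κ := by
    have h1 : (h.E N1).Nonempty := by
      have h2 := hδ (δ * n0) (by nlinarith)
      have h3 : ¬ (h.L (δ * n0 + δ) ≤ h.L (δ * n0)) := by
        intro hle
        have := h.L_fin (δ * n0)
        have := Submodule.finrank_mono hle
        unfold l at h2
        omega
      obtain ⟨b, hb1, hb2⟩ := Set.not_subset.1 h3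
      rw [SetLike.mem_coe, h.mem_L] at hb1 hb2
      refine ⟨b, (h.mem_E _ _).2 ⟨?_, ?_⟩⟩
      · rintro rfl; rw [h.zero] at hb2; omega
      · obtain ⟨c, hc⟩ := hed b
        rw [hc] at hb1 hb2 ⊢
        rw [hN1]
        congr 1
        have h5 : n0 < c := by
          by_contra h6
          exact hb2 (Nat.mul_le_mul_left _ (by omega))
        have h6 : c ≤ n0 + 1 := by
          have : δ * c ≤ δ * (n0 + 1) := by rw [mul_add, mul_one]; exact hb1
          exact Nat.le_of_mul_le_mul_left this hδ0
        omega
    have : 0 < (h.E N1).card := Finset.card_pos.2 h1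
    simp only [hκdef, hedef]
    positivity
  have hle : ∀ i, N1 ≤ i → e i ≤ κ := by
    intro i hi
    by_cases hd : δ ∣ i
    · obtain ⟨c, rfl⟩ := hd
      have h1 : n0 + 1 ≤ c := Nat.le_of_mul_le_mul_left hi hδ0
      obtain ⟨j, rfl⟩ := Nat.exists_eq_add_of_le h1
      rw [mul_add, hperm]
    · have h1 : h.E i = ∅ := by
        rw [Finset.eq_empty_iff_forall_notMem]
        intro b hb
        exact hd (((h.mem_E _ _).1 hb).2 ▸ hed b)
      simp only [hedef, h1, Finset.card_empty, Nat.cast_zero, zero_div]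
      exact hκ.le
  refine final_contra t e ?_ κ (25/16 * (δ * n0 + δ)) (κ + ∑ i ∈ Finset.range N1, e i) hκ
    (add_nonneg hκ.le (Finset.sum_nonneg (fun i _ => he0 i))) N1 (by omega) ?_ ?_ ?_ hle ?_
  · intro j
    have : 0 < q - 1 := by linarith
    positivity
  · intro n
    have h1 := h.T_le hq n
    have h2 := h.S_le hq hc hδ hδ2 hed n
    rw [← Finset.sum_div, div_le_iff₀ (by linarith)]
    refine h1.trans ?_
    linarith
  · intro n
    have h1 := h.recurrence n
    have h2 : (q - 1) * n * ((h.E n).card : ℝ) =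
        ∑ j ∈ Finset.Icc 1 n, (h.Nt j : ℝ) * ((h.E (n-j)).card : ℝ) := by
      have h3 := congrArg (Nat.cast (R := ℝ)) h1
      push_cast [Nat.cast_sub (show 1 ≤ Nat.card k by omega)] at h3
      exact h3
    have hq1 : q - 1 ≠ 0 := by linarith
    have h4 : (n:ℝ) * e n = ((q - 1) * n * ((h.E n).card : ℝ)) / (q^n * (q-1)) := by
      simp only [hedef]
      field_simp
    rw [h4, h2, Finset.sum_div]
    apply Finset.sum_congr rfl
    intro j hj
    rw [Finset.mem_Icc] at hj
    simp only [hedef, htdef]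
    have h5 : q^n = q^j * q^(n-j) := by rw [← pow_add]; congr 1; omega
    rw [h5]
    field_simp
  · intro i
    by_cases hi : N1 ≤ i
    · exact (hle i hi).trans (le_add_of_nonneg_right (Finset.sum_nonneg (fun i _ => he0 i)))
    · have := Finset.single_le_sum (f := e) (fun j _ => he0 j) (Finset.mem_range.2 (not_le.1 hi))
      linarith
  · intro m hm
    obtain ⟨j, rfl⟩ := Nat.exists_eq_add_of_le hm
    have : N1 * (1 + j) = N1 + δ * ((n0+1) * j) := by rw [hN1]; ring
    rw [this, hperm]

end DegRing
end

/-- For `q ≥ 5`, every uniformizationally rigid Drinfeldian domain over `Fq`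
is isomorphic as an `Fq`-algebra to the polynomial ring `Fq[T]`. -/
theorem uniformizationallyRigid_drinfeldian_iso_polynomial
    (Fq : Type*) [Field Fq] [Fintype Fq] (hq : 5 ≤ Fintype.card Fq)
    (B : Type*) [CommRing B] [IsDomain B] [Algebra Fq B]
    (hB : IsDrinfeldianDomain Fq B) (hrig : IsUniformizationallyRigid B) :
    Nonempty (B ≃ₐ[Fq] Polynomial Fq) := by
  classical
  have hq' : 5 ≤ Nat.card Fq := by rwa [Nat.card_eq_fintype_card]
  obtain ⟨V, ⟨hV1, hV2⟩, hVu⟩ := hB.unique_infinite_place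
  have hded := hB.isDedekind
  have hI : InfPlace Fq B V := by
    refine ⟨hV1, not_forall.1 hV2, ?_, ?_, hB.finiteType⟩
    · intro W hW hne
      by_contra hcon
      exact hne (hVu W ⟨hW, hcon⟩)
    · rintro b ⟨p, hp, hpb⟩
      have hcomp : (algebraMap B (FractionRing B)).comp (algebraMap Fq B) =
          algebraMap Fq (FractionRing B) := (IsScalarTower.algebraMap_eq Fq B (FractionRing B)).symm
      obtain ⟨c, hc⟩ := hB.algebraicallyClosed b ⟨p, hp.ne_zero, by rw [hcomp]; exact hpb⟩
      exact ⟨c, by rw [← hcomp]; exact hc⟩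
  obtain ⟨deg, h, hle⟩ := hI.exists_deg
  have hpid : IsPrincipalIdealRing B := Cusp.isPrincipalIdealRing hI h hle hrig
  obtain ⟨δ, hδ0, hdvd, n0, hδ⟩ := h.exists_delta
  have h1 : δ = 1 := h.delta_eq_one hq' hI.hc hδ0 hδ hdvd
  subst h1
  obtain ⟨K, hK⟩ := h.weil_bound n0 hδ
  obtain ⟨x, hx⟩ := h.exists_deg_one hq' n0 hδ K hK
  exact h.iso_of_deg_one (h.l_succ_le n0 hδ) x hx
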